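/- Let f be a smooth positive function on the closed unit disc and j a smooth positive function on the unit circle, and fix smooth initial data u₀ : closure B → ℝ and ρ₀ ∈ (0, π). Then there exist constants c, d > 0, depending only on f, j, u₀, ρ₀ and not on T, such that for every T ∈ (0, ∞] and every smooth solution (u, ρ) of the prescribed curvature flow on [0, T) with u(·,0) = u₀ and ρ(0) = ρ₀, there holds ∫_B e^{2u(·,t)} dz ≥ c and ∫_{∂B} e^{u(·,t)} ds₀ ≥ d for all 0 ≤ t < T. -/

import Mathlib

open MeasureTheory Metric Set Filter
open scoped Real Topology ENNReal

noncomputable section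

/-- The closed unit disc in `ℂ ≅ ℝ²`. -/
def cdisc : Set ℂ := Metric.closedBall 0 1

/-- The open unit disc `B`. -/
def odisc : Set ℂ := Metric.ball 0 1

/-- The unit circle `∂B`. -/
def bdry : Set ℂ := Metric.sphere 0 1

/-- The boundary point with angle `θ`. -/
def bpt (θ : ℝ) : ℂ := Complex.exp ((θ : ℂ) * Complex.I)

/-- Boundary integral with respect to arclength `ds₀`. -/
def circInt (φ : ℂ → ℝ) : ℝ := ∫ θ in (0:ℝ)..(2 * Real.pi), φ (bpt θ)

/-- Integral over the open unit disc with respect to Lebesgue measure. -/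
def ballInt (φ : ℂ → ℝ) : ℝ := ∫ z in odisc, φ z

/-- Outward normal derivative `∂w/∂ν₀(z) = z·∇w(z)` for `z ∈ ∂B`. -/
def nder (w : ℂ → ℝ) (z : ℂ) : ℝ := fderivWithin ℝ w cdisc z z

/-- The Euclidean Laplacian, computed with derivatives within the closed disc. -/
def lapW (w : ℂ → ℝ) (z : ℂ) : ℝ :=
  fderivWithin ℝ (fun x => fderivWithin ℝ w cdisc x 1) cdisc z 1 +
  fderivWithin ℝ (fun x => fderivWithin ℝ w cdisc x Complex.I) cdisc z Complex.I

/-- The coefficient `α(t) = 2ρ(t)/∫_B f e^{2u(·,t)} dz`. -/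
def alphaC (f : ℂ → ℝ) (u : ℂ → ℝ → ℝ) (ρ : ℝ → ℝ) (t : ℝ) : ℝ :=
  2 * ρ t / ballInt fun z => f z * Real.exp (2 * u z t)

/-- The coefficient `β(t) = 2(π − ρ(t))/∫_{∂B} j e^{u(·,t)} ds₀`. -/
def betaC (j : ℂ → ℝ) (u : ℂ → ℝ → ℝ) (ρ : ℝ → ℝ) (t : ℝ) : ℝ :=
  2 * (Real.pi - ρ t) / circInt fun z => j z * Real.exp (u z t)

/-- The time domain `[0, T)` (with `T ∈ (0, ∞]`). -/
def flowDom (T : ℝ≥0∞) : Set ℝ := {t : ℝ | 0 ≤ t ∧ ENNReal.ofReal t < T}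

/-- `(u, ρ)` is a smooth solution of the prescribed curvature flow on `[0, T)`:
`∂u/∂t = α f + e^{−2u} Δu` in `B`, `∂u/∂t = β j − e^{−u}(∂u/∂ν₀ + 1)` on `∂B`,
and `dρ/dt = log (β²/α)`, with `u` smooth on `closure B × [0,T)` and `ρ` C¹ with
values in `(0, π)`. -/
def IsFlow (f j : ℂ → ℝ) (T : ℝ≥0∞) (u : ℂ → ℝ → ℝ) (ρ : ℝ → ℝ) : Prop :=
  ContDiffOn ℝ (⊤ : ℕ∞) (fun p : ℂ × ℝ => u p.1 p.2) (cdisc ×ˢ flowDom T) ∧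
  ContDiffOn ℝ 1 ρ (flowDom T) ∧
  (∀ t ∈ flowDom T, ρ t ∈ Set.Ioo 0 Real.pi) ∧
  (∀ t ∈ flowDom T, 0 < t → ∀ z ∈ odisc,
    deriv (u z) t = alphaC f u ρ t * f z + Real.exp (-(2 * u z t)) * lapW (fun w => u w t) z) ∧
  (∀ t ∈ flowDom T, 0 < t → ∀ z ∈ bdry,
    deriv (u z) t = betaC j u ρ t * j z - Real.exp (-(u z t)) * (nder (fun w => u w t) z + 1)) ∧
  (∀ t ∈ flowDom T, 0 < t →
    deriv ρ t = Real.log (betaC j u ρ t ^ 2 / alphaC f u ρ t))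

lemma bpt_add_two_pi (θ : ℝ) : bpt (θ + 2 * π) = bpt θ := by
  simp [bpt, add_mul, Complex.exp_add, Complex.exp_two_pi_mul_I]

lemma continuous_bpt : Continuous bpt := by
  unfold bpt; fun_prop

lemma norm_bpt (θ : ℝ) : ‖bpt θ‖ = 1 := Complex.norm_exp_ofReal_mul_I θ

lemma bpt_mem_bdry (θ : ℝ) : bpt θ ∈ bdry := by simp [bdry, norm_bpt]

lemma bpt_re (θ : ℝ) : (bpt θ).re = Real.cos θ := by simp [bpt, Complex.exp_ofReal_mul_I_re]

lemma bpt_im (θ : ℝ) : (bpt θ).im = Real.sin θ := by simp [bpt, Complex.exp_ofReal_mul_I_im]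

lemma hasDerivAt_bpt (θ : ℝ) : HasDerivAt bpt (bpt θ * Complex.I) θ := by
  have h := ((Complex.ofRealCLM.hasDerivAt (x := θ)).mul_const Complex.I).cexp
  simp only [Complex.ofRealCLM_apply, Complex.ofReal_one, one_mul] at h
  exact h

lemma bdry_subset_cdisc : bdry ⊆ cdisc := sphere_subset_closedBall

lemma odisc_subset_cdisc : odisc ⊆ cdisc := ball_subset_closedBall

lemma circInt_eq_neg_pi (φ : ℂ → ℝ) : circInt φ = ∫ θ in (-π)..π, φ (bpt θ) := by
  have hp : Function.Periodic (fun θ => φ (bpt θ)) (2 * π) := fun θ => by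
    simp [bpt_add_two_pi]
  have := hp.intervalIntegral_add_eq 0 (-π)
  rw [zero_add] at this
  rw [circInt, this]
  congr 1; ring

lemma ballInt_eq_polar (D : ℂ → ℝ) (hD : ContinuousOn D cdisc) :
    ballInt D = ∫ r in (0:ℝ)..1, ∫ θ in (-π)..π, r * D (r * bpt θ) := by
  have h1 : ballInt D = ∫ p in polarCoord.target,
      p.1 • (odisc.indicator D) (Complex.polarCoord.symm p) := by
    rw [Complex.integral_comp_polarCoord_symm,
      integral_indicator (show MeasurableSet odisc from measurableSet_ball)]
    rfl
  have hpi : -π ≤ π := by linarith [Real.pi_pos]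
  have h2 : ∫ p in polarCoord.target, p.1 • (odisc.indicator D) (Complex.polarCoord.symm p) =
      ∫ p in Ioo (0:ℝ) 1 ×ˢ Ioo (-π) π, p.1 * D (p.1 * bpt p.2) := by
    have hsub : Ioo (0:ℝ) 1 ×ˢ Ioo (-π) π ⊆ polarCoord.target := by
      rintro ⟨r, θ⟩ ⟨h, h'⟩; exact ⟨h.1, h'⟩
    rw [setIntegral_eq_of_subset_of_forall_sdiff_eq_zero
      (polarCoord.open_target.measurableSet) hsub]
    · refine setIntegral_congr_fun (measurableSet_Ioo.prod measurableSet_Ioo) ?_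
      rintro ⟨r, θ⟩ ⟨h, h'⟩
      have e : Complex.polarCoord.symm (r, θ) = r * bpt θ := by
        simp [Complex.polarCoord_symm_apply, bpt, Complex.exp_mul_I]
      have hm : (r : ℂ) * bpt θ ∈ odisc := by
        simp only [odisc, mem_ball_zero_iff, norm_mul, norm_bpt, Complex.norm_real]
        simpa [abs_of_pos h.1] using h.2
      simp only [e, smul_eq_mul, indicator_of_mem hm]
    · rintro ⟨r, θ⟩ ⟨h, h'⟩
      have e : Complex.polarCoord.symm (r, θ) = r * bpt θ := by
        simp [Complex.polarCoord_symm_apply, bpt, Complex.exp_mul_I]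
      have h0 : 0 < r := h.1
      have hm : (r : ℂ) * bpt θ ∉ odisc := by
        simp only [odisc, mem_ball_zero_iff, norm_mul, norm_bpt, Complex.norm_real]
        intro hr
        rw [Real.norm_eq_abs, abs_of_pos h0, mul_one] at hr
        exact h' ⟨⟨h0, hr⟩, h.2⟩
      simp only [e, smul_eq_mul, indicator_of_notMem hm, mul_zero]
  have hcont : ContinuousOn (fun p : ℝ × ℝ => p.1 * D (p.1 * bpt p.2))
      (Icc (0:ℝ) 1 ×ˢ Icc (-π) π) := by
    refine continuousOn_fst.mul (hD.comp ?_ ?_)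
    · exact ((Complex.continuous_ofReal.comp continuous_fst).mul
        (continuous_bpt.comp continuous_snd)).continuousOn
    · rintro ⟨r, θ⟩ ⟨h, h'⟩
      simpa [cdisc, norm_bpt, abs_of_nonneg h.1] using h.2
  have hint : IntegrableOn (fun p : ℝ × ℝ => p.1 * D (p.1 * bpt p.2))
      (Ioc (0:ℝ) 1 ×ˢ Ioc (-π) π) (volume.prod volume) :=
    (hcont.integrableOn_compact (isCompact_Icc.prod isCompact_Icc)).mono_set
      (prod_mono Ioc_subset_Icc_self Ioc_subset_Icc_self)
  rw [h1, h2, intervalIntegral.integral_of_le zero_le_one]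
  simp_rw [intervalIntegral.integral_of_le hpi]
  rw [← setIntegral_prod _ hint]
  refine setIntegral_congr_set ?_
  exact Measure.set_prod_ae_eq Ioo_ae_eq_Ioc Ioo_ae_eq_Ioc

/-- The divergence theorem on the unit disc. -/
lemma divergence_disc (X : ℂ → ℂ) (X' : ℂ → ℂ →L[ℝ] ℂ) (D : ℂ → ℝ)
    (hc : ContinuousOn X cdisc) (hd : ∀ z ∈ odisc, HasFDerivAt X (X' z) z)
    (hD : ContinuousOn D cdisc)
    (h : ∀ z ∈ odisc, (X' z 1).re + (X' z Complex.I).im = D z) :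
    ballInt D = circInt (fun z => z.re * (X z).re + z.im * (X z).im) := by
  have hpi : -π ≤ π := by linarith [Real.pi_pos]
  -- polar components
  let ζ : ℝ × ℝ → ℂ := fun p => p.1 * bpt p.2
  let ζ' : ℝ × ℝ → ℝ × ℝ →L[ℝ] ℂ := fun p =>
    (ContinuousLinearMap.fst ℝ ℝ ℝ).smulRight (bpt p.2) +
      (ContinuousLinearMap.snd ℝ ℝ ℝ).smulRight (p.1 * (bpt p.2 * Complex.I))
  let e : ℝ × ℝ → ℂ := fun p => bpt (-p.2)
  have hζ : ∀ p, HasFDerivAt ζ (ζ' p) p := by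
    intro p
    have h1 : HasFDerivAt (fun p : ℝ × ℝ => (p.1 : ℂ))
        (Complex.ofRealCLM.comp (ContinuousLinearMap.fst ℝ ℝ ℝ)) p :=
      (Complex.ofRealCLM.hasFDerivAt).comp p hasFDerivAt_fst
    have h2 : HasFDerivAt (fun p : ℝ × ℝ => bpt p.2) _ p :=
      (hasDerivAt_bpt p.2).hasFDerivAt.comp p hasFDerivAt_snd
    refine (h1.mul h2).congr_fderiv ?_
    ext <;> simp [ζ']
  have he : ∀ p, HasFDerivAt e
      ((ContinuousLinearMap.snd ℝ ℝ ℝ).smulRight (-(bpt (-p.2) * Complex.I))) p := by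
    intro p
    have h0 : HasFDerivAt (fun p : ℝ × ℝ => -p.2) (-ContinuousLinearMap.snd ℝ ℝ ℝ) p :=
      (hasFDerivAt_snd (𝕜 := ℝ) (p := p)).neg
    have h2 := HasFDerivAt.comp (f := fun p : ℝ × ℝ => -p.2) p
      (hasDerivAt_bpt (-p.2)).hasFDerivAt h0
    refine h2.congr_fderiv ?_
    ext <;> simp
  let G : ℝ × ℝ → ℂ := fun p => e p * X (ζ p)
  let G' : ℝ × ℝ → ℝ × ℝ →L[ℝ] ℂ := fun p =>
    (e p) • ((X' (ζ p)).comp (ζ' p)) + (X (ζ p)) •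
      (ContinuousLinearMap.snd ℝ ℝ ℝ).smulRight (-(bpt (-p.2) * Complex.I))
  have hζm : ∀ p ∈ Icc (0:ℝ) 1 ×ˢ Icc (-π) π, ζ p ∈ cdisc := by
    rintro ⟨r, θ⟩ ⟨h, h'⟩
    simpa [ζ, cdisc, norm_bpt, abs_of_nonneg h.1] using h.2
  have hζo : ∀ p ∈ Ioo (0:ℝ) 1 ×ˢ Ioo (-π) π, ζ p ∈ odisc := by
    rintro ⟨r, θ⟩ ⟨h, h'⟩
    simpa [ζ, odisc, norm_bpt, abs_of_pos h.1] using h.2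
  have hG : ∀ p ∈ Ioo (0:ℝ) 1 ×ˢ Ioo (-π) π, HasFDerivAt G (G' p) p := fun p hp =>
    (he p).mul ((hd _ (hζo p hp)).comp p (hζ p))
  have hGc : ContinuousOn G (Icc (0:ℝ) 1 ×ˢ Icc (-π) π) := by
    refine ContinuousOn.mul ?_ (hc.comp ?_ hζm)
    · exact (continuous_bpt.comp continuous_snd.neg).continuousOn
    · exact fun p _ => (hζ p).continuousAt.continuousWithinAt
  have key : ∀ p ∈ Ioo (0:ℝ) 1 ×ˢ Ioo (-π) π,
      (p.1 • (Complex.reCLM.comp (G' p)) +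
        (Complex.reCLM (G p)) • (ContinuousLinearMap.fst ℝ ℝ ℝ)) (1, 0) +
        (Complex.imCLM.comp (G' p)) (0, 1) = p.1 * D (p.1 * bpt p.2) := by
    intro p hp
    have hD' := h _ (hζo p hp)
    have hlin : ∀ w : ℂ, X' (ζ p) w = w.re * X' (ζ p) 1 + w.im * X' (ζ p) Complex.I := by
      intro w
      conv_lhs => rw [show w = w.re • (1:ℂ) + w.im • Complex.I by simp [Complex.re_add_im]]
      rw [map_add, map_smul, map_smul]; simp
    change _ = p.1 * D (ζ p)
    rw [← hD']
    have hcs := Real.sin_sq_add_cos_sq p.2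
    simp [G', G, ζ', e, hlin (bpt p.2), hlin (p.1 * (bpt p.2 * Complex.I)), bpt_re, bpt_im]
    simp only [Complex.cos_ofReal_re, Complex.sin_ofReal_re]
    generalize X' (ζ p) 1 = U at *
    generalize X' (ζ p) Complex.I = W at *
    linear_combination (p.1 * (U.re + W.im)) * hcs
  have hDc : ContinuousOn (fun p : ℝ × ℝ => p.1 * D (p.1 * bpt p.2))
      (Icc (0:ℝ) 1 ×ˢ Icc (-π) π) :=
    continuousOn_fst.mul (hD.comp (fun p _ => (hζ p).continuousAt.continuousWithinAt) hζm)
  have hae : Icc (0:ℝ) 1 ×ˢ Icc (-π) π =ᵐ[volume] Ioo (0:ℝ) 1 ×ˢ Ioo (-π) π :=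
    (Measure.set_prod_ae_eq Ioo_ae_eq_Icc Ioo_ae_eq_Icc).symm
  have main := integral2_divergence_prod_of_hasFDerivAt (fun p => p.1 * (G p).re)
    (fun p => (G p).im)
    (fun p => p.1 • (Complex.reCLM.comp (G' p)) +
        (Complex.reCLM (G p)) • (ContinuousLinearMap.fst ℝ ℝ ℝ))
    (fun p => Complex.imCLM.comp (G' p)) 0 (-π) 1 π
    (by
      rw [uIcc_of_le zero_le_one, uIcc_of_le hpi]
      exact continuousOn_fst.mul (Complex.continuous_re.comp_continuousOn hGc))
    (by
      rw [uIcc_of_le zero_le_one, uIcc_of_le hpi]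
      exact (Complex.continuous_im.comp_continuousOn hGc))
    (by
      simp only [min_eq_left, max_eq_right, zero_le_one, hpi]
      intro p hp
      exact (hasFDerivAt_fst (𝕜 := ℝ) (p := p)).mul (Complex.reCLM.hasFDerivAt.comp p (hG p hp)))
    (by
      simp only [min_eq_left, max_eq_right, zero_le_one, hpi]
      intro p hp
      exact (Complex.imCLM.hasFDerivAt.comp p (hG p hp)))
    (by
      rw [uIcc_of_le zero_le_one, uIcc_of_le hpi]
      rw [integrableOn_congr_set_ae hae]
      refine IntegrableOn.congr_fun ((hDc.integrableOn_compact
        (isCompact_Icc.prod isCompact_Icc)).mono_set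
          (prod_mono Ioo_subset_Icc_self Ioo_subset_Icc_self))
          (fun p hp => (key p hp).symm) (measurableSet_Ioo.prod measurableSet_Ioo))
  have lhs : (∫ x in (0:ℝ)..1, ∫ y in (-π)..π,
      (((x, y) : ℝ × ℝ).1 • (Complex.reCLM.comp (G' (x, y))) +
        (Complex.reCLM (G (x, y))) • (ContinuousLinearMap.fst ℝ ℝ ℝ)) (1, 0) +
        (Complex.imCLM.comp (G' (x, y))) (0, 1)) =
      ∫ r in (0:ℝ)..1, ∫ θ in (-π)..π, r * D (r * bpt θ) := by
    rw [intervalIntegral.integral_of_le zero_le_one, intervalIntegral.integral_of_le zero_le_one,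
      integral_Ioc_eq_integral_Ioo, integral_Ioc_eq_integral_Ioo]
    refine setIntegral_congr_fun measurableSet_Ioo fun x hx => ?_
    simp only
    rw [intervalIntegral.integral_of_le hpi, intervalIntegral.integral_of_le hpi,
      integral_Ioc_eq_integral_Ioo, integral_Ioc_eq_integral_Ioo]
    exact setIntegral_congr_fun measurableSet_Ioo fun y hy => key (x, y) ⟨hx, hy⟩
  rw [ballInt_eq_polar D hD, ← lhs, main, circInt_eq_neg_pi]
  have hgg : ∀ x : ℝ, G (x, π) = G (x, -π) := by
    intro x
    have h1 : bpt π = bpt (-π) := by rw [← bpt_add_two_pi (-π)]; congr 1; ring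
    simp [G, e, ζ, h1]
  simp only [hgg, sub_self, zero_add, one_mul, zero_mul, intervalIntegral.integral_zero, sub_zero]
  refine intervalIntegral.integral_congr fun θ _ => ?_
  simp [G, e, ζ, bpt_re, bpt_im]

/-- Lebesgue measure on the unit disc. -/
def discM : Measure ℂ := volume.restrict odisc

/-- Arclength measure on the unit circle. -/
def circM : Measure ℂ := (volume.restrict (Ioc (0:ℝ) (2 * π))).map bpt

instance : IsFiniteMeasure discM :=
  ⟨by simp [discM, odisc, Complex.volume_ball]⟩

instance : IsFiniteMeasure circM := by
  unfold circM; infer_instance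

lemma isCompact_cdisc : IsCompact cdisc := isCompact_closedBall 0 1

lemma isCompact_bdry : IsCompact bdry := isCompact_sphere 0 1

lemma discM_compl : discM cdiscᶜ = 0 := by
  rw [discM, Measure.restrict_apply isCompact_cdisc.measurableSet.compl]
  convert measure_empty (μ := volume)
  exact (disjoint_compl_left_iff_subset.mpr odisc_subset_cdisc).inter_eq

lemma discM_ae : ∀ᵐ z ∂discM, z ∈ odisc := ae_restrict_mem measurableSet_ball

lemma circM_compl_bdry : circM bdryᶜ = 0 := by
  rw [circM, Measure.map_apply continuous_bpt.measurable isCompact_bdry.measurableSet.compl]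
  convert measure_empty (μ := (volume.restrict (Ioc (0:ℝ) (2 * π))))
  ext θ; simp [bpt_mem_bdry]

lemma circM_ae : ∀ᵐ z ∂circM, z ∈ bdry := circM_compl_bdry

lemma circM_compl : circM cdiscᶜ = 0 :=
  measure_mono_null (compl_subset_compl.mpr bdry_subset_cdisc) circM_compl_bdry

lemma integrable_of_continuousOn {α : Type*} [TopologicalSpace α] [MeasurableSpace α]
    [T2Space α] [SecondCountableTopology α] [OpensMeasurableSpace α]
    {ν : Measure α} [IsFiniteMeasure ν] {K : Set α} (hK : IsCompact K) (h : ν Kᶜ = 0)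
    {φ : α → ℝ} (hφ : ContinuousOn φ K) : Integrable φ ν := by
  have h1 : IntegrableOn φ K ν := hφ.integrableOn_compact hK
  rwa [IntegrableOn, Measure.restrict_eq_self_of_ae_mem (show ∀ᵐ x ∂ν, x ∈ K from h)] at h1

lemma integrable_discM {φ : ℂ → ℝ} (h : ContinuousOn φ cdisc) : Integrable φ discM :=
  integrable_of_continuousOn isCompact_cdisc discM_compl h

lemma integrable_circM {φ : ℂ → ℝ} (h : ContinuousOn φ bdry) : Integrable φ circM :=
  integrable_of_continuousOn isCompact_bdry circM_compl_bdry h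

lemma circInt_eq {φ : ℂ → ℝ} (h : ContinuousOn φ bdry) : circInt φ = ∫ z, φ z ∂circM := by
  rw [circInt, intervalIntegral.integral_of_le (by positivity), circM, integral_map
    continuous_bpt.measurable.aemeasurable]
  exact (integrable_circM h).1

lemma ballInt_eq (φ : ℂ → ℝ) : ballInt φ = ∫ z, φ z ∂discM := rfl

lemma discM_univ : discM.real univ = π := by
  simp [discM, odisc, Measure.real, Complex.volume_ball]

lemma circM_univ : circM.real univ = 2 * π := by
  have : circM univ = ENNReal.ofReal (2 * π) := by
    rw [circM, Measure.map_apply continuous_bpt.measurable MeasurableSet.univ]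
    simp
  rw [Measure.real, this, ENNReal.toReal_ofReal (by positivity)]

/-- The Euclidean inner product of `ℂ ≅ ℝ²`. -/
def rdot (z w : ℂ) : ℝ := z.re * w.re + z.im * w.im

@[fun_prop]
lemma continuous_rdot : Continuous (fun p : ℂ × ℂ => rdot p.1 p.2) := by
  unfold rdot; fun_prop

lemma rdot_comm (z w : ℂ) : rdot z w = rdot w z := by simp only [rdot]; ring

lemma rdot_add (z w w' : ℂ) : rdot z (w + w') = rdot z w + rdot z w' := by
  simp [rdot]; ring

lemma rdot_smul (z w : ℂ) (r : ℝ) : rdot z (r * w) = r * rdot z w := by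
  simp [rdot]; ring

lemma rdot_smul_left (z w : ℂ) (r : ℝ) : rdot (r * z) w = r * rdot z w := by
  simp [rdot]; ring

lemma rdot_self (z : ℂ) : rdot z z = ‖z‖ ^ 2 := by
  rw [Complex.sq_norm, Complex.normSq_apply, rdot]

lemma abs_rdot_le (z w : ℂ) : |rdot z w| ≤ ‖z‖ * ‖w‖ := by
  refine abs_le_of_sq_le_sq ?_ (by positivity)
  rw [mul_pow, Complex.sq_norm, Complex.sq_norm, Complex.normSq_apply, Complex.normSq_apply, rdot]
  nlinarith [sq_nonneg (z.re * w.im - z.im * w.re)]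

/-- The gradient within the closed disc. -/
def gradW (u : ℂ → ℝ) (z : ℂ) : ℂ :=
  ⟨fderivWithin ℝ u cdisc z 1, fderivWithin ℝ u cdisc z Complex.I⟩

lemma fderivWithin_apply_eq_rdot (u : ℂ → ℝ) (z w : ℂ) :
    fderivWithin ℝ u cdisc z w = rdot (gradW u z) w := by
  conv_lhs => rw [show w = w.re • (1:ℂ) + w.im • Complex.I by simp [Complex.re_add_im]]
  rw [map_add, map_smul, map_smul]; simp [gradW, rdot, mul_comm]

lemma uniqueDiffOn_cdisc : UniqueDiffOn ℝ cdisc :=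
  uniqueDiffOn_convex (convex_closedBall 0 1) (by
    rw [cdisc, interior_closedBall _ one_ne_zero]; exact ⟨0, by simp⟩)

lemma cdisc_mem_nhds {z : ℂ} (hz : z ∈ odisc) : cdisc ∈ 𝓝 z :=
  mem_of_superset (isOpen_ball.mem_nhds hz) odisc_subset_cdisc

lemma continuousOn_gradW {u : ℂ → ℝ} (hu : ContDiffOn ℝ 1 u cdisc) :
    ContinuousOn (gradW u) cdisc := by
  have h := hu.continuousOn_fderivWithin uniqueDiffOn_cdisc le_rfl
  have h1 : ContinuousOn (fun z => fderivWithin ℝ u cdisc z 1) cdisc :=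
    h.clm_apply continuousOn_const
  have h2 : ContinuousOn (fun z => fderivWithin ℝ u cdisc z Complex.I) cdisc :=
    h.clm_apply continuousOn_const
  have : gradW u = fun z => ((fderivWithin ℝ u cdisc z 1 : ℝ) : ℂ) +
      (fderivWithin ℝ u cdisc z Complex.I : ℝ) * Complex.I := by
    funext z
    apply Complex.ext <;> simp [gradW]
  rw [this]; fun_prop

lemma hasFDerivAt_of_contDiffOn {u : ℂ → ℝ} (hu : ContDiffOn ℝ 1 u cdisc) {z : ℂ}
    (hz : z ∈ odisc) : HasFDerivAt u (fderivWithin ℝ u cdisc z) z :=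
  ((hu.differentiableOn one_ne_zero z (odisc_subset_cdisc hz)).hasFDerivWithinAt).hasFDerivAt
    (cdisc_mem_nhds hz)

/-- Integration by parts on the disc against a vector field `Y` with divergence `d`. -/
lemma green {u : ℂ → ℝ} (hu : ContDiffOn ℝ 1 u cdisc) {Y : ℂ → ℂ} {Y' : ℂ → ℂ →L[ℝ] ℂ}
    {d : ℂ → ℝ} (hY : ContinuousOn Y cdisc) (hY' : ∀ z ∈ odisc, HasFDerivAt Y (Y' z) z)
    (hd : ContinuousOn d cdisc)
    (h : ∀ z ∈ odisc, (Y' z 1).re + (Y' z Complex.I).im = d z) :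
    ∫ z, rdot (gradW u z) (Y z) ∂discM + ∫ z, u z * d z ∂discM =
      ∫ z, u z * rdot z (Y z) ∂circM := by
  have hg := continuousOn_gradW hu
  have huc := hu.continuousOn
  have c1 : ContinuousOn (fun z => rdot (gradW u z) (Y z)) cdisc :=
    continuous_rdot.comp_continuousOn (hg.prodMk hY)
  have c2 : ContinuousOn (fun z => u z * d z) cdisc := huc.mul hd
  have c3 : ContinuousOn (fun z => u z * rdot z (Y z)) bdry :=
    (huc.mul (continuous_rdot.comp_continuousOn (continuousOn_id.prodMk hY))).mono
      bdry_subset_cdisc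
  rw [← integral_add (integrable_discM c1) (integrable_discM c2), ← ballInt_eq, ← circInt_eq c3]
  have := divergence_disc (fun z => (u z : ℂ) * Y z)
    (fun z => (u z : ℂ) • Y' z +
      (Y z) • (Complex.ofRealCLM.comp (fderivWithin ℝ u cdisc z)))
    (fun z => rdot (gradW u z) (Y z) + u z * d z)
    ((Complex.continuous_ofReal.comp_continuousOn huc).mul hY)
    (fun z hz => (Complex.ofRealCLM.hasFDerivAt.comp z (hasFDerivAt_of_contDiffOn hu hz)).mul
      (hY' z hz)) (c1.add c2)
    (fun z hz => by
      rw [← h z hz]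
      simp [rdot, gradW]
      ring)
  rw [this]
  congr 1; ext z; simp [rdot]; ring

/-- The linear functional `rdot G`. -/
def rdotL (G : ℂ) : ℂ →L[ℝ] ℝ := G.re • Complex.reCLM + G.im • Complex.imCLM

lemma rdotL_apply (G h : ℂ) : rdotL G h = rdot G h := by simp [rdotL, rdot]

/-- `g` has gradient `G` at `z`. -/
def HasGradAt (g : ℂ → ℝ) (G z : ℂ) : Prop := HasFDerivAt g (rdotL G) z

/-- `Y` is differentiable at `z` with divergence `d`. -/
def HasDivAt (Y : ℂ → ℂ) (d : ℝ) (z : ℂ) : Prop :=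
  ∃ Y' : ℂ →L[ℝ] ℂ, HasFDerivAt Y Y' z ∧ (Y' 1).re + (Y' Complex.I).im = d

lemma HasGradAt.comp {g : ℂ → ℝ} {G z : ℂ} (h : HasGradAt g G z) {φ : ℝ → ℝ} {φ' : ℝ}
    (hφ : HasDerivAt φ φ' (g z)) : HasGradAt (fun x => φ (g x)) (φ' * G) z := by
  refine (hφ.comp_hasFDerivAt z h).congr_fderiv ?_
  ext w; simp [rdotL]; ring

lemma HasGradAt.add {g k : ℂ → ℝ} {G K z : ℂ} (h : HasGradAt g G z) (h' : HasGradAt k K z) :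
    HasGradAt (fun x => g x + k x) (G + K) z := by
  refine (HasFDerivAt.add h h').congr_fderiv ?_
  ext w; simp [rdotL]; ring

lemma HasGradAt.gradW {g : ℂ → ℝ} {G z : ℂ} (h : HasGradAt g G z) (hz : z ∈ cdisc) :
    gradW g z = G := by
  have h1 : fderivWithin ℝ g cdisc z = rdotL G :=
    h.hasFDerivWithinAt.fderivWithin (uniqueDiffOn_cdisc z hz)
  apply Complex.ext <;> simp [_root_.gradW, h1, rdotL_apply, rdot]

lemma hasGradAt_gradW {u : ℂ → ℝ} (hu : ContDiffOn ℝ 1 u cdisc) {z : ℂ}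
    (hz : z ∈ odisc) : HasGradAt u (_root_.gradW u z) z := by
  refine (hasFDerivAt_of_contDiffOn hu hz).congr_fderiv ?_
  ext w; rw [rdotL_apply, fderivWithin_apply_eq_rdot]

lemma HasDivAt.add {Y Z : ℂ → ℂ} {d e : ℝ} {z : ℂ} (h : HasDivAt Y d z) (h' : HasDivAt Z e z) :
    HasDivAt (fun x => Y x + Z x) (d + e) z := by
  obtain ⟨Y', h1, h2⟩ := h
  obtain ⟨Z', h3, h4⟩ := h'
  exact ⟨Y' + Z', h1.add h3, by simp [← h2, ← h4]; ring⟩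

lemma HasDivAt.mul {Y : ℂ → ℂ} {d : ℝ} {z : ℂ} (h : HasDivAt Y d z) {g : ℂ → ℝ} {G : ℂ}
    (h' : HasGradAt g G z) : HasDivAt (fun x => (g x : ℂ) * Y x) (rdot G (Y z) + g z * d) z := by
  obtain ⟨Y', h1, h2⟩ := h
  refine ⟨_, (Complex.ofRealCLM.hasFDerivAt.comp z h').mul h1, ?_⟩
  simp [← h2, rdotL, rdot]; ring

lemma HasDivAt.congr {Y : ℂ → ℂ} {d e : ℝ} {z : ℂ} (h : HasDivAt Y d z) (h' : d = e) :
    HasDivAt Y e z := h' ▸ h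

lemma hasDivAt_affine (p : ℂ) (s : ℝ) (z : ℂ) : HasDivAt (fun x => p + s * x) (2 * s) z := by
  refine ⟨(s : ℂ) • ContinuousLinearMap.id ℝ ℂ, ?_, by simp; ring⟩
  exact ((hasFDerivAt_id z).const_mul (s : ℂ)).const_add p

/-- Integration by parts on the disc against a vector field `Y` with divergence `d`. -/
lemma green_div {u : ℂ → ℝ} (hu : ContDiffOn ℝ 1 u cdisc) {Y : ℂ → ℂ}
    {d : ℂ → ℝ} (hY : ContinuousOn Y cdisc) (hY' : ∀ z ∈ odisc, HasDivAt Y (d z) z)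
    (hd : ContinuousOn d cdisc) :
    ∫ z, rdot (gradW u z) (Y z) ∂discM + ∫ z, u z * d z ∂discM =
      ∫ z, u z * rdot z (Y z) ∂circM := by
  refine green hu (Y' := fderiv ℝ Y) hY (fun z hz => ?_) hd (fun z hz => ?_)
  · obtain ⟨Y', h1, h2⟩ := hY' z hz
    exact h1.differentiableAt.hasFDerivAt
  · obtain ⟨Y', h1, h2⟩ := hY' z hz
    rwa [h1.fderiv]

lemma gradW_one (z : ℂ) : gradW (fun _ => (1:ℝ)) z = 0 := by
  apply Complex.ext <;> simp [gradW]

/-- The divergence theorem on the disc. -/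
lemma integral_div {Y : ℂ → ℂ}
    {d : ℂ → ℝ} (hY : ContinuousOn Y cdisc) (hY' : ∀ z ∈ odisc, HasDivAt Y (d z) z)
    (hd : ContinuousOn d cdisc) :
    ∫ z, d z ∂discM = ∫ z, rdot z (Y z) ∂circM := by
  have := green_div (u := fun _ => 1) contDiffOn_const hY hY' hd
  simpa [gradW_one, rdot] using this

/-! ### Regularised Neumann kernels -/

/-- Regularised squared distance to `b`. -/
def Q1 (ε : ℝ) (b x : ℂ) : ℝ := ‖x - b‖ ^ 2 + ε ^ 2

/-- Regularised squared distance to the reflection of `b`, normalised. -/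
def Q2 (ε : ℝ) (b x : ℂ) : ℝ := ‖1 - (starRingEnd ℂ) b * x‖ ^ 2 + ε ^ 2

/-- Regularised Neumann kernel of the disc. -/
def Nk (ε : ℝ) (b x : ℂ) : ℝ := -(1 / 2) * Real.log (Q1 ε b x) - 1 / 2 * Real.log (Q2 ε b x)

/-- The gradient of `Nk`. -/
def Yk (ε : ℝ) (b x : ℂ) : ℂ :=
  ((Q1 ε b x)⁻¹ : ℝ) * (b + (-1 : ℝ) * x) + ((Q2 ε b x)⁻¹ : ℝ) * (b + (-‖b‖ ^ 2 : ℝ) * x)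

/-- Minus the divergence of `Yk`. -/
def kk (ε : ℝ) (b x : ℂ) : ℝ :=
  2 * ε ^ 2 / Q1 ε b x ^ 2 + 2 * ‖b‖ ^ 2 * ε ^ 2 / Q2 ε b x ^ 2

lemma norm_sq_eq (z : ℂ) : ‖z‖ ^ 2 = z.re ^ 2 + z.im ^ 2 := by
  rw [Complex.sq_norm, Complex.normSq_apply]; ring

section kernel
variable {ε : ℝ}

lemma Q1_pos (hε : 0 < ε) (b x : ℂ) : 0 < Q1 ε b x := by unfold Q1; positivity

lemma Q2_pos (hε : 0 < ε) (b x : ℂ) : 0 < Q2 ε b x := by unfold Q2; positivity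

@[fun_prop]
lemma continuous_Q1 (ε : ℝ) : Continuous (fun p : ℂ × ℂ => Q1 ε p.1 p.2) := by
  unfold Q1; fun_prop

@[fun_prop]
lemma continuous_Q2 (ε : ℝ) : Continuous (fun p : ℂ × ℂ => Q2 ε p.1 p.2) := by
  unfold Q2
  have := Complex.continuous_conj
  fun_prop

lemma continuous_Nk (hε : 0 < ε) : Continuous (fun p : ℂ × ℂ => Nk ε p.1 p.2) := by
  unfold Nk
  refine (continuous_const.mul ((continuous_Q1 ε).log fun p => (Q1_pos hε _ _).ne')).sub
    (continuous_const.mul ((continuous_Q2 ε).log fun p => (Q2_pos hε _ _).ne'))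

lemma continuous_Yk (hε : 0 < ε) : Continuous (fun p : ℂ × ℂ => Yk ε p.1 p.2) := by
  unfold Yk
  have h1 : Continuous fun p : ℂ × ℂ => (Q1 ε p.1 p.2)⁻¹ :=
    (continuous_Q1 ε).inv₀ fun p => (Q1_pos hε _ _).ne'
  have h2 : Continuous fun p : ℂ × ℂ => (Q2 ε p.1 p.2)⁻¹ :=
    (continuous_Q2 ε).inv₀ fun p => (Q2_pos hε _ _).ne'
  fun_prop

lemma continuous_kk (hε : 0 < ε) : Continuous (fun p : ℂ × ℂ => kk ε p.1 p.2) := by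
  unfold kk
  refine (continuous_const.div ((continuous_Q1 ε).pow 2) fun p => (pow_pos (Q1_pos hε _ _) 2).ne').add
    (Continuous.div (by fun_prop) ((continuous_Q2 ε).pow 2)
      fun p => (pow_pos (Q2_pos hε _ _) 2).ne')

lemma hasGradAt_normSq_affine (p q : ℂ) (c : ℝ) (x : ℂ) :
    HasGradAt (fun x => ‖p + q * x‖ ^ 2 + c) (2 * (starRingEnd ℂ) q * (p + q * x)) x := by
  have h1 : HasFDerivAt (fun x : ℂ => p + q * x) (q • ContinuousLinearMap.id ℝ ℂ) x :=
    ((hasFDerivAt_id x).const_mul q).const_add p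
  have h2 := (h1.norm_sq).add_const c
  refine h2.congr_fderiv ?_
  ext w
  simp [rdotL, Complex.inner]
  ring

lemma Q1_eq (ε : ℝ) (b x : ℂ) : Q1 ε b x = ‖-b + 1 * x‖ ^ 2 + ε ^ 2 := by
  rw [Q1]; congr 3; ring

lemma Q2_eq (ε : ℝ) (b x : ℂ) : Q2 ε b x = ‖1 + (-(starRingEnd ℂ) b) * x‖ ^ 2 + ε ^ 2 := by
  rw [Q2]; congr 3; ring

lemma hasGradAt_Q1 (ε : ℝ) (b x : ℂ) : HasGradAt (Q1 ε b) (2 * (x - b)) x := by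
  have := hasGradAt_normSq_affine (-b) 1 (ε ^ 2) x
  convert this using 1
  · funext y; exact Q1_eq ε b y
  · simp; ring

lemma mul_conj_eq (b : ℂ) : b * (starRingEnd ℂ) b = (‖b‖ ^ 2 : ℝ) := by
  rw [Complex.mul_conj, Complex.sq_norm]

lemma hasGradAt_Q2 (ε : ℝ) (b x : ℂ) :
    HasGradAt (Q2 ε b) (-2 * (b + (-‖b‖ ^ 2 : ℝ) * x)) x := by
  have := hasGradAt_normSq_affine 1 (-(starRingEnd ℂ) b) (ε ^ 2) x
  convert this using 1
  · funext y; exact Q2_eq ε b y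
  · rw [Complex.ofReal_neg, ← mul_conj_eq]; simp; ring

lemma hasGradAt_Nk (hε : 0 < ε) (b x : ℂ) : HasGradAt (Nk ε b) (Yk ε b x) x := by
  have h1 := (hasGradAt_Q1 ε b x).comp (φ := fun t => -(1 / 2) * Real.log t)
    ((Real.hasDerivAt_log (Q1_pos hε b x).ne').const_mul _)
  have h2 := (hasGradAt_Q2 ε b x).comp (φ := fun t => -(1 / 2) * Real.log t)
    ((Real.hasDerivAt_log (Q2_pos hε b x).ne').const_mul _)
  convert h1.add h2 using 1
  · funext y; simp only [Nk]; ring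
  · simp only [Yk]; push_cast; ring

lemma sq_aux2 (b x : ℂ) :
    ‖b + (-‖b‖ ^ 2 : ℝ) * x‖ ^ 2 = ‖b‖ ^ 2 * ‖1 - (starRingEnd ℂ) b * x‖ ^ 2 := by
  rw [← mul_pow, ← norm_mul]
  congr 2
  rw [Complex.ofReal_neg, ← mul_conj_eq]; ring

lemma hasDivAt_Yk (hε : 0 < ε) (b x : ℂ) : HasDivAt (Yk ε b) (-kk ε b x) x := by
  have p1 := Q1_pos hε b x
  have p2 := Q2_pos hε b x
  have h1 := (hasDivAt_affine b (-1) x).mul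
    ((hasGradAt_Q1 ε b x).comp (φ := fun t => t⁻¹) (hasDerivAt_inv p1.ne'))
  have h2 := (hasDivAt_affine b (-‖b‖ ^ 2) x).mul
    ((hasGradAt_Q2 ε b x).comp (φ := fun t => t⁻¹) (hasDerivAt_inv p2.ne'))
  refine (show HasDivAt (Yk ε b) _ x from h1.add h2).congr ?_
  have e1 : rdot (((-(Q1 ε b x ^ 2)⁻¹ : ℝ) : ℂ) * (2 * (x - b))) (b + ((-1:ℝ) : ℂ) * x) =
      2 * (Q1 ε b x ^ 2)⁻¹ * (Q1 ε b x - ε ^ 2) := by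
    rw [rdot_smul_left, show Q1 ε b x - ε ^ 2 = ‖x - b‖ ^ 2 by rw [Q1]; ring, norm_sq_eq]
    simp only [rdot, Complex.mul_re, Complex.mul_im, Complex.sub_re, Complex.sub_im, Complex.add_re,
      Complex.add_im, Complex.ofReal_re, Complex.ofReal_im, Complex.re_ofNat, Complex.im_ofNat]
    ring
  have e2 : rdot (((-(Q2 ε b x ^ 2)⁻¹ : ℝ) : ℂ) * (-2 * (b + (-‖b‖ ^ 2 : ℝ) * x)))
      (b + (-‖b‖ ^ 2 : ℝ) * x) = 2 * (Q2 ε b x ^ 2)⁻¹ * (‖b‖ ^ 2 * (Q2 ε b x - ε ^ 2)) := by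
    rw [show Q2 ε b x - ε ^ 2 = ‖1 - (starRingEnd ℂ) b * x‖ ^ 2 by rw [Q2]; ring, ← sq_aux2,
      ← rdot_self (b + _), rdot_smul_left, show (-2 : ℂ) = ((-2 : ℝ) : ℂ) by push_cast; rfl,
      rdot_smul_left]
    ring
  rw [e1, e2, kk]
  field_simp
  ring

lemma Q2_eq_Q1_add (ε : ℝ) (b x : ℂ) :
    Q2 ε b x = Q1 ε b x + (1 - ‖b‖ ^ 2) * (1 - ‖x‖ ^ 2) := by
  simp only [Q1, Q2, norm_sq_eq]; simp; ring

lemma rdot_Yk (hε : 0 < ε) (b : ℂ) {x : ℂ} (hx : x ∈ bdry) :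
    rdot x (Yk ε b x) = -1 + ε ^ 2 / Q1 ε b x := by
  have hn : ‖x‖ = 1 := by simpa [bdry] using hx
  have hq : Q2 ε b x = Q1 ε b x := by rw [Q2_eq_Q1_add, hn]; ring
  have hx2 : x.re ^ 2 + x.im ^ 2 = 1 := by rw [← norm_sq_eq, hn]; norm_num
  have p1 := Q1_pos hε b x
  rw [Yk, hq, rdot_add, rdot_smul, rdot_smul]
  have : rdot x (b + ((-1:ℝ) : ℂ) * x) + rdot x (b + (-‖b‖ ^ 2 : ℝ) * x) = -Q1 ε b x + ε ^ 2 := by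
    rw [Q1, norm_sq_eq (x - b)]
    have hb := norm_sq_eq b
    generalize ‖b‖ ^ 2 = n at *
    rw [rdot_add, rdot_add, rdot_smul, rdot_smul, rdot_self, hn]
    simp only [rdot, Complex.sub_re, Complex.sub_im]
    linear_combination hx2 - hb
  rw [← mul_add, this]; field_simp

lemma contDiff_Nk (hε : 0 < ε) (b : ℂ) : ContDiff ℝ 1 (Nk ε b) := by
  have h1 : ContDiff ℝ 1 (Q1 ε b) := by
    unfold Q1
    have h : ContDiff ℝ 1 fun x : ℂ => x - b := by fun_prop
    exact (h.norm_sq ℝ).add contDiff_const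
  have h2 : ContDiff ℝ 1 (Q2 ε b) := by
    unfold Q2
    have h : ContDiff ℝ 1 fun x : ℂ => 1 - (starRingEnd ℂ) b * x := by fun_prop
    exact (h.norm_sq ℝ).add contDiff_const
  have l1 : ContDiff ℝ 1 fun x => Real.log (Q1 ε b x) := h1.log fun x => (Q1_pos hε b x).ne'
  have l2 : ContDiff ℝ 1 fun x => Real.log (Q2 ε b x) := h2.log fun x => (Q2_pos hε b x).ne'
  unfold Nk
  exact (contDiff_const.mul l1).sub (contDiff_const.mul l2)

/-- Green's identity for the regularised Neumann kernel. -/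
lemma green_Yk (hε : 0 < ε) (b : ℂ) {u : ℂ → ℝ} (hu : ContDiffOn ℝ 1 u cdisc) :
    ∫ z, rdot (gradW u z) (Yk ε b z) ∂discM =
      ∫ z, u z * kk ε b z ∂discM + ∫ z, u z * (ε ^ 2 / Q1 ε b z) ∂circM - ∫ z, u z ∂circM := by
  have hk : Continuous (fun x => kk ε b x) :=
    Continuous.uncurry_left (f := kk ε) b (continuous_kk hε)
  have hY : Continuous (fun x => Yk ε b x) :=
    Continuous.uncurry_left (f := Yk ε) b (continuous_Yk hε)
  have hQ : Continuous (fun x => Q1 ε b x) :=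
    Continuous.uncurry_left (f := Q1 ε) b (continuous_Q1 ε)
  have h := green_div hu hY.continuousOn (d := fun x => -kk ε b x)
    (fun z _ => hasDivAt_Yk hε b z) hk.neg.continuousOn
  have hub := hu.continuousOn.mono bdry_subset_cdisc
  have h2 : ∫ z, u z * rdot z (Yk ε b z) ∂circM =
      ∫ z, u z * (ε ^ 2 / Q1 ε b z) ∂circM - ∫ z, u z ∂circM := by
    rw [← integral_sub]
    · refine integral_congr_ae ?_
      filter_upwards [circM_ae] with z hz
      rw [rdot_Yk hε b hz]; ring
    · exact integrable_circM (hub.mul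
        (continuous_const.div hQ fun x => (Q1_pos hε b x).ne').continuousOn)
    · exact integrable_circM hub
  rw [h2] at h
  simp only [mul_neg, integral_neg] at h
  linarith

end kernel

lemma exists_bound_integral_Q1 : ∃ K : ℝ, 0 ≤ K ∧ ∀ ε : ℝ, 0 < ε → ∀ b : ℂ,
    ∫ x, ε * (Q1 ε b x) ^ (-(3 / 2) : ℝ) ∂discM ≤ K := by
  have hg : Integrable (fun y : ℂ => ((1 : ℝ) + ‖y‖ ^ 2) ^ (-(3:ℝ) / 2)) :=
    integrable_rpow_neg_one_add_norm_sq (by rw [Complex.finrank_real_complex]; norm_num)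
  refine ⟨∫ y : ℂ, ((1 : ℝ) + ‖y‖ ^ 2) ^ (-(3:ℝ) / 2), integral_nonneg fun y => by positivity, ?_⟩
  intro ε hε b
  set g : ℂ → ℝ := fun y : ℂ => ((1 : ℝ) + ‖y‖ ^ 2) ^ (-(3:ℝ) / 2) with hgdef
  have hpt : ∀ x, ε * (Q1 ε b x) ^ (-(3 / 2) : ℝ) = (ε ^ 2)⁻¹ * g (ε⁻¹ • (x - b)) := by
    intro x
    have h1 : Q1 ε b x = ε ^ 2 * (1 + ‖ε⁻¹ • (x - b)‖ ^ 2) := by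
      rw [norm_smul, Q1, Real.norm_eq_abs, mul_pow, sq_abs]; field_simp; ring
    have h2 : (ε ^ 2) ^ (-(3 / 2) : ℝ) = (ε ^ 3)⁻¹ := by
      rw [← Real.rpow_natCast ε 2, ← Real.rpow_mul hε.le]
      rw [show ((2:ℕ):ℝ) * (-(3 / 2)) = -((3:ℕ):ℝ) by norm_num, Real.rpow_neg hε.le,
        Real.rpow_natCast]
    rw [h1, Real.mul_rpow (by positivity) (by positivity), h2, hgdef]
    simp only
    rw [show (-(3:ℝ) / 2) = -(3 / 2) by norm_num]
    field_simp
  have hint : Integrable (fun x : ℂ => g (ε⁻¹ • (x - b))) :=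
    (hg.comp_smul (inv_ne_zero hε.ne')).comp_sub_right b
  simp_rw [hpt]
  calc ∫ x, (ε ^ 2)⁻¹ * g (ε⁻¹ • (x - b)) ∂discM
      ≤ ∫ x, (ε ^ 2)⁻¹ * g (ε⁻¹ • (x - b)) :=
        setIntegral_le_integral (hint.const_mul _) (ae_of_all _ fun x => by
          simp only [Pi.zero_apply, hgdef]; positivity)
    _ = ∫ y, g y := by
        rw [integral_const_mul, integral_sub_right_eq_self (fun x => g (ε⁻¹ • x)) b,
          Measure.integral_comp_smul, Complex.finrank_real_complex, smul_eq_mul,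
          abs_of_pos (by positivity)]
        field_simp

/-- Integration against the measure `-div(∇N) dx + (∂N/∂ν + 1) ds` of total mass `2π`. -/
def kap (ε : ℝ) (b : ℂ) (φ : ℂ → ℝ) : ℝ :=
  ∫ z, φ z * kk ε b z ∂discM + ∫ z, φ z * (ε ^ 2 / Q1 ε b z) ∂circM

section
variable {ε : ℝ} {b : ℂ}

lemma continuous_kk_right (hε : 0 < ε) : Continuous (fun x => kk ε b x) :=
  Continuous.uncurry_left (f := kk ε) b (continuous_kk hε)

lemma continuous_Q1_right : Continuous (fun x => Q1 ε b x) :=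
  Continuous.uncurry_left (f := Q1 ε) b (continuous_Q1 ε)

lemma continuous_Yk_right (hε : 0 < ε) : Continuous (fun x => Yk ε b x) :=
  Continuous.uncurry_left (f := Yk ε) b (continuous_Yk hε)

lemma kap_integrable (hε : 0 < ε) {φ : ℂ → ℝ} (hφ : ContinuousOn φ cdisc) :
    Integrable (fun z => φ z * kk ε b z) discM ∧
      Integrable (fun z => φ z * (ε ^ 2 / Q1 ε b z)) circM :=
  ⟨integrable_discM (hφ.mul (continuous_kk_right hε).continuousOn),
    integrable_circM ((hφ.mono bdry_subset_cdisc).mul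
      (continuous_const.div continuous_Q1_right fun x => (Q1_pos hε b x).ne').continuousOn)⟩

lemma kk_nonneg (hε : 0 < ε) (x : ℂ) : 0 ≤ kk ε b x := by
  have := Q1_pos hε b x; have := Q2_pos hε b x; unfold kk; positivity

lemma kap_mono (hε : 0 < ε) {φ ψ : ℂ → ℝ} (hφ : ContinuousOn φ cdisc) (hψ : ContinuousOn ψ cdisc)
    (h : ∀ z ∈ cdisc, φ z ≤ ψ z) : kap ε b φ ≤ kap ε b ψ := by
  refine add_le_add (integral_mono_ae (kap_integrable hε hφ).1 (kap_integrable hε hψ).1 ?_)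
    (integral_mono_ae (kap_integrable hε hφ).2 (kap_integrable hε hψ).2 ?_)
  · filter_upwards [discM_ae] with z hz
    exact mul_le_mul_of_nonneg_right (h z (odisc_subset_cdisc hz)) (kk_nonneg hε z)
  · filter_upwards [circM_ae] with z hz
    have := Q1_pos hε b z
    exact mul_le_mul_of_nonneg_right (h z (bdry_subset_cdisc hz)) (by positivity)

lemma kap_add (hε : 0 < ε) {φ ψ : ℂ → ℝ} (hφ : ContinuousOn φ cdisc)
    (hψ : ContinuousOn ψ cdisc) :
    kap ε b (fun z => φ z + ψ z) = kap ε b φ + kap ε b ψ := by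
  simp only [kap, add_mul]
  rw [integral_add (kap_integrable hε hφ).1 (kap_integrable hε hψ).1,
    integral_add (kap_integrable hε hφ).2 (kap_integrable hε hψ).2]
  ring

lemma kap_const_mul (c : ℝ) (φ : ℂ → ℝ) :
    kap ε b (fun z => c * φ z) = c * kap ε b φ := by
  simp only [kap, mul_assoc, integral_const_mul]
  ring

lemma green_kap (hε : 0 < ε) {u : ℂ → ℝ} (hu : ContDiffOn ℝ 1 u cdisc) :
    ∫ z, rdot (gradW u z) (Yk ε b z) ∂discM = kap ε b u - ∫ z, u z ∂circM :=
  green_Yk hε b hu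

lemma kap_const (hε : 0 < ε) (c : ℝ) : kap ε b (fun _ => c) = 2 * π * c := by
  have h := green_kap (b := b) hε (u := fun _ => 1) contDiffOn_const
  have h2 := kap_const_mul (ε := ε) (b := b) c (fun _ => 1)
  simp [gradW_one, rdot, circM_univ] at h
  simp only [mul_one] at h2
  rw [h2]
  linear_combination (-c) * h

lemma kap_sqrt_le {K : ℝ} (hK : ∫ x, ε * (Q1 ε b x) ^ (-(3 / 2) : ℝ) ∂discM ≤ K)
    (hε : 0 < ε) (hb : b ∈ cdisc) :
    kap ε b (fun z => √(Q1 ε b z)) ≤ (4 * K + 2 * π) * ε := by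
  have hb' : ‖b‖ ≤ 1 := by simpa [cdisc] using hb
  have hc : ContinuousOn (fun z => √(Q1 ε b z)) cdisc :=
    (Real.continuous_sqrt.comp continuous_Q1_right).continuousOn
  have i1 : ∫ z, √(Q1 ε b z) * kk ε b z ∂discM ≤ ∫ z, 4 * ε * (ε * (Q1 ε b z) ^ (-(3 / 2) : ℝ)) ∂discM := by
    refine integral_mono_ae (kap_integrable hε hc).1 (integrable_discM ?_) ?_
    · exact (continuous_const.mul (continuous_const.mul (continuous_Q1_right.rpow_const
        fun x => Or.inl (Q1_pos hε b x).ne'))).continuousOn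
    · filter_upwards [discM_ae] with z hz
      have hz' : ‖z‖ < 1 := by simpa [odisc] using hz
      have p1 := Q1_pos hε b z
      have hQ : Q1 ε b z ≤ Q2 ε b z := by
        rw [Q2_eq_Q1_add]
        nlinarith [mul_nonneg (sub_nonneg.mpr (show ‖b‖ ^ 2 ≤ 1 by nlinarith [norm_nonneg b]))
          (sub_nonneg.mpr (show ‖z‖ ^ 2 ≤ 1 by nlinarith [norm_nonneg z]))]
      have hk : kk ε b z ≤ 4 * ε ^ 2 / Q1 ε b z ^ 2 := by
        have h3 : 2 * ‖b‖ ^ 2 * ε ^ 2 / Q2 ε b z ^ 2 ≤ 2 * ε ^ 2 / Q1 ε b z ^ 2 := by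
          refine div_le_div₀ (by positivity) ?_ (by positivity) (by gcongr)
          nlinarith [mul_nonneg (sub_nonneg.mpr (show ‖b‖ ^ 2 ≤ 1 by nlinarith [norm_nonneg b]))
            (sq_nonneg ε)]
        unfold kk
        calc _ ≤ 2 * ε ^ 2 / Q1 ε b z ^ 2 + 2 * ε ^ 2 / Q1 ε b z ^ 2 := by gcongr
          _ = _ := by ring
      have hr : (Q1 ε b z) ^ (-(3 / 2) : ℝ) = √(Q1 ε b z) / Q1 ε b z ^ 2 := by
        rw [Real.sqrt_eq_rpow, ← Real.rpow_natCast, ← Real.rpow_sub p1]; norm_num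
      calc √(Q1 ε b z) * kk ε b z ≤ √(Q1 ε b z) * (4 * ε ^ 2 / Q1 ε b z ^ 2) := by gcongr
        _ = 4 * ε * (ε * (Q1 ε b z) ^ (-(3 / 2) : ℝ)) := by rw [hr]; ring
  have i2 : ∫ z, √(Q1 ε b z) * (ε ^ 2 / Q1 ε b z) ∂circM ≤ ∫ z, ε ∂circM := by
    refine integral_mono (kap_integrable hε hc).2 (integrable_const _) fun z => ?_
    have p1 := Q1_pos hε b z
    have h1 : ε ≤ √(Q1 ε b z) := Real.le_sqrt_of_sq_le (by unfold Q1; nlinarith [sq_nonneg ‖z - b‖])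
    have h2 := Real.mul_self_sqrt p1.le
    simp only
    rw [mul_div_assoc', div_le_iff₀ p1]
    nlinarith [mul_le_mul_of_nonneg_left h1 (mul_pos hε (hε.trans_le h1)).le]
  rw [integral_const_mul] at i1
  rw [integral_const, circM_univ, smul_eq_mul] at i2
  have := mul_le_mul_of_nonneg_left hK (by positivity : 0 ≤ 4 * ε)
  unfold kap
  linarith

lemma norm_sub_le_sqrt_Q1 (x : ℂ) : ‖x - b‖ ≤ √(Q1 ε b x) :=
  Real.le_sqrt_of_sq_le (by unfold Q1; nlinarith [sq_nonneg ε])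

/-- Testing a Lipschitz function against the regularised Neumann kernel. -/
lemma abs_green_sub_le {K : ℝ} (hK : ∫ x, ε * (Q1 ε b x) ^ (-(3 / 2) : ℝ) ∂discM ≤ K)
    (hε : 0 < ε) (hb : b ∈ cdisc) {u : ℂ → ℝ} (hu : ContDiffOn ℝ 1 u cdisc) {Λ : ℝ} (hΛ : 0 ≤ Λ)
    (hL : ∀ x ∈ cdisc, |u x - u b| ≤ Λ * ‖x - b‖) :
    |∫ z, rdot (gradW u z) (Yk ε b z) ∂discM - (2 * π * u b - ∫ z, u z ∂circM)| ≤
      Λ * ((4 * K + 2 * π) * ε) := by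
  have hc : ContinuousOn (fun z => √(Q1 ε b z)) cdisc :=
    (Real.continuous_sqrt.comp continuous_Q1_right).continuousOn
  have hs := kap_sqrt_le hK hε hb
  have hsΛ := mul_le_mul_of_nonneg_left hs hΛ
  rw [← kap_const_mul] at hsΛ
  have hpt : ∀ x ∈ cdisc, |u x - u b| ≤ Λ * √(Q1 ε b x) := fun x hx =>
    (hL x hx).trans (mul_le_mul_of_nonneg_left (norm_sub_le_sqrt_Q1 x) hΛ)
  have hΛc : ContinuousOn (fun z => Λ * √(Q1 ε b z)) cdisc := continuousOn_const.mul hc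
  have h1 := kap_mono (b := b) hε hu.continuousOn (hΛc.add (continuousOn_const (c := u b)))
    (fun x hx => by have := (abs_le.mp (hpt x hx)).2; simp only [Pi.add_apply]; linarith)
  have h2 := kap_mono (b := b) hε (continuousOn_const (c := u b)) (hΛc.add hu.continuousOn)
    (fun x hx => by have := (abs_le.mp (hpt x hx)).1; simp only [Pi.add_apply]; linarith)
  have e1 := kap_add (b := b) hε hΛc (continuousOn_const (c := u b))
  have e2 := kap_add (b := b) hε hΛc hu.continuousOn
  have e3 := kap_const (b := b) hε (u b)
  change kap ε b u ≤ kap ε b (fun z => Λ * √(Q1 ε b z) + u b) at h1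
  change kap ε b (fun _ => u b) ≤ kap ε b (fun z => Λ * √(Q1 ε b z) + u z) at h2
  rw [green_kap hε hu, abs_le]
  constructor <;> linarith

lemma Nk_le_add (hε : 0 < ε) {b' x : ℂ} (hb : b ∈ cdisc) :
    Nk ε b x ≤ Nk ε b b' + Real.log 2 + 2 * (√(Q1 ε b' x) / ε) := by
  have hb1 : ‖b‖ ≤ 1 := by simpa [cdisc] using hb
  have q := Q1_pos hε b' x
  have ineq : ∀ s r p : ℝ, 0 ≤ s → 0 ≤ r → 0 ≤ p → p ≤ s + r →
      p ^ 2 + ε ^ 2 ≤ 2 * (s ^ 2 + ε ^ 2) * (r ^ 2 + ε ^ 2) / ε ^ 2 := by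
    intro s r p hs hr hp h
    rw [le_div_iff₀ (by positivity)]
    have : p ^ 2 ≤ 2 * s ^ 2 + 2 * r ^ 2 := by nlinarith [sq_nonneg (s - r)]
    nlinarith [mul_nonneg (sq_nonneg s) (sq_nonneg r), sq_nonneg (ε ^ 2), mul_le_mul_of_nonneg_right this (sq_nonneg ε)]
  have h1 : Q1 ε b b' ≤ 2 * Q1 ε b' x * Q1 ε b x / ε ^ 2 := by
    refine ineq _ _ _ (norm_nonneg _) (norm_nonneg _) (norm_nonneg _) ?_
    calc ‖b' - b‖ = ‖(b' - x) + (x - b)‖ := by congr 1; ring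
      _ ≤ ‖b' - x‖ + ‖x - b‖ := norm_add_le _ _
      _ = _ := by rw [norm_sub_rev]
  have h2 : Q2 ε b b' ≤ 2 * Q1 ε b' x * Q2 ε b x / ε ^ 2 := by
    refine ineq _ _ _ (norm_nonneg _) (norm_nonneg _) (norm_nonneg _) ?_
    calc ‖1 - (starRingEnd ℂ) b * b'‖
        = ‖(starRingEnd ℂ) b * (x - b') + (1 - (starRingEnd ℂ) b * x)‖ := by congr 1; ring
      _ ≤ ‖(starRingEnd ℂ) b * (x - b')‖ + ‖1 - (starRingEnd ℂ) b * x‖ := norm_add_le _ _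
      _ ≤ _ := by
        rw [norm_mul, RCLike.norm_conj]
        nlinarith [norm_nonneg (x - b')]
  have key : ∀ A B : ℝ, 0 < A → 0 < B → A ≤ 2 * Q1 ε b' x * B / ε ^ 2 →
      Real.log A ≤ Real.log 2 + 2 * (√(Q1 ε b' x) / ε) + Real.log B := by
    intro A B hA hB h
    have hs : 0 < √(Q1 ε b' x) / ε := div_pos (Real.sqrt_pos.mpr q) hε
    have e : 2 * Q1 ε b' x * B / ε ^ 2 = 2 * (√(Q1 ε b' x) / ε) ^ 2 * B := by
      rw [div_pow, Real.sq_sqrt q.le]; ring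
    have h3 := Real.log_le_log hA (e ▸ h)
    rw [Real.log_mul (by positivity) hB.ne', Real.log_mul (by norm_num) (by positivity),
      Real.log_pow] at h3
    have := Real.log_le_self hs.le
    push_cast at h3
    linarith
  have k1 := key _ _ (Q1_pos hε b b') (Q1_pos hε b x) h1
  have k2 := key _ _ (Q2_pos hε b b') (Q2_pos hε b x) h2
  unfold Nk
  linarith

lemma Q1_le_five (hε : 0 < ε) (hε1 : ε < 1) (hb : b ∈ cdisc) {x : ℂ} (hx : x ∈ cdisc) :
    Q1 ε b x ≤ 5 := by
  have hb1 : ‖b‖ ≤ 1 := by simpa [cdisc] using hb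
  have hx1 : ‖x‖ ≤ 1 := by simpa [cdisc] using hx
  have := norm_sub_le x b
  unfold Q1
  nlinarith [norm_nonneg (x - b)]

lemma Q2_le_five (hε : 0 < ε) (hε1 : ε < 1) (hb : b ∈ cdisc) {x : ℂ} (hx : x ∈ cdisc) :
    Q2 ε b x ≤ 5 := by
  have hb1 : ‖b‖ ≤ 1 := by simpa [cdisc] using hb
  have hx1 : ‖x‖ ≤ 1 := by simpa [cdisc] using hx
  have h1 := norm_sub_le 1 ((starRingEnd ℂ) b * x)
  have h2 : ‖(starRingEnd ℂ) b * x‖ ≤ 1 := by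
    rw [norm_mul, RCLike.norm_conj]; nlinarith [norm_nonneg x, norm_nonneg b]
  have h3 : ‖(1:ℂ)‖ = 1 := norm_one
  unfold Q2
  nlinarith [norm_nonneg (1 - (starRingEnd ℂ) b * x)]

lemma neg_Nk_le (hε : 0 < ε) (hε1 : ε < 1) (hb : b ∈ cdisc) {x : ℂ} (hx : x ∈ cdisc) :
    -Nk ε b x ≤ Real.log 5 := by
  have h1 := Real.log_le_log (Q1_pos hε b x) (Q1_le_five hε hε1 hb hx)
  have h2 := Real.log_le_log (Q2_pos hε b x) (Q2_le_five hε hε1 hb hx)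
  unfold Nk; linarith

/-- The mutual energy of two regularised Neumann kernels. -/
lemma integral_rdot_Yk_le {K : ℝ} {b' : ℂ}
    (hK : ∫ x, ε * (Q1 ε b' x) ^ (-(3 / 2) : ℝ) ∂discM ≤ K)
    (hε : 0 < ε) (hε1 : ε < 1) (hb : b ∈ cdisc) (hb' : b' ∈ cdisc) :
    ∫ z, rdot (Yk ε b z) (Yk ε b' z) ∂discM ≤
      2 * π * Nk ε b b' + (2 * π * Real.log 2 + 2 * (4 * K + 2 * π) + 2 * π * Real.log 5) := by
  have hN := (contDiff_Nk hε b).contDiffOn (s := cdisc)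
  have h := green_kap (b := b') hε hN
  have h1 : ∫ z, rdot (gradW (Nk ε b) z) (Yk ε b' z) ∂discM =
      ∫ z, rdot (Yk ε b z) (Yk ε b' z) ∂discM := by
    refine integral_congr_ae ?_
    filter_upwards [discM_ae] with z hz
    rw [(hasGradAt_Nk hε b z).gradW (odisc_subset_cdisc hz)]
  rw [← h1, h]
  have hc : ContinuousOn (fun z => √(Q1 ε b' z)) cdisc :=
    (Real.continuous_sqrt.comp continuous_Q1_right).continuousOn
  have hcc : ContinuousOn (fun z => 2 / ε * √(Q1 ε b' z)) cdisc := continuousOn_const.mul hc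
  have h2 : kap ε b' (Nk ε b) ≤
      kap ε b' (fun z => 2 / ε * √(Q1 ε b' z) + (Nk ε b b' + Real.log 2)) := by
    refine kap_mono hε hN.continuousOn (hcc.add continuousOn_const) fun x hx => ?_
    have := Nk_le_add (b := b) (b' := b') (x := x) hε hb
    calc _ ≤ _ := this
      _ = _ := by ring
  rw [kap_add hε hcc continuousOn_const, kap_const hε, kap_const_mul] at h2
  have h3 := mul_le_mul_of_nonneg_left (kap_sqrt_le hK hε hb') (by positivity : 0 ≤ 2 / ε)
  have e3 : 2 / ε * ((4 * K + 2 * π) * ε) = 2 * (4 * K + 2 * π) := by field_simp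
  have h4 : -∫ z, Nk ε b z ∂circM ≤ 2 * π * Real.log 5 := by
    rw [← integral_neg]
    calc _ ≤ ∫ z, Real.log 5 ∂circM := by
          refine integral_mono_ae (integrable_circM (hN.continuousOn.mono bdry_subset_cdisc)).neg
            (integrable_const _) ?_
          filter_upwards [circM_ae] with z hz
          exact neg_Nk_le hε hε1 hb (bdry_subset_cdisc hz)
      _ = _ := by rw [integral_const, circM_univ, smul_eq_mul]
  linarith

end

/-- The squared modulus of the denominator of a disc automorphism. -/
def dn (a x : ℂ) : ℝ := Q2 0 a x

/-- Minus the logarithm of the conformal factor of a disc automorphism. -/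
def pa (a x : ℂ) : ℝ := Real.log (dn a x) - Real.log (1 - ‖a‖ ^ 2)

/-- The conformal factor of a disc automorphism. -/
def wa (a x : ℂ) : ℝ := (1 - ‖a‖ ^ 2) / dn a x

/-- The disc automorphism sending `a` to the origin. -/
def Psi (a x : ℂ) : ℂ := (x - a) / (1 - (starRingEnd ℂ) a * x)

/-- The gradient of `pa`. -/
def Ga (a x : ℂ) : ℂ := ((dn a x)⁻¹ : ℝ) * ((-2 : ℝ) * a + (2 * ‖a‖ ^ 2 : ℝ) * x)

lemma dn_def (a x : ℂ) : dn a x = ‖1 - (starRingEnd ℂ) a * x‖ ^ 2 := by simp [dn, Q2]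

section mobius
variable {a : ℂ}

lemma one_sub_sq_pos (ha : a ∈ odisc) : 0 < 1 - ‖a‖ ^ 2 := by
  have : ‖a‖ < 1 := by simpa [odisc] using ha
  nlinarith [norm_nonneg a]

lemma one_sub_ne (ha : a ∈ odisc) {x : ℂ} (hx : x ∈ cdisc) : 1 - (starRingEnd ℂ) a * x ≠ 0 := by
  have h1 : ‖a‖ < 1 := by simpa [odisc] using ha
  have h2 : ‖x‖ ≤ 1 := by simpa [cdisc] using hx
  intro h
  have h3 : ‖(starRingEnd ℂ) a * x‖ = 1 := by rw [← sub_eq_zero.mp h, norm_one]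
  rw [norm_mul, RCLike.norm_conj] at h3
  nlinarith [norm_nonneg a, norm_nonneg x]

lemma dn_pos (ha : a ∈ odisc) {x : ℂ} (hx : x ∈ cdisc) : 0 < dn a x := by
  rw [dn_def]; have := norm_pos_iff.mpr (one_sub_ne ha hx); positivity

lemma wa_pos (ha : a ∈ odisc) {x : ℂ} (hx : x ∈ cdisc) : 0 < wa a x :=
  div_pos (one_sub_sq_pos ha) (dn_pos ha hx)

lemma exp_neg_pa (ha : a ∈ odisc) {x : ℂ} (hx : x ∈ cdisc) : Real.exp (-pa a x) = wa a x := by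
  rw [pa, neg_sub, Real.exp_sub, Real.exp_log (dn_pos ha hx), Real.exp_log (one_sub_sq_pos ha), wa]

lemma log_wa (ha : a ∈ odisc) {x : ℂ} (hx : x ∈ cdisc) : Real.log (wa a x) = -pa a x := by
  rw [← exp_neg_pa ha hx, Real.log_exp]

lemma hasGradAt_pa (ha : a ∈ odisc) {x : ℂ} (hx : x ∈ cdisc) : HasGradAt (pa a) (Ga a x) x := by
  have h := (hasGradAt_Q2 0 a x).comp (φ := fun t => Real.log t - Real.log (1 - ‖a‖ ^ 2))
    ((Real.hasDerivAt_log (dn_pos ha hx).ne').sub_const _)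
  have e : Ga a x = (((dn a x)⁻¹ : ℝ) : ℂ) * (-2 * (a + (-‖a‖ ^ 2 : ℝ) * x)) := by
    rw [Ga]; push_cast; ring
  rw [e]
  exact h

lemma hasDivAt_Ga (ha : a ∈ odisc) {x : ℂ} (hx : x ∈ cdisc) : HasDivAt (Ga a) 0 x := by
  have p2 := dn_pos ha hx
  have h := (hasDivAt_affine ((-2 : ℝ) * a) (2 * ‖a‖ ^ 2) x).mul
    ((hasGradAt_Q2 0 a x).comp (φ := fun t => t⁻¹) (hasDerivAt_inv (dn_pos ha hx).ne'))
  refine HasDivAt.congr h ?_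
  have e : (((-2 : ℝ) : ℂ) * a + ((2 * ‖a‖ ^ 2 : ℝ) : ℂ) * x) =
      ((-2 : ℝ) : ℂ) * (a + ((-‖a‖ ^ 2 : ℝ) : ℂ) * x) := by push_cast; ring
  have e2 : (-2 * (a + ((-‖a‖ ^ 2 : ℝ) : ℂ) * x)) = ((-2 : ℝ) : ℂ) * (a + ((-‖a‖ ^ 2 : ℝ) : ℂ) * x) := by
    push_cast; ring
  rw [e, e2, rdot_smul_left, rdot_smul_left, rdot_smul, rdot_self, sq_aux2, ← dn_def]
  change -(dn a x ^ 2)⁻¹ * _ + (dn a x)⁻¹ * _ = 0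
  field_simp
  ring

lemma contDiffOn_dn : ContDiffOn ℝ 1 (dn a) cdisc := by
  have : ContDiff ℝ 1 (dn a) := by
    unfold dn Q2
    exact ((contDiff_const.sub (contDiff_const.mul contDiff_id)).norm_sq ℝ).add contDiff_const
  exact this.contDiffOn

lemma contDiffOn_pa (ha : a ∈ odisc) : ContDiffOn ℝ 1 (pa a) cdisc :=
  (contDiffOn_dn.log fun _ hx => (dn_pos ha hx).ne').sub contDiffOn_const

lemma continuousOn_wa (ha : a ∈ odisc) : ContinuousOn (wa a) cdisc :=
  continuousOn_const.div contDiffOn_dn.continuousOn fun _ hx => (dn_pos ha hx).ne'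

lemma gradW_pa (ha : a ∈ odisc) {x : ℂ} (hx : x ∈ cdisc) : gradW (pa a) x = Ga a x := (hasGradAt_pa ha hx).gradW hx

lemma continuousOn_Ga (ha : a ∈ odisc) : ContinuousOn (Ga a) cdisc :=
  (continuousOn_gradW (contDiffOn_pa ha)).congr fun _ hx => (gradW_pa ha hx).symm

lemma continuousOn_Psi (ha : a ∈ odisc) : ContinuousOn (Psi a) cdisc := by
  unfold Psi
  exact ContinuousOn.div (by fun_prop) (by fun_prop) fun _ hx => one_sub_ne ha hx

lemma rdot_Ga (ha : a ∈ odisc) {x : ℂ} (hx : x ∈ bdry) : rdot x (Ga a x) = 1 - wa a x := by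
  have p := dn_pos ha (bdry_subset_cdisc hx)
  have hn : ‖x‖ = 1 := by simpa [bdry] using hx
  have hx2 : x.re ^ 2 + x.im ^ 2 = 1 := by rw [← norm_sq_eq, hn]; norm_num
  have e : dn a x = 1 + ‖a‖ ^ 2 - 2 * rdot a x := by
    rw [dn_def, norm_sq_eq, norm_sq_eq]; simp [rdot]; linear_combination (a.re ^ 2 + a.im ^ 2) * hx2
  rw [Ga, rdot_smul, rdot_add, rdot_smul, rdot_smul, rdot_self, hn, wa, rdot_comm x a]
  field_simp
  rw [e]; ring

lemma harmonicOnNhd_log_dn (ha : a ∈ odisc) :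
    InnerProductSpace.HarmonicOnNhd (fun x => Real.log ‖1 - (starRingEnd ℂ) a * x‖) cdisc := by
  intro x hx
  exact AnalyticAt.harmonicAt_log_norm (by fun_prop) (one_sub_ne ha hx)

lemma circleAverage_eq_integral {φ : ℂ → ℝ} (h : ContinuousOn φ bdry) :
    2 * π * Real.circleAverage φ 0 1 = ∫ x, φ x ∂circM := by
  rw [← circInt_eq h, Real.circleAverage_def, circInt, smul_eq_mul, mul_inv_cancel_left₀ (by positivity)]
  simp [circleMap, bpt]

lemma log_dn (x : ℂ) : Real.log (dn a x) = 2 * Real.log ‖1 - (starRingEnd ℂ) a * x‖ := by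
  rw [dn_def, Real.log_pow]; norm_num

lemma integral_pa (ha : a ∈ odisc) : ∫ x, pa a x ∂circM = -2 * π * Real.log (1 - ‖a‖ ^ 2) := by
  have hc : ContinuousOn (fun x => Real.log ‖1 - (starRingEnd ℂ) a * x‖) bdry :=
    ((harmonicOnNhd_log_dn ha).continuousOn).mono bdry_subset_cdisc
  have h := (harmonicOnNhd_log_dn ha)
  rw [cdisc, ← abs_one (α := ℝ)] at h
  have h2 := h.circleAverage_eq
  have h3 := circleAverage_eq_integral hc
  rw [h2] at h3
  simp only [pa, log_dn]
  rw [integral_sub ((integrable_circM hc).const_mul 2) (integrable_const _), integral_const_mul, ← h3]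
  simp [circM_univ]

lemma integral_wa_circ (ha : a ∈ odisc) : ∫ x, wa a x ∂circM = 2 * π := by
  have h := integral_div (continuousOn_Ga ha) (d := fun _ => 0)
    (fun x hx => hasDivAt_Ga ha (odisc_subset_cdisc hx)) continuousOn_const
  rw [integral_zero] at h
  have h2 : ∫ x, rdot x (Ga a x) ∂circM = ∫ x, (1 - wa a x) ∂circM :=
    integral_congr_ae (circM_ae.mono fun x hx => rdot_Ga ha hx)
  rw [h2, integral_sub (integrable_const _)
    (integrable_circM ((continuousOn_wa ha).mono bdry_subset_cdisc))] at h
  simp [circM_univ] at h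
  linarith

lemma integral_pa_mul_wa (ha : a ∈ odisc) : ∫ x, pa a x * wa a x ∂circM = 2 * π * Real.log (1 - ‖a‖ ^ 2) := by
  have hb := ((continuousOn_wa ha).mono bdry_subset_cdisc)
  have hc : ContinuousOn (fun x => Real.log ‖1 - (starRingEnd ℂ) a * x‖) bdry :=
    ((harmonicOnNhd_log_dn ha).continuousOn).mono bdry_subset_cdisc
  have hk : ∀ x ∈ bdry, poissonKernel 0 a x = wa a x := by
    intro x hx
    have hn : ‖x‖ = 1 := by simpa [bdry] using hx
    have hx2 : x.re ^ 2 + x.im ^ 2 = 1 := by rw [← norm_sq_eq, hn]; norm_num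
    rw [poissonKernel, wa, dn_def, sub_zero, sub_zero, hn, one_pow]
    congr 1
    rw [norm_sq_eq, norm_sq_eq]; simp
    linear_combination (1 - a.re ^ 2 - a.im ^ 2) * hx2
  have h := (harmonicOnNhd_log_dn ha).circleAverage_poissonKernel_smul ha
  have hw : ContinuousOn (poissonKernel 0 a • fun x => Real.log ‖1 - (starRingEnd ℂ) a * x‖) bdry :=
    (hb.congr hk).mul hc
  have h3 := circleAverage_eq_integral hw
  rw [h] at h3
  have h4 : ∫ x, (poissonKernel 0 a • fun x => Real.log ‖1 - (starRingEnd ℂ) a * x‖) x ∂circM =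
      ∫ x, wa a x * Real.log ‖1 - (starRingEnd ℂ) a * x‖ ∂circM :=
    integral_congr_ae (circM_ae.mono fun x hx => by simp [hk x hx])
  have h5 : ‖1 - (starRingEnd ℂ) a * a‖ = 1 - ‖a‖ ^ 2 := by
    rw [mul_comm, mul_conj_eq, ← Complex.ofReal_one, ← Complex.ofReal_sub, Complex.norm_real,
      Real.norm_of_nonneg (one_sub_sq_pos ha).le]
  rw [h4, h5] at h3
  have h6 : ∀ x, pa a x * wa a x = 2 * (wa a x * Real.log ‖1 - (starRingEnd ℂ) a * x‖) -
      Real.log (1 - ‖a‖ ^ 2) * wa a x := by intro x; rw [pa, log_dn]; ring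
  simp only [h6]
  have hi : Integrable (fun x => wa a x * Real.log ‖1 - (starRingEnd ℂ) a * x‖) circM :=
    integrable_circM (hb.mul hc)
  rw [integral_sub (hi.const_mul 2) ((integrable_circM hb).const_mul _), integral_const_mul,
    integral_const_mul, integral_wa_circ ha, ← h3]
  ring

lemma integral_grad_Ga (ha : a ∈ odisc) {u : ℂ → ℝ} (hu : ContDiffOn ℝ 1 u cdisc) :
    ∫ x, rdot (gradW u x) (Ga a x) ∂discM = ∫ x, u x ∂circM - ∫ x, u x * wa a x ∂circM := by
  have h := green_div hu (continuousOn_Ga ha) (d := fun _ => 0)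
    (fun x hx => hasDivAt_Ga ha (odisc_subset_cdisc hx)) continuousOn_const
  simp only [mul_zero, integral_zero, add_zero] at h
  have hb := hu.continuousOn.mono bdry_subset_cdisc
  have hi : Integrable (fun x => u x * wa a x) circM :=
    integrable_circM (hb.mul ((continuousOn_wa ha).mono bdry_subset_cdisc))
  rw [h, ← integral_sub (integrable_circM hb) hi]
  exact integral_congr_ae (circM_ae.mono fun x hx => by
    simp only [rdot_Ga ha hx]; ring)

lemma integral_Ga_sq (ha : a ∈ odisc) :
    ∫ x, rdot (Ga a x) (Ga a x) ∂discM = -4 * π * Real.log (1 - ‖a‖ ^ 2) := by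
  have h := integral_grad_Ga ha (contDiffOn_pa ha)
  rw [integral_pa ha, integral_pa_mul_wa ha] at h
  rw [← integral_congr_ae (f := fun x => rdot (gradW (pa a) x) (Ga a x))
    (discM_ae.mono fun x hx => by simp only [gradW_pa ha (odisc_subset_cdisc hx)]), h]
  ring

end mobius

lemma exists_lipschitz {u : ℂ → ℝ} (hu : ContDiffOn ℝ 1 u cdisc) :
    ∃ Λ : ℝ, 0 ≤ Λ ∧ ∀ x ∈ cdisc, ∀ y ∈ cdisc, |u x - u y| ≤ Λ * ‖x - y‖ := by
  have h := hu.continuousOn_fderivWithin uniqueDiffOn_cdisc le_rfl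
  obtain ⟨Λ, hΛ⟩ := isCompact_cdisc.exists_bound_of_continuousOn h
  refine ⟨max Λ 0, le_max_right _ _, fun x hx y hy => ?_⟩
  exact (convex_closedBall (0:ℂ) 1).norm_image_sub_le_of_norm_fderivWithin_le
    (hu.differentiableOn one_ne_zero) (fun z hz => (hΛ z hz).trans (le_max_left _ _)) hy hx

section fubini
variable {α β : Type*} [TopologicalSpace α] [MeasurableSpace α]
    [T2Space α] [SecondCountableTopology α] [OpensMeasurableSpace α]
    [TopologicalSpace β] [MeasurableSpace β]
    [T2Space β] [SecondCountableTopology β] [OpensMeasurableSpace β]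
    {μ : Measure α} [IsFiniteMeasure μ] {ν : Measure β} [IsFiniteMeasure ν] {K : Set α} {K' : Set β}

lemma prod_compl_eq_zero {α β : Type*} [MeasurableSpace α] [MeasurableSpace β] {μ : Measure α}
    {ν : Measure β} [SFinite ν] {K : Set α} {K' : Set β} (h : μ Kᶜ = 0) (h' : ν K'ᶜ = 0) :
    (μ.prod ν) (K ×ˢ K')ᶜ = 0 := by
  have h1 : ∀ᵐ q ∂(μ.prod ν), q.1 ∈ K := Measure.quasiMeasurePreserving_fst.ae h
  have h2 : ∀ᵐ q ∂(μ.prod ν), q.2 ∈ K' := Measure.quasiMeasurePreserving_snd.ae h'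
  have h3 : ∀ᵐ q ∂(μ.prod ν), q ∈ K ×ˢ K' := by
    filter_upwards [h1, h2] with q a b using ⟨a, b⟩
  exact h3

lemma integrable_prod_of_continuousOn (hK : IsCompact K) (hK' : IsCompact K') (h : μ Kᶜ = 0)
    (h' : ν K'ᶜ = 0) {F : α × β → ℝ} (hF : ContinuousOn F (K ×ˢ K')) :
    Integrable F (μ.prod ν) :=
  integrable_of_continuousOn (hK.prod hK') (prod_compl_eq_zero h h') hF

end fubini

lemma integrable_and_integral_lin {α : Type*} [MeasurableSpace α] {M : Measure α}
    [IsProbabilityMeasure M] {F G H : α → ℝ} (hF : Integrable F M) (hG : Integrable G M)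
    (hH : Integrable H M) (c₁ c₂ c₃ d : ℝ) :
    Integrable (fun q => c₁ * F q + c₂ * G q + c₃ * H q + d) M ∧
    ∫ q, (c₁ * F q + c₂ * G q + c₃ * H q + d) ∂M =
      c₁ * ∫ q, F q ∂M + c₂ * ∫ q, G q ∂M + c₃ * ∫ q, H q ∂M + d := by
  have i2 : Integrable (fun q => c₁ * F q + c₂ * G q) M := (hF.const_mul _).add (hG.const_mul _)
  have i3 : Integrable (fun q => c₁ * F q + c₂ * G q + c₃ * H q) M := i2.add (hH.const_mul _)
  refine ⟨i3.add (integrable_const _), ?_⟩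
  rw [integral_add i3 (integrable_const _), integral_add i2 (hH.const_mul _),
    integral_add (hF.const_mul _) (hG.const_mul _), integral_const_mul,
    integral_const_mul, integral_const_mul]
  simp

section measure
variable {μ : Measure ℂ} [IsProbabilityMeasure μ]

lemma sub_half_double_le (hμ : μ cdiscᶜ = 0) {Z : ℂ → ℂ} (hZ : ContinuousOn Z cdisc) (G : ℂ) :
    ∫ b, rdot G (Z b) ∂μ - 1 / 2 * ∫ q, rdot (Z q.1) (Z q.2) ∂(μ.prod μ) ≤ 1 / 2 * rdot G G := by
  have i1 : Integrable (fun b => (Z b).re) μ := integrable_of_continuousOn isCompact_cdisc hμ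
    (Complex.continuous_re.comp_continuousOn hZ)
  have i2 : Integrable (fun b => (Z b).im) μ := integrable_of_continuousOn isCompact_cdisc hμ
    (Complex.continuous_im.comp_continuousOn hZ)
  simp only [rdot]
  rw [integral_add (i1.const_mul _) (i2.const_mul _), integral_const_mul, integral_const_mul,
    integral_add (i1.mul_prod i1) (i2.mul_prod i2),
    integral_prod_mul (fun b => (Z b).re) (fun b => (Z b).re),
    integral_prod_mul (fun b => (Z b).im) (fun b => (Z b).im)]
  nlinarith [sq_nonneg (G.re - ∫ b, (Z b).re ∂μ), sq_nonneg (G.im - ∫ b, (Z b).im ∂μ)]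

/-- Lower bound for the Dirichlet energy by testing with a superposition of vector fields. -/
lemma dirichlet_ge (hμ : μ cdiscᶜ = 0) {G : ℂ → ℂ} (hG : ContinuousOn G cdisc) {Z : ℂ → ℂ → ℂ}
    (hZ : ContinuousOn (fun q : ℂ × ℂ => Z q.1 q.2) (cdisc ×ˢ cdisc)) :
    (∫ b, ∫ z, rdot (G z) (Z b z) ∂discM ∂μ) -
      1 / 2 * ∫ q, (∫ z, rdot (Z q.1 z) (Z q.2 z) ∂discM) ∂(μ.prod μ) ≤
      1 / 2 * ∫ z, rdot (G z) (G z) ∂discM := by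
  have hc : ∀ F : ℂ × ℂ → ℂ, ∀ H : ℂ × ℂ → ℂ, ContinuousOn F (cdisc ×ˢ cdisc) →
      ContinuousOn H (cdisc ×ˢ cdisc) →
      ContinuousOn (fun q => rdot (F q) (H q)) (cdisc ×ˢ cdisc) := fun F H hF hH =>
    continuous_rdot.comp_continuousOn (hF.prodMk hH)
  have j1 : Integrable (fun q : ℂ × ℂ => rdot (G q.2) (Z q.1 q.2)) (μ.prod discM) :=
    integrable_prod_of_continuousOn isCompact_cdisc isCompact_cdisc hμ discM_compl
      (hc _ _ (hG.comp continuousOn_snd fun q hq => hq.2) hZ)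
  have hK2 : IsCompact (cdisc ×ˢ cdisc) := isCompact_cdisc.prod isCompact_cdisc
  have j2 : Integrable (fun q : (ℂ × ℂ) × ℂ => rdot (Z q.1.1 q.2) (Z q.1.2 q.2))
      ((μ.prod μ).prod discM) := by
    refine integrable_prod_of_continuousOn hK2 isCompact_cdisc
      (prod_compl_eq_zero hμ hμ) discM_compl ?_
    refine continuous_rdot.comp_continuousOn (ContinuousOn.prodMk ?_ ?_)
    · exact hZ.comp (f := fun q : (ℂ × ℂ) × ℂ => (q.1.1, q.2)) (by fun_prop)
        fun q hq => ⟨hq.1.1, hq.2⟩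
    · exact hZ.comp (f := fun q : (ℂ × ℂ) × ℂ => (q.1.2, q.2)) (by fun_prop)
        fun q hq => ⟨hq.1.2, hq.2⟩
  have j3 : Integrable (fun z => rdot (G z) (G z)) discM :=
    integrable_discM (continuous_rdot.comp_continuousOn (hG.prodMk hG))
  rw [integral_integral_swap (f := fun b z => rdot (G z) (Z b z)) j1,
    integral_integral_swap (f := fun (q : ℂ × ℂ) z => rdot (Z q.1 z) (Z q.2 z)) j2,
    ← integral_const_mul, ← integral_const_mul,
    ← integral_sub j1.integral_prod_right (j2.integral_prod_right.const_mul _)]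
  refine integral_mono_ae (j1.integral_prod_right.sub (j2.integral_prod_right.const_mul _))
    (j3.const_mul _) ?_
  filter_upwards [discM_ae] with z hz
  exact sub_half_double_le hμ (Z := fun b => Z b z)
    (hZ.comp (f := fun b : ℂ => (b, z)) (by fun_prop) fun b hb => ⟨hb, odisc_subset_cdisc hz⟩) (G z)

end measure

/-- The Dirichlet energy of `u` plus its boundary mean. -/
def En (u : ℂ → ℝ) : ℝ := 1 / 2 * ∫ z, rdot (gradW u z) (gradW u z) ∂discM + ∫ z, u z ∂circM

/-- The test field. -/
def Zf (ε : ℝ) (a b z : ℂ) : ℂ := ((9 / 8 : ℝ) : ℂ) * Yk ε b z + ((1 / 8 : ℝ) : ℂ) * Ga a z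

lemma continuousOn_Zf {ε : ℝ} (hε : 0 < ε) {a : ℂ} (ha : a ∈ odisc) :
    ContinuousOn (fun q : ℂ × ℂ => Zf ε a q.1 q.2) (cdisc ×ˢ cdisc) :=
  (continuousOn_const.mul (continuous_Yk hε).continuousOn).add (continuousOn_const.mul
    ((continuousOn_Ga ha).comp continuousOn_snd fun _ hq => hq.2))

lemma integrable_rdot {F H : ℂ → ℂ} (hF : ContinuousOn F cdisc) (hH : ContinuousOn H cdisc) :
    Integrable (fun z => rdot (F z) (H z)) discM :=
  integrable_discM (continuous_rdot.comp_continuousOn (hF.prodMk hH))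

lemma integral_rdot_Zf {ε : ℝ} (hε : 0 < ε) {a : ℂ} (ha : a ∈ odisc) (b : ℂ) {F : ℂ → ℂ}
    (hF : ContinuousOn F cdisc) :
    ∫ z, rdot (F z) (Zf ε a b z) ∂discM =
      9 / 8 * ∫ z, rdot (F z) (Yk ε b z) ∂discM + 1 / 8 * ∫ z, rdot (F z) (Ga a z) ∂discM := by
  simp only [Zf, rdot_add, rdot_smul]
  rw [integral_add ((integrable_rdot hF (continuous_Yk_right hε).continuousOn).const_mul _)
    ((integrable_rdot hF (continuousOn_Ga ha)).const_mul _), integral_const_mul, integral_const_mul]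

lemma continuousOn_Zf_right {ε : ℝ} (hε : 0 < ε) {a : ℂ} (ha : a ∈ odisc) (b : ℂ) :
    ContinuousOn (Zf ε a b) cdisc :=
  (continuousOn_const.mul (continuous_Yk_right hε).continuousOn).add (continuousOn_const.mul
    (continuousOn_Ga ha))

lemma exists_energy_lower : ∃ C : ℝ, ∀ (μ : Measure ℂ) [IsProbabilityMeasure μ], μ cdiscᶜ = 0 →
    ∀ u : ℂ → ℝ, ContDiffOn ℝ 1 u cdisc → ∀ a ∈ odisc, ∃ ε : ℝ, 0 < ε ∧ ε < 1 ∧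
      9 * π / 4 * ∫ x, (u x + pa a x) ∂μ -
        81 * π / 64 * (∫ q, (Nk ε q.1 q.2 + pa a q.1 + pa a q.2) ∂(μ.prod μ)) - C ≤
      En u + 1 / 8 * ∫ x, (u x + pa a x) * wa a x ∂circM := by
  obtain ⟨K, hK0, hK⟩ := exists_bound_integral_Q1
  set C2 := 2 * π * Real.log 2 + 2 * (4 * K + 2 * π) + 2 * π * Real.log 5 with hC2
  refine ⟨3 + C2, ?_⟩
  intro μ _ hμ u hu a ha
  obtain ⟨Λ, hΛ0, hΛ⟩ := exists_lipschitz hu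
  obtain ⟨Λ', hΛ0', hΛ'⟩ := exists_lipschitz (contDiffOn_pa ha)
  have hpi := Real.pi_pos
  set D := (Λ + Λ' + 1) * (4 * K + 2 * π) + 1 with hD
  have hD1 : 1 ≤ D := by rw [hD]; linarith [mul_nonneg (by linarith : 0 ≤ Λ + Λ' + 1) (by linarith : 0 ≤ 4 * K + 2 * π)]
  set ε := 1 / (2 * D) with hεd
  have hε : 0 < ε := by positivity
  have hε1 : ε < 1 := by rw [hεd, div_lt_one (by positivity)]; linarith
  have hεD : D * ε ≤ 1 := by rw [hεd]; field_simp; norm_num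
  have e1 : Λ * ((4 * K + 2 * π) * ε) ≤ 1 := by
    refine le_trans ?_ hεD
    rw [← mul_assoc]; refine mul_le_mul_of_nonneg_right ?_ hε.le
    rw [hD]; nlinarith
  have e2 : Λ' * ((4 * K + 2 * π) * ε) ≤ 1 := by
    refine le_trans ?_ hεD
    rw [← mul_assoc]; refine mul_le_mul_of_nonneg_right ?_ hε.le
    rw [hD]; nlinarith
  refine ⟨ε, hε, hε1, ?_⟩
  have hGu := continuousOn_gradW hu
  have hmain := dirichlet_ge hμ hGu (continuousOn_Zf hε ha)
  have iu : Integrable u μ := integrable_of_continuousOn isCompact_cdisc hμ hu.continuousOn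
  have ip : Integrable (pa a) μ :=
    integrable_of_continuousOn isCompact_cdisc hμ (contDiffOn_pa ha).continuousOn
  have hμ' : ∀ᵐ b ∂μ, b ∈ cdisc := hμ
  set U := ∫ x, u x ∂circM with hU
  set Uw := ∫ x, u x * wa a x ∂circM with hUw
  set P := Real.log (1 - ‖a‖ ^ 2) with hP
  -- the linear term
  have low : 9 / 8 * (2 * π * ∫ b, u b ∂μ - U - 1) + 1 / 8 * (U - Uw) ≤
      ∫ b, ∫ z, rdot (gradW u z) (Zf ε a b z) ∂discM ∂μ := by
    have : 9 / 8 * (2 * π * ∫ b, u b ∂μ - U - 1) + 1 / 8 * (U - Uw) =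
        ∫ b, ((9 / 8 * (2 * π)) * u b + (9 / 8 * (- U - 1) + 1 / 8 * (U - Uw))) ∂μ := by
      rw [integral_add (iu.const_mul _) (integrable_const _), integral_const_mul]; simp; ring
    rw [this]
    refine integral_mono_ae ((iu.const_mul _).add (integrable_const _)) ?_ ?_
    · exact (integrable_prod_of_continuousOn isCompact_cdisc isCompact_cdisc hμ discM_compl
        (F := fun q : ℂ × ℂ => rdot (gradW u q.2) (Zf ε a q.1 q.2))
        (continuous_rdot.comp_continuousOn ((hGu.comp continuousOn_snd fun q hq => hq.2).prodMk
          (continuousOn_Zf hε ha)))).integral_prod_left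
    · filter_upwards [hμ'] with b hb
      rw [integral_rdot_Zf hε ha b hGu, integral_grad_Ga ha hu]
      have := abs_le.mp (abs_green_sub_le (hK ε hε b) hε hb hu hΛ0 fun x hx => hΛ x hx b hb)
      linarith [this.1]
  have hGY : ∀ b ∈ cdisc, ∫ z, rdot (Ga a z) (Yk ε b z) ∂discM ≤
      2 * π * pa a b + 2 * π * P + 1 := by
    intro b hb
    have := abs_le.mp (abs_green_sub_le (hK ε hε b) hε hb (contDiffOn_pa ha) hΛ0'
      fun x hx => hΛ' x hx b hb)
    rw [integral_congr_ae (g := fun z => rdot (Ga a z) (Yk ε b z)) (discM_ae.mono fun x hx => by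
      simp only [gradW_pa ha (odisc_subset_cdisc hx)]), integral_pa ha] at this
    linarith [this.2]
  have iN : Integrable (fun q : ℂ × ℂ => Nk ε q.1 q.2) (μ.prod μ) :=
    integrable_prod_of_continuousOn isCompact_cdisc isCompact_cdisc hμ hμ
      (continuous_Nk hε).continuousOn
  have ip1 : Integrable (fun q : ℂ × ℂ => pa a q.1) (μ.prod μ) := ip.comp_fst μ
  have ip2 : Integrable (fun q : ℂ × ℂ => pa a q.2) (μ.prod μ) := ip.comp_snd μ
  have hp1 : ∫ q, pa a q.1 ∂(μ.prod μ) = ∫ b, pa a b ∂μ := by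
    rw [integral_fun_fst]; simp
  have hp2 : ∫ q, pa a q.2 ∂(μ.prod μ) = ∫ b, pa a b ∂μ := by
    rw [integral_fun_snd]; simp
  have high : ∫ q, (∫ z, rdot (Zf ε a q.1 z) (Zf ε a q.2 z) ∂discM) ∂(μ.prod μ) ≤
      81 / 64 * (2 * π * ∫ q, Nk ε q.1 q.2 ∂(μ.prod μ) + C2) +
        9 / 32 * (2 * π * ∫ b, pa a b ∂μ + 2 * π * P + 1) + 1 / 64 * (-4 * π * P) := by
    have : 81 / 64 * (2 * π * ∫ q, Nk ε q.1 q.2 ∂(μ.prod μ) + C2) +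
        9 / 32 * (2 * π * ∫ b, pa a b ∂μ + 2 * π * P + 1) + 1 / 64 * (-4 * π * P) =
        ∫ q, ((81 / 64 * (2 * π)) * Nk ε q.1 q.2 + (9 / 64 * (2 * π)) * pa a q.1 +
          (9 / 64 * (2 * π)) * pa a q.2 +
          (81 / 64 * C2 + 9 / 32 * (2 * π * P + 1) + 1 / 64 * (-4 * π * P))) ∂(μ.prod μ) := by
      rw [(integrable_and_integral_lin iN ip1 ip2 _ _ _ _).2, hp1, hp2]
      ring
    rw [this]
    refine integral_mono_ae ?_ (integrable_and_integral_lin iN ip1 ip2 _ _ _ _).1 ?_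
    · refine (integrable_prod_of_continuousOn (isCompact_cdisc.prod isCompact_cdisc) isCompact_cdisc
        (prod_compl_eq_zero hμ hμ) discM_compl
        (F := fun q : (ℂ × ℂ) × ℂ => rdot (Zf ε a q.1.1 q.2) (Zf ε a q.1.2 q.2))
        ?_).integral_prod_left
      refine continuous_rdot.comp_continuousOn (ContinuousOn.prodMk ?_ ?_)
      · exact (continuousOn_Zf hε ha).comp (f := fun q : (ℂ × ℂ) × ℂ => (q.1.1, q.2)) (by fun_prop)
          fun q hq => ⟨hq.1.1, hq.2⟩
      · exact (continuousOn_Zf hε ha).comp (f := fun q : (ℂ × ℂ) × ℂ => (q.1.2, q.2)) (by fun_prop)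
          fun q hq => ⟨hq.1.2, hq.2⟩
    · have hq := prod_compl_eq_zero hμ hμ
      have hq' : ∀ᵐ q ∂(μ.prod μ), q ∈ cdisc ×ˢ cdisc := hq
      filter_upwards [hq'] with q hq
      obtain ⟨b1, b2⟩ := hq
      have k1 := integral_rdot_Yk_le (hK ε hε q.2) hε hε1 b1 b2
      have k2 := hGY _ b1
      have k3 := hGY _ b2
      rw [integral_rdot_Zf hε ha q.2 (continuousOn_Zf_right hε ha q.1)]
      simp only [rdot_comm (Zf ε a q.1 _)]
      rw [integral_rdot_Zf hε ha q.1 (continuous_Yk_right hε).continuousOn,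
        integral_rdot_Zf hε ha q.1 (continuousOn_Ga ha), integral_Ga_sq ha]
      simp only [rdot_comm (Yk ε q.2 _)]
      linarith
  have hlast : ∫ x, (u x + pa a x) * wa a x ∂circM = Uw + 2 * π * P := by
    rw [hUw, hP, ← integral_pa_mul_wa ha, ← integral_add]
    · exact integral_congr_ae (ae_of_all _ fun x => by ring)
    · exact integrable_circM ((hu.continuousOn.mul (continuousOn_wa ha)).mono bdry_subset_cdisc)
    · exact integrable_circM (((contDiffOn_pa ha).continuousOn.mul (continuousOn_wa ha)).mono
        bdry_subset_cdisc)
  have hN := (integrable_and_integral_lin iN ip1 ip2 1 1 1 0).2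
  simp only [one_mul, add_zero, hp1, hp2] at hN
  rw [hN, integral_add iu ip, hlast, En]
  have hC20 : 0 ≤ C2 := by
    have := Real.log_nonneg (by norm_num : (1:ℝ) ≤ 2)
    have := Real.log_nonneg (by norm_num : (1:ℝ) ≤ 5)
    rw [hC2]; positivity
  nlinarith

section mobius
variable {a : ℂ}

lemma conj_one_sub (a x : ℂ) : (starRingEnd ℂ) (1 - (starRingEnd ℂ) a * x) =
    1 - a * (starRingEnd ℂ) x := by simp

lemma wa_mul_wa (a x b : ℂ) :
    wa a x * wa a b = ‖((1 - ‖a‖ ^ 2 : ℝ) : ℂ) /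
      ((1 - (starRingEnd ℂ) a * x) * (1 - (starRingEnd ℂ) a * b))‖ ^ 2 := by
  rw [wa, wa, dn_def, dn_def, norm_div, norm_mul, Complex.norm_real, div_pow, mul_pow,
    Real.norm_eq_abs, sq_abs, div_mul_div_comm, sq (1 - ‖a‖ ^ 2)]

lemma Psi_sub_sq (ha : a ∈ odisc) {x b : ℂ} (hx : x ∈ cdisc) (hb : b ∈ cdisc) :
    ‖Psi a x - Psi a b‖ ^ 2 = ‖x - b‖ ^ 2 * (wa a x * wa a b) := by
  have h1 := one_sub_ne ha hx
  have h2 := one_sub_ne ha hb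
  rw [wa_mul_wa a x b, ← mul_pow, ← norm_mul]
  congr 2
  rw [Complex.ofReal_sub, ← mul_conj_eq, Psi, Psi, div_sub_div _ _ h1 h2,
    mul_div_assoc']
  congr 1
  push_cast; ring

lemma one_sub_Psi_sq (ha : a ∈ odisc) {x b : ℂ} (hx : x ∈ cdisc) (hb : b ∈ cdisc) :
    ‖1 - (starRingEnd ℂ) (Psi a b) * Psi a x‖ ^ 2 =
      ‖1 - (starRingEnd ℂ) b * x‖ ^ 2 * (wa a x * wa a b) := by
  have h1 := one_sub_ne ha hx
  have h2 := one_sub_ne ha hb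
  have h3 : 1 - a * (starRingEnd ℂ) b ≠ 0 := by
    rw [← conj_one_sub]; exact (map_ne_zero _).mpr h2
  have e : ‖((1 - ‖a‖ ^ 2 : ℝ) : ℂ) /
      ((1 - (starRingEnd ℂ) a * x) * (1 - (starRingEnd ℂ) a * b))‖ = ‖((1 - ‖a‖ ^ 2 : ℝ) : ℂ) /
      ((1 - (starRingEnd ℂ) a * x) * (1 - a * (starRingEnd ℂ) b))‖ := by
    rw [← conj_one_sub a b, norm_div, norm_div, norm_mul, norm_mul, RCLike.norm_conj]
  rw [wa_mul_wa a x b, e, ← mul_pow, ← norm_mul]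
  congr 2
  rw [Complex.ofReal_sub, ← mul_conj_eq, Psi, Psi, map_div₀, conj_one_sub,
    div_mul_div_comm, one_sub_div (mul_ne_zero h3 h1), mul_div_assoc', mul_comm (1 - a * _)]
  congr 1
  simp only [map_sub]
  push_cast; ring

lemma one_sub_norm_Psi_sq (ha : a ∈ odisc) {x : ℂ} (hx : x ∈ cdisc) :
    1 - ‖Psi a x‖ ^ 2 = (1 - ‖x‖ ^ 2) * wa a x := by
  have h1 := dn_pos ha hx
  rw [Psi, norm_div, div_pow, ← dn_def, wa]
  field_simp
  have := Q2_eq_Q1_add 0 a x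
  rw [← dn, Q1] at this
  linarith

lemma Psi_mem_cdisc (ha : a ∈ odisc) {x : ℂ} (hx : x ∈ cdisc) : Psi a x ∈ cdisc := by
  have h := one_sub_norm_Psi_sq ha hx
  have hx' : ‖x‖ ≤ 1 := by simpa [cdisc] using hx
  have := mul_nonneg (by nlinarith [norm_nonneg x] : 0 ≤ 1 - ‖x‖ ^ 2) (wa_pos ha hx).le
  have : ‖Psi a x‖ ≤ 1 := by nlinarith [norm_nonneg (Psi a x)]
  simpa [cdisc] using this

lemma Psi_mem_odisc (ha : a ∈ odisc) {x : ℂ} (hx : x ∈ odisc) : Psi a x ∈ odisc := by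
  have h := one_sub_norm_Psi_sq ha (odisc_subset_cdisc hx)
  have := mul_pos (one_sub_sq_pos hx) (wa_pos ha (odisc_subset_cdisc hx))
  have : ‖Psi a x‖ < 1 := by nlinarith [norm_nonneg (Psi a x)]
  simpa [odisc] using this

lemma norm_Psi_of_bdry (ha : a ∈ odisc) {x : ℂ} (hx : x ∈ bdry) : ‖Psi a x‖ = 1 := by
  have h := one_sub_norm_Psi_sq ha (bdry_subset_cdisc hx)
  have hn : ‖x‖ = 1 := by simpa [bdry] using hx
  rw [hn] at h
  nlinarith [norm_nonneg (Psi a x)]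

lemma le_wa (ha : a ∈ odisc) {x : ℂ} (hx : x ∈ cdisc) : (1 - ‖a‖ ^ 2) / 4 ≤ wa a x := by
  have h1 := dn_pos ha hx
  have ha' : ‖a‖ < 1 := by simpa [odisc] using ha
  have hx1 : ‖x‖ ≤ 1 := by simpa [cdisc] using hx
  have h2 := norm_sub_le 1 ((starRingEnd ℂ) a * x)
  have h3 : ‖(starRingEnd ℂ) a * x‖ ≤ 1 := by
    rw [norm_mul, RCLike.norm_conj]; nlinarith [norm_nonneg x, norm_nonneg a]
  have h4 : ‖(1:ℂ)‖ = 1 := norm_one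
  have h5 : dn a x ≤ 4 := by rw [dn_def]; nlinarith [norm_nonneg (1 - (starRingEnd ℂ) a * x)]
  exact div_le_div_of_nonneg_left (one_sub_sq_pos ha).le h1 h5

/-- Conformal covariance of the Neumann kernel, up to the regularisation. -/
lemma Nk_add_pa_le (ha : a ∈ odisc) {ε : ℝ} (hε : 0 < ε) {x b : ℂ} (hx : x ∈ cdisc)
    (hb : b ∈ cdisc) : Nk ε b x + pa a b + pa a x ≤
      Nk (ε * ((1 - ‖a‖ ^ 2) / 4)) (Psi a b) (Psi a x) := by
  have hm := one_sub_sq_pos ha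
  have wx := wa_pos ha hx
  have wb := wa_pos ha hb
  have q1 := Q1_pos hε b x
  have q2 := Q2_pos hε b x
  have hδ : 0 < ε * ((1 - ‖a‖ ^ 2) / 4) := by positivity
  have r1 := Q1_pos hδ (Psi a b) (Psi a x)
  have r2 := Q2_pos hδ (Psi a b) (Psi a x)
  have hww : ((1 - ‖a‖ ^ 2) / 4) ^ 2 ≤ wa a x * wa a b := by
    rw [sq]; exact mul_le_mul (le_wa ha hx) (le_wa ha hb) (by positivity) wx.le
  have hd := mul_le_mul_of_nonneg_left hww (sq_nonneg ε)
  have e1 : Q1 (ε * ((1 - ‖a‖ ^ 2) / 4)) (Psi a b) (Psi a x) ≤ Q1 ε b x * (wa a x * wa a b) := by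
    rw [Q1, Q1, Psi_sub_sq ha hx hb]; linarith
  have e2 : Q2 (ε * ((1 - ‖a‖ ^ 2) / 4)) (Psi a b) (Psi a x) ≤ Q2 ε b x * (wa a x * wa a b) := by
    rw [Q2, Q2, one_sub_Psi_sq ha hx hb]; linarith
  have l1 := Real.log_le_log r1 e1
  have l2 := Real.log_le_log r2 e2
  rw [Real.log_mul q1.ne' (by positivity), Real.log_mul wx.ne' wb.ne', log_wa ha hx,
    log_wa ha hb] at l1
  rw [Real.log_mul q2.ne' (by positivity), Real.log_mul wx.ne' wb.ne', log_wa ha hx,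
    log_wa ha hb] at l2
  unfold Nk
  linarith

lemma measurable_Psi (a : ℂ) : Measurable (Psi a) := by
  unfold Psi; fun_prop

/-- The complex derivative of `Psi`. -/
def dPsi (a x : ℂ) : ℂ := ((1 - ‖a‖ ^ 2 : ℝ) : ℂ) / (1 - (starRingEnd ℂ) a * x) ^ 2

lemma hasDerivAt_Psi (ha : a ∈ odisc) {x : ℂ} (hx : x ∈ cdisc) :
    HasDerivAt (Psi a) (dPsi a x) x := by
  have h1 := one_sub_ne ha hx
  have h := ((hasDerivAt_id x).sub_const a).div
    (((hasDerivAt_id x).const_mul ((starRingEnd ℂ) a)).const_sub 1) h1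
  refine h.congr_deriv ?_
  rw [dPsi, Complex.ofReal_sub, ← mul_conj_eq]
  congr 1
  simp; ring

lemma norm_dPsi (ha : a ∈ odisc) (x : ℂ) : ‖dPsi a x‖ = wa a x := by
  rw [dPsi, norm_div, norm_pow, ← dn_def, Complex.norm_real,
    Real.norm_of_nonneg (one_sub_sq_pos ha).le, wa]

lemma injOn_Psi (ha : a ∈ odisc) : InjOn (Psi a) cdisc := by
  intro x hx b hb h
  have e := Psi_sub_sq ha hx hb
  have := mul_pos (wa_pos ha hx) (wa_pos ha hb)
  rw [h, sub_self, norm_zero] at e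
  have e0 : ‖x - b‖ ^ 2 = 0 := by
    rcases mul_eq_zero.mp (by simpa using e.symm : ‖x - b‖ ^ 2 * (wa a x * wa a b) = 0) with h | h
    · exact h
    · exact absurd h this.ne'
  exact sub_eq_zero.mp (norm_eq_zero.mp (pow_eq_zero_iff two_ne_zero |>.mp e0))

lemma det_mul_eq (c : ℂ) :
    (((ContinuousLinearMap.toSpanSingleton ℂ c).restrictScalars ℝ : ℂ →L[ℝ] ℂ)).det = ‖c‖ ^ 2 := by
  have : Algebra.norm ℝ c = ‖c‖ ^ 2 := by
    rw [Algebra.norm_complex_apply, Complex.sq_norm]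
  rw [← this, Algebra.norm_apply, ContinuousLinearMap.det]
  congr 1
  ext; simp [mul_comm]

/-- Change of variables by a disc automorphism. -/
lemma integral_comp_Psi_le (ha : a ∈ odisc) {h : ℂ → ℝ} (h0 : ∀ y, 0 ≤ h y)
    (hi : Integrable h discM) :
    ∫ x, h (Psi a x) * wa a x ^ 2 ∂discM ≤ ∫ y, h y ∂discM := by
  have hm : MeasurableSet odisc := measurableSet_ball
  have key := integral_image_eq_integral_abs_det_fderiv_smul volume hm (f := Psi a)
    (f' := fun x => (ContinuousLinearMap.toSpanSingleton ℂ (dPsi a x)).restrictScalars ℝ)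
    (fun x hx => ((hasDerivAt_Psi ha (odisc_subset_cdisc hx)).hasFDerivAt.restrictScalars
      ℝ).hasFDerivWithinAt) ((injOn_Psi ha).mono odisc_subset_cdisc) h
  have e : ∫ x, h (Psi a x) * wa a x ^ 2 ∂discM = ∫ y in Psi a '' odisc, h y := by
    rw [key, discM]
    refine integral_congr_ae (ae_of_all _ fun x => ?_)
    simp only [det_mul_eq, norm_dPsi ha, smul_eq_mul, abs_of_nonneg (sq_nonneg (wa a x))]
    ring
  rw [e, discM]
  refine setIntegral_mono_set hi (ae_of_all _ h0) (LE.le.eventuallyLE ?_)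
  rintro _ ⟨x, hx, rfl⟩
  exact Psi_mem_odisc ha hx

end mobius

/-! ### Kernel bounds -/

lemma Q1_rpow_le (δ : ℝ) {y' y : ℂ} (h : y ≠ y') :
    Q1 δ y' y ^ (-(7 / 8) : ℝ) ≤ ‖y - y'‖ ^ (-(7 / 4) : ℝ) := by
  have h0 : 0 < ‖y - y'‖ := norm_pos_iff.mpr (sub_ne_zero.mpr h)
  have e : ‖y - y'‖ ^ (-(7 / 4) : ℝ) = (‖y - y'‖ ^ 2) ^ (-(7 / 8) : ℝ) := by
    rw [← Real.rpow_natCast, ← Real.rpow_mul h0.le]; norm_num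
  rw [e]
  exact Real.rpow_le_rpow_of_nonpos (by positivity) (by rw [Q1]; nlinarith [sq_nonneg δ])
    (by norm_num)

lemma continuous_Q1_rpow {δ : ℝ} (hδ : 0 < δ) (y' : ℂ) (s : ℝ) :
    Continuous (fun y => Q1 δ y' y ^ s) :=
  continuous_Q1_right.rpow_const fun y => Or.inl (Q1_pos hδ y' y).ne'

lemma exists_bound_integral_Q1_rpow : ∃ K : ℝ, 0 ≤ K ∧ ∀ δ : ℝ, 0 < δ → ∀ y' ∈ cdisc,
    ∫ y, Q1 δ y' y ^ (-(7 / 8) : ℝ) ∂discM ≤ K := by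
  have hint : IntegrableOn (fun y : ℂ => ‖y‖ ^ (-(7 / 4) : ℝ)) (ball 0 2) volume := by
    refine integrableOn_ball_of_norm_le_rpow (C := 1) (α := 7 / 4) ?_ ?_ ?_ ?_
    · simp [Complex.finrank_real_complex]
    · rw [Complex.finrank_real_complex]; norm_num
    · exact ae_of_all _ fun x => by
        rw [one_mul, Real.norm_of_nonneg (by positivity)]
    · exact (measurable_norm.pow_const _).aestronglyMeasurable
  refine ⟨∫ y in ball (0:ℂ) 2, ‖y‖ ^ (-(7 / 4) : ℝ), integral_nonneg fun y => by positivity,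
    fun δ hδ y' hy' => ?_⟩
  have hpre : (fun y : ℂ => y - y') ⁻¹' (ball 0 2) = ball y' 2 := by
    ext y; simp [dist_eq_norm]
  have hmp : MeasurePreserving (fun y : ℂ => y - y') volume volume :=
    measurePreserving_sub_right volume y'
  have hme : MeasurableEmbedding (fun y : ℂ => y - y') := (Homeomorph.subRight y').measurableEmbedding
  have hs : odisc ⊆ ball y' 2 := by
    intro y hy
    have h1 : ‖y‖ < 1 := by simpa [odisc] using hy
    have h2 : ‖y'‖ ≤ 1 := by simpa [cdisc] using hy'
    rw [mem_ball, dist_eq_norm]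
    linarith [norm_sub_le y y']
  have hint' : IntegrableOn (fun y : ℂ => ‖y - y'‖ ^ (-(7 / 4) : ℝ)) (ball y' 2) volume := by
    rw [← hpre]
    exact (hmp.integrableOn_comp_preimage hme).mpr hint
  calc ∫ y, Q1 δ y' y ^ (-(7 / 8) : ℝ) ∂discM
      ≤ ∫ y in odisc, ‖y - y'‖ ^ (-(7 / 4) : ℝ) := by
        refine integral_mono_ae (integrable_discM (continuous_Q1_rpow hδ y' _).continuousOn)
          (hint'.mono_set hs) ?_
        have : ∀ᵐ y ∂(volume : Measure ℂ), y ≠ y' := by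
          simp [ae_iff]
        filter_upwards [ae_restrict_of_ae this] with y hy using Q1_rpow_le δ hy
    _ ≤ ∫ y in ball y' 2, ‖y - y'‖ ^ (-(7 / 4) : ℝ) :=
        setIntegral_mono_set hint' (ae_of_all _ fun y => by positivity) hs.eventuallyLE
    _ = _ := by rw [← hpre]; exact hmp.setIntegral_preimage_emb hme (fun y => ‖y‖ ^ (-(7 / 4) : ℝ)) _

section field
variable {a : ℂ}

/-- Half the gradient of `‖Psi a ·‖²`. -/
def Xa (a x : ℂ) : ℂ := (starRingEnd ℂ) (dPsi a x) * Psi a x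

lemma exists_hasDerivAt_dPsi (ha : a ∈ odisc) {x : ℂ} (hx : x ∈ cdisc) :
    ∃ d, HasDerivAt (dPsi a) d x := by
  have h1 := one_sub_ne ha hx
  exact ⟨_, (hasDerivAt_const x _).div
    ((((hasDerivAt_id x).const_mul ((starRingEnd ℂ) a)).const_sub 1).pow 2) (pow_ne_zero 2 h1)⟩

lemma hasDivAt_Xa (ha : a ∈ odisc) {x : ℂ} (hx : x ∈ cdisc) :
    HasDivAt (Xa a) (2 * wa a x ^ 2) x := by
  obtain ⟨d, hd⟩ := exists_hasDerivAt_dPsi ha hx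
  have h1 := hd.hasFDerivAt.restrictScalars ℝ
  have h2 := (hasDerivAt_Psi ha hx).hasFDerivAt.restrictScalars ℝ
  have h3 := (Complex.conjCLE.toContinuousLinearMap.hasFDerivAt.comp x h1).mul h2
  refine ⟨_, h3, ?_⟩
  rw [← norm_dPsi ha x, Complex.sq_norm, Complex.normSq_apply]
  simp
  ring

lemma continuousOn_dPsi (ha : a ∈ odisc) : ContinuousOn (dPsi a) cdisc := fun _ hx =>
  (exists_hasDerivAt_dPsi ha hx).choose_spec.continuousAt.continuousWithinAt

lemma continuousOn_Xa (ha : a ∈ odisc) : ContinuousOn (Xa a) cdisc :=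
  (Complex.continuous_conj.comp_continuousOn (continuousOn_dPsi ha)).mul (continuousOn_Psi ha)

lemma norm_Xa_le (ha : a ∈ odisc) {x : ℂ} (hx : x ∈ cdisc) : ‖Xa a x‖ ≤ wa a x := by
  have h : ‖Psi a x‖ ≤ 1 := by simpa [cdisc] using Psi_mem_cdisc ha hx
  rw [Xa, norm_mul, RCLike.norm_conj, norm_dPsi ha]
  exact mul_le_of_le_one_right (wa_pos ha hx).le h

lemma rdot_Xa (ha : a ∈ odisc) {x : ℂ} (hx : x ∈ bdry) : rdot x (Xa a x) = wa a x := by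
  have hx' := bdry_subset_cdisc hx
  have hn : ‖x‖ = 1 := by simpa [bdry] using hx
  have h1 := one_sub_ne ha hx'
  have h2 : 1 - a * (starRingEnd ℂ) x ≠ 0 := by
    rw [← conj_one_sub]; exact (map_ne_zero _).mpr h1
  have hxx : x * (starRingEnd ℂ) x = 1 := by rw [mul_conj_eq, hn]; simp
  have e0 : (dn a x : ℂ) = (1 - (starRingEnd ℂ) a * x) * (1 - a * (starRingEnd ℂ) x) := by
    rw [dn_def, ← mul_conj_eq, conj_one_sub]
  have e : x * dPsi a x = wa a x * Psi a x := by
    have e1 : x - a = x * (1 - a * (starRingEnd ℂ) x) := by linear_combination a * hxx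
    rw [dPsi, Psi, wa, Complex.ofReal_div, e0, e1]
    generalize 1 - (starRingEnd ℂ) a * x = p at h1 ⊢
    generalize 1 - a * (starRingEnd ℂ) x = q at h2 ⊢
    field_simp
  have e' : rdot x (Xa a x) = rdot (x * dPsi a x) (Psi a x) := by
    simp [rdot, Xa]; ring
  rw [e', e, rdot_smul_left, rdot_self, norm_Psi_of_bdry ha hx]; simp

lemma contDiffOn_Psi (ha : a ∈ odisc) : ContDiffOn ℝ 1 (Psi a) cdisc := by
  have h1 : ContDiffOn ℝ 1 (fun x : ℂ => x - a) cdisc := contDiffOn_id.sub contDiffOn_const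
  have h2 : ContDiffOn ℝ 1 (fun x : ℂ => 1 - (starRingEnd ℂ) a * x) cdisc :=
    contDiffOn_const.sub (contDiffOn_const.mul contDiffOn_id)
  exact (h1.mul (h2.inv fun x hx => one_sub_ne ha hx)).congr fun x _ => div_eq_mul_inv _ _

lemma continuousOn_wa_sq (ha : a ∈ odisc) : ContinuousOn (fun x => wa a x ^ 2) cdisc :=
  (continuousOn_wa ha).pow 2

/-- The divergence identity for `φ * Xa`. -/
lemma integral_mul_wa_circ (ha : a ∈ odisc) {φ : ℂ → ℝ} (hφ : ContDiffOn ℝ 1 φ cdisc) :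
    ∫ x, φ x * wa a x ∂circM =
      ∫ x, rdot (gradW φ x) (Xa a x) ∂discM + ∫ x, φ x * (2 * wa a x ^ 2) ∂discM := by
  rw [green_div hφ (continuousOn_Xa ha) (fun z hz => hasDivAt_Xa ha (odisc_subset_cdisc hz))
    (continuousOn_const.mul (continuousOn_wa_sq ha))]
  refine integral_congr_ae ?_
  filter_upwards [circM_ae] with x hx
  rw [rdot_Xa ha hx]

lemma hasGradAt_Q1_Psi (ha : a ∈ odisc) (δ : ℝ) (y' : ℂ) {x : ℂ} (hx : x ∈ cdisc) :
    HasGradAt (fun x => Q1 δ y' (Psi a x))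
      (2 * ((starRingEnd ℂ) (dPsi a x) * (Psi a x - y'))) x := by
  have h2 := ((hasDerivAt_Psi ha hx).hasFDerivAt.restrictScalars ℝ).sub_const y'
  have h3 := (h2.norm_sq).add_const (δ ^ 2)
  refine h3.congr_fderiv ?_
  ext w
  simp [rdotL, Complex.inner]
  ring

lemma contDiffOn_Q1_Psi (ha : a ∈ odisc) (δ : ℝ) (y' : ℂ) :
    ContDiffOn ℝ 1 (fun x => Q1 δ y' (Psi a x)) cdisc :=
  (((contDiffOn_Psi ha).sub contDiffOn_const).norm_sq ℝ).add contDiffOn_const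

lemma integral_Q1_Psi_le {K : ℝ} (ha : a ∈ odisc) {δ : ℝ} (hδ : 0 < δ) {y' : ℂ}
    (hK : ∫ y, Q1 δ y' y ^ (-(7 / 8) : ℝ) ∂discM ≤ K) :
    ∫ x, Q1 δ y' (Psi a x) ^ (-(7 / 8) : ℝ) * wa a x ^ 2 ∂discM ≤ K :=
  (integral_comp_Psi_le ha (h := fun y => Q1 δ y' y ^ (-(7 / 8) : ℝ))
    (fun y => (Real.rpow_pos_of_pos (Q1_pos hδ y' y) _).le)
    (integrable_discM (continuous_Q1_rpow hδ y' _).continuousOn)).trans hK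

lemma continuousOn_Q1_Psi (ha : a ∈ odisc) {δ : ℝ} (hδ : 0 < δ) (y' : ℂ) (s : ℝ) :
    ContinuousOn (fun x => Q1 δ y' (Psi a x) ^ s) cdisc :=
  (continuous_Q1_rpow hδ y' s).comp_continuousOn (continuousOn_Psi ha)

/-- Lowering the exponent of a quantity bounded by five. -/
lemma rpow_le_five_mul {q s t : ℝ} (hq : 0 < q) (hq5 : q ≤ 5) (hst : s ≤ t) (hts : t ≤ s + 1) :
    q ^ t ≤ 5 * q ^ s := by
  have e : q ^ t = q ^ (t - s) * q ^ s := by rw [← Real.rpow_add hq]; ring_nf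
  rw [e]
  refine mul_le_mul_of_nonneg_right ?_ (Real.rpow_pos_of_pos hq _).le
  calc q ^ (t - s) ≤ (5:ℝ) ^ (t - s) := Real.rpow_le_rpow hq.le hq5 (by linarith)
    _ ≤ (5:ℝ) ^ (1:ℝ) := Real.rpow_le_rpow_of_exponent_le (by norm_num) (by linarith)
    _ = 5 := by norm_num

lemma integral_disc_Q1_Psi_le {K : ℝ} (ha : a ∈ odisc) {δ : ℝ} (hδ : 0 < δ) (hδ1 : δ < 1) {y' : ℂ}
    (hy' : y' ∈ cdisc)
    (hK : ∫ y, Q1 δ y' y ^ (-(7 / 8) : ℝ) ∂discM ≤ K) :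
    ∫ x, Q1 δ y' (Psi a x) ^ (-(3 / 4) : ℝ) * wa a x ^ 2 ∂discM ≤ 5 * K := by
  refine le_trans ?_ (mul_le_mul_of_nonneg_left (integral_Q1_Psi_le ha hδ hK) (by norm_num))
  rw [← integral_const_mul]
  refine integral_mono_ae
    (integrable_discM ((continuousOn_Q1_Psi ha hδ y' _).mul (continuousOn_wa_sq ha)))
    ((integrable_discM ((continuousOn_Q1_Psi ha hδ y' _).mul (continuousOn_wa_sq ha))).const_mul _)
    ?_
  filter_upwards [discM_ae] with x hx
  have hx' := odisc_subset_cdisc hx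
  have := rpow_le_five_mul (s := -(7 / 8)) (t := -(3 / 4)) (Q1_pos hδ y' (Psi a x))
    (Q1_le_five hδ hδ1 hy' (Psi_mem_cdisc ha hx')) (by norm_num) (by norm_num)
  nlinarith [mul_le_mul_of_nonneg_right this (sq_nonneg (wa a x))]

lemma rdot_gradW_Q1_rpow_le (ha : a ∈ odisc) {δ : ℝ} (hδ : 0 < δ) (y' : ℂ) {x : ℂ}
    (hx : x ∈ cdisc) :
    rdot (gradW (fun x => Q1 δ y' (Psi a x) ^ (-(3 / 8) : ℝ)) x) (Xa a x) ≤
      Q1 δ y' (Psi a x) ^ (-(7 / 8) : ℝ) * wa a x ^ 2 := by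
  have hq := Q1_pos hδ y' (Psi a x)
  have hw := wa_pos ha hx
  have hg := (hasGradAt_Q1_Psi ha δ y' hx).comp
    (Real.hasDerivAt_rpow_const (p := -(3 / 8)) (Or.inl hq.ne'))
  rw [hg.gradW hx]
  refine (le_abs_self _).trans ((abs_rdot_le _ _).trans ?_)
  set q := Q1 δ y' (Psi a x) with hqdef
  have hs : ‖Psi a x - y'‖ ≤ q ^ (1 / 2 : ℝ) := by
    rw [← Real.sqrt_eq_rpow]
    exact Real.le_sqrt_of_sq_le (by rw [hqdef, Q1]; nlinarith [sq_nonneg δ])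
  have e : q ^ (-(7 / 8) : ℝ) = q ^ (-(3 / 8) - 1 : ℝ) * q ^ (1 / 2 : ℝ) := by
    rw [← Real.rpow_add hq]; norm_num
  have hp := Real.rpow_pos_of_pos hq (-(3 / 8) - 1 : ℝ)
  rw [norm_mul, norm_mul, norm_mul, RCLike.norm_conj, norm_dPsi ha, Complex.norm_real, e,
    Real.norm_eq_abs, abs_mul, abs_of_pos hp]
  have h2 : ‖(2:ℂ)‖ = 2 := by simp
  have h3 : |(-(3 / 8) : ℝ)| = 3 / 8 := by rw [abs_neg, abs_of_pos (by norm_num)]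
  rw [h2, h3]
  have hX := norm_Xa_le ha hx
  calc 3 / 8 * q ^ (-(3 / 8) - 1 : ℝ) * (2 * (wa a x * ‖Psi a x - y'‖)) * ‖Xa a x‖
      ≤ 3 / 8 * q ^ (-(3 / 8) - 1 : ℝ) * (2 * (wa a x * q ^ (1 / 2 : ℝ))) * wa a x := by gcongr
    _ = 3 / 4 * (q ^ (-(3 / 8) - 1 : ℝ) * q ^ (1 / 2 : ℝ) * wa a x ^ 2) := by ring
    _ ≤ _ := by
      have : 0 ≤ q ^ (-(3 / 8) - 1 : ℝ) * q ^ (1 / 2 : ℝ) * wa a x ^ 2 := by positivity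
      linarith

lemma integral_circ_Q1_Psi_le {K : ℝ} (ha : a ∈ odisc) {δ : ℝ} (hδ : 0 < δ) (hδ1 : δ < 1) {y' : ℂ}
    (hy' : y' ∈ cdisc)
    (hK : ∫ y, Q1 δ y' y ^ (-(7 / 8) : ℝ) ∂discM ≤ K) :
    ∫ x, Q1 δ y' (Psi a x) ^ (-(3 / 8) : ℝ) * wa a x ∂circM ≤ 11 * K := by
  have hφ : ContDiffOn ℝ 1 (fun x => Q1 δ y' (Psi a x) ^ (-(3 / 8) : ℝ)) cdisc :=
    (contDiffOn_Q1_Psi ha δ y').rpow_const_of_ne fun x _ => (Q1_pos hδ y' _).ne'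
  rw [integral_mul_wa_circ ha hφ]
  have i7 := integrable_discM ((continuousOn_Q1_Psi ha hδ y' (-(7 / 8))).mul
    (continuousOn_wa_sq ha))
  have h1 : ∫ x, rdot (gradW (fun x => Q1 δ y' (Psi a x) ^ (-(3 / 8) : ℝ)) x) (Xa a x) ∂discM ≤
      ∫ x, Q1 δ y' (Psi a x) ^ (-(7 / 8) : ℝ) * wa a x ^ 2 ∂discM := by
    refine integral_mono_ae (integrable_rdot (continuousOn_gradW hφ) (continuousOn_Xa ha)) i7 ?_
    filter_upwards [discM_ae] with x hx using rdot_gradW_Q1_rpow_le ha hδ y' (odisc_subset_cdisc hx)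
  have h2 : ∫ x, Q1 δ y' (Psi a x) ^ (-(3 / 8) : ℝ) * (2 * wa a x ^ 2) ∂discM ≤
      ∫ x, 10 * (Q1 δ y' (Psi a x) ^ (-(7 / 8) : ℝ) * wa a x ^ 2) ∂discM := by
    refine integral_mono_ae (integrable_discM ((continuousOn_Q1_Psi ha hδ y' _).mul
      (continuousOn_const.mul (continuousOn_wa_sq ha)))) (i7.const_mul _) ?_
    filter_upwards [discM_ae] with x hx
    have hx' := odisc_subset_cdisc hx
    have := rpow_le_five_mul (s := -(7 / 8)) (t := -(3 / 8)) (Q1_pos hδ y' (Psi a x))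
      (Q1_le_five hδ hδ1 hy' (Psi_mem_cdisc ha hx')) (by norm_num) (by norm_num)
    nlinarith [mul_le_mul_of_nonneg_right this (sq_nonneg (wa a x))]
  rw [integral_const_mul] at h2
  have h3 := integral_Q1_Psi_le ha hδ hK
  linarith

end field

/-! ### Exponential integrability of potentials of spread-out measures -/

section jensen
variable {α : Type*} [MeasurableSpace α] {μ : Measure α} [IsProbabilityMeasure μ]

lemma exp_integral_le {h : α → ℝ} (hh : Integrable h μ)
    (he : Integrable (fun x => Real.exp (h x)) μ) :
    Real.exp (∫ x, h x ∂μ) ≤ ∫ x, Real.exp (h x) ∂μ :=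
  convexOn_exp.map_integral_le Real.continuous_exp.continuousOn isClosed_univ
    (ae_of_all _ fun _ => mem_univ _) hh he

/-- Jensen's inequality on a set of measure at most `2 / 3`. -/
lemma exp_setIntegral_le {S : Set α} (hS : μ.real S ≤ 2 / 3) {h : α → ℝ}
    (hh : Integrable h μ) (he : Integrable (fun x => Real.exp (2 / 3 * h x)) μ) :
    Real.exp (∫ x in S, h x ∂μ) ≤ 1 + 3 / 2 * ∫ x in S, Real.exp (2 / 3 * h x) ∂μ := by
  set M := ∫ x in S, h x ∂μ with hM
  have hnn : 0 ≤ ∫ x in S, Real.exp (2 / 3 * h x) ∂μ := integral_nonneg fun x => (Real.exp_pos _).le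
  rcases le_or_gt M 0 with h0 | h0
  · have := Real.exp_le_one_iff.mpr h0
    linarith
  have i1 : Integrable (fun x => 2 / 3 * h x + (1 - M)) (μ.restrict S) :=
    (hh.restrict.const_mul _).add (integrable_const _)
  have key : ∫ x in S, Real.exp M * (2 / 3 * h x + (1 - M)) ∂μ ≤
      ∫ x in S, Real.exp (2 / 3 * h x) ∂μ := by
    refine integral_mono (i1.const_mul _) he.restrict fun x => ?_
    have h1 := Real.add_one_le_exp (2 / 3 * h x - M)
    have h2 : Real.exp (2 / 3 * h x) = Real.exp M * Real.exp (2 / 3 * h x - M) := by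
      rw [← Real.exp_add]; ring_nf
    simp only
    rw [h2]
    exact mul_le_mul_of_nonneg_left (by linarith) (Real.exp_pos _).le
  rw [integral_const_mul, integral_add (hh.restrict.const_mul _) (integrable_const _),
    integral_const_mul, ← hM, integral_const, smul_eq_mul, measureReal_restrict_apply_univ] at key
  have hs0 : 0 ≤ μ.real S := measureReal_nonneg
  set s := μ.real S
  have h3 : Real.exp M - 1 ≤ M * Real.exp M := by
    have h4 := Real.add_one_le_exp (-M)
    have h5 : Real.exp M * Real.exp (-M) = 1 := by rw [← Real.exp_add]; simp
    nlinarith [Real.exp_pos M]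
  have h6 : 0 ≤ 1 - 3 / 2 * s := by linarith
  nlinarith [mul_le_mul_of_nonneg_left h3 h6]

end jensen

section potential
variable {μ : Measure ℂ} [IsProbabilityMeasure μ] {δ : ℝ}

lemma continuous_Nk_left (hδ : 0 < δ) (y : ℂ) : Continuous (fun b => Nk δ b y) :=
  Continuous.uncurry_right (f := Nk δ) y (continuous_Nk hδ)

lemma continuous_Q1_left (y : ℂ) : Continuous (fun b => Q1 δ b y) :=
  Continuous.uncurry_right (f := Q1 δ) y (continuous_Q1 δ)

lemma continuous_Q1_rpow_left (hδ : 0 < δ) (y : ℂ) (s : ℝ) : Continuous (fun b => Q1 δ b y ^ s) :=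
  (continuous_Q1_left y).rpow_const fun b => Or.inl (Q1_pos hδ b y).ne'

lemma integrable_cdisc {φ : ℂ → ℝ} (hμ : μ cdiscᶜ = 0) (h : Continuous φ) : Integrable φ μ :=
  integrable_of_continuousOn isCompact_cdisc hμ h.continuousOn

lemma Q1_le_Q2 {b y : ℂ} (hb : b ∈ cdisc) (hy : y ∈ cdisc) : Q1 δ b y ≤ Q2 δ b y := by
  have hb1 : ‖b‖ ≤ 1 := by simpa [cdisc] using hb
  have hy1 : ‖y‖ ≤ 1 := by simpa [cdisc] using hy
  have h1 : 0 ≤ 1 - ‖b‖ ^ 2 := by nlinarith [norm_nonneg b]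
  have h2 : 0 ≤ 1 - ‖y‖ ^ 2 := by nlinarith [norm_nonneg y]
  rw [Q2_eq_Q1_add]
  nlinarith [mul_nonneg h1 h2]

lemma Nk_le_neg_log (hδ : 0 < δ) {b y : ℂ} (hb : b ∈ cdisc) (hy : y ∈ cdisc) :
    Nk δ b y ≤ -Real.log (Q1 δ b y) := by
  have := Real.log_le_log (Q1_pos hδ b y) (Q1_le_Q2 hb hy)
  unfold Nk; linarith

lemma log_256 : Real.log 256 = 8 * Real.log 2 := by
  rw [show (256:ℝ) = 2 ^ 8 by norm_num, Real.log_pow]; norm_num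

lemma neg_log_le_of_le {q : ℝ} (h : 1 / 256 ≤ q) : -Real.log q ≤ 8 * Real.log 2 := by
  have := Real.log_le_log (by norm_num) h
  rw [one_div, Real.log_inv, log_256] at this
  linarith

lemma Nk_le_of_far (hδ : 0 < δ) {b y : ℂ} (hb : b ∈ cdisc) (hy : y ∈ cdisc)
    (h : 1 / 16 ≤ ‖b - y‖) : Nk δ b y ≤ 8 * Real.log 2 := by
  refine (Nk_le_neg_log hδ hb hy).trans (neg_log_le_of_le ?_)
  rw [Q1, norm_sub_rev]; nlinarith [sq_nonneg δ]

lemma Nk_le_of_inner (hδ : 0 < δ) {b y : ℂ} (hb : b ∈ cdisc) (h : ‖y‖ ≤ 15 / 16) :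
    Nk δ b y ≤ -(1 / 2) * Real.log (Q1 δ b y) + 4 * Real.log 2 := by
  have hb1 : ‖b‖ ≤ 1 := by simpa [cdisc] using hb
  have h2 : 1 - ‖(starRingEnd ℂ) b * y‖ ≤ ‖1 - (starRingEnd ℂ) b * y‖ := by
    simpa using norm_sub_norm_le 1 ((starRingEnd ℂ) b * y)
  rw [norm_mul, RCLike.norm_conj] at h2
  have h3 : 1 / 16 ≤ ‖1 - (starRingEnd ℂ) b * y‖ := by nlinarith [norm_nonneg y, norm_nonneg b]
  have h4 : 1 / 256 ≤ Q2 δ b y := by rw [Q2]; nlinarith [sq_nonneg δ]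
  have := neg_log_le_of_le h4
  unfold Nk; linarith

lemma exp_const_le {c : ℝ} (hc : c ≤ 9 / 8) (hc0 : 0 ≤ c) {t : ℝ} (ht : t ≤ 8 * Real.log 2) :
    Real.exp (c * t) ≤ 512 := by
  have hl : 0 < Real.log 2 := Real.log_pos (by norm_num)
  have h : c * t ≤ Real.log 512 := by
    rw [show (512:ℝ) = 2 ^ 9 by norm_num, Real.log_pow]
    push_cast
    nlinarith
  calc Real.exp (c * t) ≤ Real.exp (Real.log 512) := Real.exp_le_exp.mpr h
    _ = 512 := Real.exp_log (by norm_num)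

/-- No boundary concentration of `μ` bounds the exponential of its potential. -/
lemma exp_potential_le (hμ : μ cdiscᶜ = 0) (hδ : 0 < δ)
    (hS : ∀ y ∈ cdisc, 15 / 16 ≤ ‖y‖ → μ.real (ball y (1 / 16)) ≤ 2 / 3)
    {r : ℝ} (hr : 0 < r) (hr1 : r ≤ 3 / 4) {y : ℂ} (hy : y ∈ cdisc) :
    Real.exp (3 / 2 * r * ∫ b, Nk δ b y ∂μ) ≤
      512 * (1 + 3 / 2 * ∫ b, Q1 δ b y ^ (-r) ∂μ) := by
  have hc : 3 / 2 * r ≤ 9 / 8 := by linarith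
  have hc0 : 0 ≤ 3 / 2 * r := by linarith
  have iN := integrable_cdisc hμ (continuous_Nk_left hδ y)
  have iQ := integrable_cdisc hμ (continuous_Q1_rpow_left hδ y (-r))
  have iL : Integrable (fun b => Real.log (Q1 δ b y)) μ := integrable_cdisc hμ
    ((continuous_Q1_left y).log fun b => (Q1_pos hδ b y).ne')
  have hae : ∀ᵐ b ∂μ, b ∈ cdisc := hμ
  have hQ0 : ∀ b, 0 ≤ Q1 δ b y ^ (-r) := fun b => (Real.rpow_pos_of_pos (Q1_pos hδ b y) _).le
  have hpow : ∀ (s : ℝ) b, Real.exp (-s * Real.log (Q1 δ b y)) = Q1 δ b y ^ (-s) := fun s b => by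
    rw [Real.rpow_def_of_pos (Q1_pos hδ b y)]; ring_nf
  rcases le_or_gt (15 / 16) ‖y‖ with h | h
  · set S := ball y (1 / 16)
    have hSm : MeasurableSet S := measurableSet_ball
    have e : ∫ b, Nk δ b y ∂μ = ∫ b in S, Nk δ b y ∂μ + ∫ b in Sᶜ, Nk δ b y ∂μ :=
      (integral_add_compl hSm iN).symm
    have b1 : ∫ b in Sᶜ, Nk δ b y ∂μ ≤ 8 * Real.log 2 := by
      have hl : 0 < Real.log 2 := Real.log_pos (by norm_num)
      calc ∫ b in Sᶜ, Nk δ b y ∂μ ≤ ∫ b in Sᶜ, 8 * Real.log 2 ∂μ := by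
            refine integral_mono_ae iN.restrict (integrable_const _) ?_
            filter_upwards [ae_restrict_of_ae hae, ae_restrict_mem hSm.compl] with b hb hbS
            refine Nk_le_of_far hδ hb hy ?_
            rw [mem_compl_iff, mem_ball, dist_eq_norm] at hbS
            linarith
        _ ≤ 8 * Real.log 2 := by
            rw [integral_const, smul_eq_mul, measureReal_restrict_apply_univ]
            have := measureReal_le_one (μ := μ) (s := Sᶜ)
            nlinarith
    have b2 : 3 / 2 * r * ∫ b in S, Nk δ b y ∂μ ≤
        ∫ b in S, -(3 / 2 * r) * Real.log (Q1 δ b y) ∂μ := by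
      rw [← integral_const_mul]
      refine integral_mono_ae (iN.restrict.const_mul _) (iL.restrict.const_mul _) ?_
      filter_upwards [ae_restrict_of_ae hae] with b hb
      have := mul_le_mul_of_nonneg_left (Nk_le_neg_log hδ hb hy) hc0
      linarith
    have e2 : ∀ b, Real.exp (2 / 3 * (-(3 / 2 * r) * Real.log (Q1 δ b y))) = Q1 δ b y ^ (-r) :=
      fun b => by rw [← hpow]; ring_nf
    have b3 := exp_setIntegral_le (hS y hy h) (iL.const_mul (-(3 / 2 * r)))
      (by simp_rw [e2]; exact iQ)
    simp_rw [e2] at b3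
    have b4 : ∫ b in S, Q1 δ b y ^ (-r) ∂μ ≤ ∫ b, Q1 δ b y ^ (-r) ∂μ :=
      setIntegral_le_integral iQ (ae_of_all _ hQ0)
    rw [e, mul_add, Real.exp_add, mul_comm]
    exact mul_le_mul (exp_const_le hc hc0 b1)
      ((Real.exp_le_exp.mpr b2).trans (b3.trans (by linarith))) (Real.exp_pos _).le (by norm_num)
  · have iQ' := integrable_cdisc hμ (continuous_Q1_rpow_left hδ y (-(3 / 4 * r)))
    have b2 : 3 / 2 * r * ∫ b, Nk δ b y ∂μ ≤
        ∫ b, -(3 / 4 * r) * Real.log (Q1 δ b y) ∂μ + 3 / 2 * r * (4 * Real.log 2) := by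
      rw [← integral_const_mul]
      calc ∫ b, 3 / 2 * r * Nk δ b y ∂μ
          ≤ ∫ b, (-(3 / 4 * r) * Real.log (Q1 δ b y) + 3 / 2 * r * (4 * Real.log 2)) ∂μ := by
            refine integral_mono_ae (iN.const_mul _)
              ((iL.const_mul _).add (integrable_const _)) ?_
            filter_upwards [hae] with b hb
            have := mul_le_mul_of_nonneg_left (Nk_le_of_inner hδ hb h.le) hc0
            linarith
        _ = _ := by rw [integral_add (iL.const_mul _) (integrable_const _)]; simp
    have b3 := exp_integral_le (iL.const_mul (-(3 / 4 * r))) (by simp_rw [hpow]; exact iQ')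
    simp_rw [hpow] at b3
    have b4 : ∫ b, Q1 δ b y ^ (-(3 / 4 * r)) ∂μ ≤ 1 + ∫ b, Q1 δ b y ^ (-r) ∂μ := by
      calc ∫ b, Q1 δ b y ^ (-(3 / 4 * r)) ∂μ ≤ ∫ b, (1 + Q1 δ b y ^ (-r)) ∂μ := by
            refine integral_mono iQ' ((integrable_const _).add iQ) fun b => ?_
            have hq := Q1_pos hδ b y
            simp only
            rcases le_or_gt 1 (Q1 δ b y) with h1 | h1
            · have := Real.rpow_le_one_of_one_le_of_nonpos h1 (by linarith : -(3 / 4 * r) ≤ 0)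
              linarith [hQ0 b]
            · have := Real.rpow_le_rpow_of_exponent_ge hq h1.le (by linarith : -r ≤ -(3 / 4 * r))
              linarith
        _ = _ := by rw [integral_add (integrable_const _) iQ]; simp
    have b5 : 0 ≤ ∫ b, Q1 δ b y ^ (-r) ∂μ := integral_nonneg hQ0
    have hl : 0 < Real.log 2 := Real.log_pos (by norm_num)
    calc Real.exp (3 / 2 * r * ∫ b, Nk δ b y ∂μ)
        ≤ Real.exp (∫ b, -(3 / 4 * r) * Real.log (Q1 δ b y) ∂μ + 3 / 2 * r * (4 * Real.log 2)) :=
          Real.exp_le_exp.mpr b2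
      _ ≤ (1 + 3 / 2 * ∫ b, Q1 δ b y ^ (-r) ∂μ) * 512 := by
          rw [Real.exp_add]
          exact mul_le_mul (b3.trans (b4.trans (by linarith)))
            (exp_const_le hc hc0 (by linarith)) (Real.exp_pos _).le (by positivity)
      _ = _ := mul_comm _ _

lemma continuous_potential (hμ : μ cdiscᶜ = 0) (hδ : 0 < δ) :
    Continuous (fun y => ∫ b, Nk δ b y ∂μ) := by
  have e : μ.restrict cdisc = μ := Measure.restrict_eq_self_of_ae_mem hμ
  have hN : Continuous (Function.uncurry fun y b => Nk δ b y) := by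
    have h : Continuous (fun p : ℂ × ℂ => Nk δ p.2 p.1) := by
      have := (continuous_Nk hδ).comp continuous_swap
      simpa only [Function.comp_def, Prod.fst_swap, Prod.snd_swap] using this
    simpa only [Function.uncurry_def] using h
  have := continuous_parametric_integral_of_continuous (μ := μ) (f := fun y b => Nk δ b y)
    hN isCompact_cdisc
  rwa [e] at this

/-- Integrated version of `exp_potential_le`. -/
lemma integral_exp_potential_le (hμ : μ cdiscᶜ = 0) (hδ : 0 < δ)
    (hS : ∀ y ∈ cdisc, 15 / 16 ≤ ‖y‖ → μ.real (ball y (1 / 16)) ≤ 2 / 3)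
    {r : ℝ} (hr : 0 < r) (hr1 : r ≤ 3 / 4) {a : ℂ} (ha : a ∈ odisc) {ν : Measure ℂ}
    [IsFiniteMeasure ν] (hν : ν cdiscᶜ = 0) {w : ℂ → ℝ} (hw : ContinuousOn w cdisc)
    (hw0 : ∀ x ∈ cdisc, 0 ≤ w x) {W K : ℝ} (hW : ∫ x, w x ∂ν ≤ W)
    (hK : ∀ b ∈ cdisc, ∫ x, Q1 δ b (Psi a x) ^ (-r) * w x ∂ν ≤ K) :
    ∫ x, Real.exp (3 / 2 * r * ∫ b, Nk δ b (Psi a x) ∂μ) * w x ∂ν ≤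
      512 * (W + 3 / 2 * K) := by
  have hae : ∀ᵐ b ∂μ, b ∈ cdisc := hμ
  have hae' : ∀ᵐ b ∂ν, b ∈ cdisc := hν
  have hc : ContinuousOn (fun x => ∫ b, Nk δ b (Psi a x) ∂μ) cdisc :=
    (continuous_potential hμ hδ).comp_continuousOn (continuousOn_Psi ha)
  have iw := integrable_of_continuousOn isCompact_cdisc hν hw
  have hF : Integrable (fun q : ℂ × ℂ => Q1 δ q.2 (Psi a q.1) ^ (-r) * w q.1) (ν.prod μ) := by
    refine integrable_prod_of_continuousOn isCompact_cdisc isCompact_cdisc hν hμ ?_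
    have h1 : ContinuousOn (fun q : ℂ × ℂ => Q1 δ q.2 (Psi a q.1)) (cdisc ×ˢ cdisc) :=
      (continuous_Q1 δ).comp_continuousOn (f := fun q : ℂ × ℂ => (q.2, Psi a q.1))
        (continuousOn_snd.prodMk ((continuousOn_Psi ha).comp continuousOn_fst fun q hq => hq.1))
    exact (h1.rpow_const fun q _ => Or.inl (Q1_pos hδ _ _).ne').mul
      (hw.comp continuousOn_fst fun q hq => hq.1)
  have iF := hF.integral_prod_left
  have step : ∫ x, Real.exp (3 / 2 * r * ∫ b, Nk δ b (Psi a x) ∂μ) * w x ∂ν ≤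
      ∫ x, (512 * w x + 768 * ∫ b, Q1 δ b (Psi a x) ^ (-r) * w x ∂μ) ∂ν := by
    refine integral_mono_ae (integrable_of_continuousOn isCompact_cdisc hν
      ((Real.continuous_exp.comp_continuousOn (continuousOn_const.mul hc)).mul hw))
      ((iw.const_mul _).add (iF.const_mul _)) ?_
    filter_upwards [hae'] with x hx
    have h1 := mul_le_mul_of_nonneg_right
      (exp_potential_le hμ hδ hS hr hr1 (Psi_mem_cdisc ha hx)) (hw0 x hx)
    rw [integral_mul_const]
    linarith
  have e1 : ∫ x, (512 * w x + 768 * ∫ b, Q1 δ b (Psi a x) ^ (-r) * w x ∂μ) ∂ν =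
      512 * ∫ x, w x ∂ν + 768 * ∫ x, ∫ b, Q1 δ b (Psi a x) ^ (-r) * w x ∂μ ∂ν := by
    rw [integral_add (iw.const_mul _) (iF.const_mul _), integral_const_mul, integral_const_mul]
  have e2 : ∫ x, ∫ b, Q1 δ b (Psi a x) ^ (-r) * w x ∂μ ∂ν =
      ∫ b, ∫ x, Q1 δ b (Psi a x) ^ (-r) * w x ∂ν ∂μ := integral_integral_swap hF
  have b2 : ∫ b, ∫ x, Q1 δ b (Psi a x) ^ (-r) * w x ∂ν ∂μ ≤ K := by
    calc _ ≤ ∫ b, K ∂μ := by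
          refine integral_mono_ae hF.integral_prod_right (integrable_const _) ?_
          filter_upwards [hae] with b hb using hK b hb
      _ = K := by simp
  rw [e1, e2] at step
  linarith

end potential

/-! ### Balancing a measure by a disc automorphism -/

section balance

lemma neg_mem_odisc {a : ℂ} (ha : a ∈ odisc) : -a ∈ odisc := by
  simpa [odisc] using ha

lemma Psi_Psi_neg {a b : ℂ} (ha : a ∈ odisc) (hb : b ∈ cdisc) : Psi a (Psi (-a) b) = b := by
  have h1 := one_sub_ne (neg_mem_odisc ha) hb
  have h2 := one_sub_ne ha (Psi_mem_cdisc (neg_mem_odisc ha) hb)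
  rw [Psi, div_eq_iff h2, Psi]
  rw [map_neg, neg_mul, sub_neg_eq_add] at h1 ⊢
  rw [sub_neg_eq_add]
  generalize (starRingEnd ℂ) a = c at h1 ⊢
  have e1 : (b + a) / (1 + c * b) - a = b * (1 - c * a) / (1 + c * b) := by
    rw [div_sub' h1]; ring_nf
  have e2 : 1 - c * ((b + a) / (1 + c * b)) = (1 - c * a) / (1 + c * b) := by
    rw [mul_div_assoc', one_sub_div h1]; ring_nf
  rw [e1, e2, mul_div_assoc]

lemma pa_Psi {a c x : ℂ} (ha : a ∈ odisc) (hc : c ∈ odisc) (hx : x ∈ cdisc) :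
    pa (Psi a c) (Psi a x) = pa c x - pa a x := by
  have hc' := odisc_subset_cdisc hc
  have h1 := dn_pos hc hx
  have h2 := wa_pos ha hx
  have h3 := wa_pos ha hc'
  have h4 := one_sub_sq_pos hc
  rw [pa, pa, dn_def, one_sub_Psi_sq ha hx hc', one_sub_norm_Psi_sq ha hc', ← dn_def,
    Real.log_mul h1.ne' (by positivity), Real.log_mul h2.ne' h3.ne', Real.log_mul h4.ne' h3.ne',
    log_wa ha hx]
  ring

lemma pa_half_le {y z : ℂ} (hy0 : y ≠ 0) {t : ℝ}
    (h : ‖1 - (starRingEnd ℂ) (y / (2 * ‖y‖)) * z‖ ^ 2 ≤ 3 / 4 * t)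
    (hz : 0 < ‖1 - (starRingEnd ℂ) (y / (2 * ‖y‖)) * z‖) :
    pa (y / (2 * ‖y‖)) z ≤ Real.log t := by
  have hn : ‖y / (2 * ‖y‖)‖ = 1 / 2 := by
    have : ‖y‖ ≠ 0 := norm_ne_zero_iff.mpr hy0
    rw [norm_div, norm_mul, Complex.norm_real, norm_norm]
    simp; field_simp
  rw [pa, dn_def, hn, ← Real.log_div (by positivity) (by norm_num)]
  refine Real.log_le_log (by positivity) ?_
  rw [div_le_iff₀ (by norm_num)]
  linarith

lemma norm_one_sub_near {y z : ℂ} (hy : 15 / 16 ≤ ‖y‖) (hy1 : ‖y‖ ≤ 1) (hz : ‖z - y‖ < 1 / 16) :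
    ‖1 - (starRingEnd ℂ) (y / (2 * ‖y‖)) * z‖ ≤ 9 / 16 := by
  have hy0 : (‖y‖ : ℂ) ≠ 0 := by
    have : (0:ℝ) < ‖y‖ := by linarith
    exact_mod_cast this.ne'
  have hn : ‖(starRingEnd ℂ) (y / (2 * ‖y‖))‖ = 1 / 2 := by
    rw [RCLike.norm_conj, norm_div, norm_mul, Complex.norm_real, norm_norm]
    have : (0:ℝ) < ‖y‖ := by linarith
    simp; field_simp
  have e : 1 - (starRingEnd ℂ) (y / (2 * ‖y‖)) * z =
      ((1 - ‖y‖ / 2 : ℝ) : ℂ) - (starRingEnd ℂ) (y / (2 * ‖y‖)) * (z - y) := by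
    have h := mul_conj_eq y
    have : (starRingEnd ℂ) (y / (2 * ‖y‖)) * y = (‖y‖ : ℂ) / 2 := by
      rw [map_div₀, map_mul, Complex.conj_ofReal, map_ofNat, div_mul_eq_mul_div, mul_comm, h]
      push_cast
      field_simp
    rw [mul_sub, this]; push_cast; ring
  rw [e]
  refine (norm_sub_le _ _).trans ?_
  rw [norm_mul, hn, Complex.norm_real, Real.norm_of_nonneg (by linarith)]
  linarith

lemma log_gap : 3 / 10 ≤ 12 * Real.log 2 - 7 * Real.log 3 := by
  have h := Real.one_sub_inv_le_log_of_pos (by norm_num : (0:ℝ) < 4096 / 2187)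
  rw [Real.log_div (by norm_num) (by norm_num), show (4096:ℝ) = 2 ^ 12 by norm_num,
    show (2187:ℝ) = 3 ^ 7 by norm_num, Real.log_pow, Real.log_pow] at h
  norm_num at h
  linarith

lemma continuousOn_pa {a : ℂ} (ha : a ∈ odisc) : ContinuousOn (pa a) cdisc :=
  (contDiffOn_pa ha).continuousOn

lemma map_Psi_compl {a : ℂ} (ha : a ∈ odisc) {μ : Measure ℂ} (hμ : μ cdiscᶜ = 0) :
    μ.map (Psi a) cdiscᶜ = 0 := by
  rw [Measure.map_apply (measurable_Psi a) isCompact_cdisc.measurableSet.compl]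
  exact measure_mono_null (fun x hx hx' => hx (Psi_mem_cdisc ha hx')) hμ

lemma integral_map_Psi {a : ℂ} (ha : a ∈ odisc) {μ : Measure ℂ} [IsFiniteMeasure μ]
    (hμ : μ cdiscᶜ = 0) {φ : ℂ → ℝ} (hφ : ContinuousOn φ cdisc) :
    ∫ y, φ y ∂(μ.map (Psi a)) = ∫ x, φ (Psi a x) ∂μ := by
  refine integral_map (measurable_Psi a).aemeasurable ?_
  exact (integrable_of_continuousOn isCompact_cdisc (map_Psi_compl ha hμ) hφ).1

/-- An almost balanced measure cannot concentrate near a boundary point. -/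
lemma measure_ball_le_of_balanced {μ : Measure ℂ} [IsProbabilityMeasure μ] (hμ : μ cdiscᶜ = 0)
    (h : ∀ b ∈ odisc, -(1 / 10) ≤ ∫ x, pa b x ∂μ) {y : ℂ} (hy : y ∈ cdisc) (hy1 : 15 / 16 ≤ ‖y‖) :
    μ.real (ball y (1 / 16)) ≤ 2 / 3 := by
  have hy' : ‖y‖ ≤ 1 := by simpa [cdisc] using hy
  have hy0 : y ≠ 0 := by rintro rfl; norm_num at hy1
  set b := y / (2 * ‖y‖) with hb
  have hn : ‖b‖ = 1 / 2 := by
    have : ‖y‖ ≠ 0 := norm_ne_zero_iff.mpr hy0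
    rw [hb, norm_div, norm_mul, Complex.norm_real, norm_norm]
    simp; field_simp
  have hbo : b ∈ odisc := by simp [odisc, hn]; norm_num
  have hae : ∀ᵐ x ∂μ, x ∈ cdisc := hμ
  set S := ball y (1 / 16)
  have hSm : MeasurableSet S := measurableSet_ball
  have ip : Integrable (pa b) μ := integrable_of_continuousOn isCompact_cdisc hμ (continuousOn_pa hbo)
  have hpos : ∀ z ∈ cdisc, 0 < ‖1 - (starRingEnd ℂ) b * z‖ := fun z hz =>
    norm_pos_iff.mpr (one_sub_ne hbo hz)
  have b1 : ∫ x in S, pa b x ∂μ ≤ μ.real S * Real.log (27 / 64) := by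
    calc ∫ x in S, pa b x ∂μ ≤ ∫ x in S, Real.log (27 / 64) ∂μ := by
          refine integral_mono_ae ip.restrict (integrable_const _) ?_
          filter_upwards [ae_restrict_of_ae hae, ae_restrict_mem hSm] with z hz hzS
          rw [mem_ball, dist_eq_norm] at hzS
          refine pa_half_le hy0 ?_ (hpos z hz)
          have := norm_one_sub_near hy1 hy' hzS
          nlinarith [hpos z hz]
      _ = _ := by rw [integral_const, smul_eq_mul, measureReal_restrict_apply_univ]
  have b2 : ∫ x in Sᶜ, pa b x ∂μ ≤ (1 - μ.real S) * Real.log 3 := by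
    calc ∫ x in Sᶜ, pa b x ∂μ ≤ ∫ x in Sᶜ, Real.log 3 ∂μ := by
          refine integral_mono_ae ip.restrict (integrable_const _) ?_
          filter_upwards [ae_restrict_of_ae hae] with z hz
          refine pa_half_le hy0 ?_ (hpos z hz)
          have hz' : ‖z‖ ≤ 1 := by simpa [cdisc] using hz
          have h2 := norm_sub_le 1 ((starRingEnd ℂ) b * z)
          rw [norm_mul, RCLike.norm_conj, hn, norm_one] at h2
          nlinarith [hpos z hz]
      _ = _ := by rw [integral_const, smul_eq_mul, measureReal_restrict_apply_univ,
                    probReal_compl_eq_one_sub hSm]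
  have e := integral_add_compl hSm ip
  have h0 := h b hbo
  have hg := log_gap
  have hl : 0 < Real.log 3 := Real.log_pos (by norm_num)
  rw [Real.log_div (by norm_num) (by norm_num), show (27:ℝ) = 3 ^ 3 by norm_num,
    show (64:ℝ) = 2 ^ 6 by norm_num, Real.log_pow, Real.log_pow] at b1
  push_cast at b1
  by_contra! hs
  nlinarith

lemma exists_spread {μ : Measure ℂ} [IsProbabilityMeasure μ] (hμ : μ cdiscᶜ = 0) {M : ℝ}
    (hM : ∀ a ∈ odisc, -M ≤ ∫ x, pa a x ∂μ) :
    ∃ a ∈ odisc, ∀ y ∈ cdisc, 15 / 16 ≤ ‖y‖ →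
      (μ.map (Psi a)).real (ball y (1 / 16)) ≤ 2 / 3 := by
  set J : Set ℝ := (fun a => ∫ x, pa a x ∂μ) '' odisc
  have hne : J.Nonempty := ⟨_, 0, by simp [odisc], rfl⟩
  have hbd : BddBelow J := ⟨-M, by rintro _ ⟨a, ha, rfl⟩; exact hM a ha⟩
  obtain ⟨_, ⟨a, ha, rfl⟩, hlt⟩ := exists_lt_of_csInf_lt hne
    (lt_add_of_pos_right (sInf J) (by norm_num : (0:ℝ) < 1 / 10))
  have : IsProbabilityMeasure (μ.map (Psi a)) :=
    Measure.isProbabilityMeasure_map (measurable_Psi a).aemeasurable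
  refine ⟨a, ha, fun y hy hy1 => measure_ball_le_of_balanced (map_Psi_compl ha hμ) ?_ hy hy1⟩
  intro b hb
  have hc : Psi (-a) b ∈ odisc := Psi_mem_odisc (neg_mem_odisc ha) hb
  have hmin : sInf J ≤ ∫ x, pa (Psi (-a) b) x ∂μ := csInf_le hbd ⟨_, hc, rfl⟩
  have hae : ∀ᵐ x ∂μ, x ∈ cdisc := hμ
  have e : ∫ x, pa b (Psi a x) ∂μ = ∫ x, pa (Psi (-a) b) x ∂μ - ∫ x, pa a x ∂μ := by
    rw [← integral_sub
      (integrable_of_continuousOn isCompact_cdisc hμ (continuousOn_pa hc))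
      (integrable_of_continuousOn isCompact_cdisc hμ (continuousOn_pa ha))]
    refine integral_congr_ae ?_
    filter_upwards [hae] with x hx
    rw [← pa_Psi ha hc hx, Psi_Psi_neg ha (odisc_subset_cdisc hb)]
  rw [integral_map_Psi ha hμ (continuousOn_pa hb), e]
  simp only at hlt
  linarith

end balance

/-! ### A Moser–Trudinger type inequality -/

lemma tilted_compl {ν : Measure ℂ} (hν : ν cdiscᶜ = 0) (f : ℂ → ℝ) : ν.tilted f cdiscᶜ = 0 :=
  tilted_absolutelyContinuous ν f hν

section gibbs
variable {ν : Measure ℂ} [IsFiniteMeasure ν]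

lemma integrable_exp_mul (hν : ν cdiscᶜ = 0) {u : ℂ → ℝ} (hu : ContinuousOn u cdisc) (k : ℝ) :
    Integrable (fun x => Real.exp (k * u x)) ν :=
  integrable_of_continuousOn isCompact_cdisc hν
    (Real.continuous_exp.comp_continuousOn (continuousOn_const.mul hu))

lemma gibbs_le [NeZero ν] (hν : ν cdiscᶜ = 0) {u : ℂ → ℝ} (hu : ContinuousOn u cdisc)
    {k : ℝ} (hk : 0 < k) (hk2 : k ≤ 2) {a : ℂ} (ha : a ∈ odisc) {ε : ℝ} (hε : 0 < ε) (hε1 : ε < 1)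
    (hS : ∀ y ∈ cdisc, 15 / 16 ≤ ‖y‖ →
      ((ν.tilted fun x => k * u x).map (Psi a)).real (ball y (1 / 16)) ≤ 2 / 3)
    {W K : ℝ} (hW : ∫ x, Real.exp (-(k * pa a x)) ∂ν ≤ W)
    (hK : ∀ δ : ℝ, 0 < δ → δ < 1 → ∀ b ∈ cdisc,
      ∫ x, Q1 δ b (Psi a x) ^ (-(3 / 8 * k)) * Real.exp (-(k * pa a x)) ∂ν ≤ K) :
    9 / 16 * k * ∫ q, (Nk ε q.1 q.2 + pa a q.1 + pa a q.2)
        ∂((ν.tilted fun x => k * u x).prod (ν.tilted fun x => k * u x)) ≤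
      k * ∫ x, (u x + pa a x) ∂(ν.tilted fun x => k * u x) -
        Real.log (∫ x, Real.exp (k * u x) ∂ν) + Real.log (512 * (W + 3 / 2 * K)) := by
  have hexp := integrable_exp_mul hν hu k
  have : IsProbabilityMeasure (ν.tilted fun x => k * u x) := isProbabilityMeasure_tilted hexp
  have hμ := tilted_compl hν fun x => k * u x
  have hZ : 0 < ∫ x, Real.exp (k * u x) ∂ν := integral_exp_pos hexp
  have htil : ∀ g : ℂ → ℝ, ∫ x, g x ∂(ν.tilted fun x => k * u x) =
      ∫ x, (Real.exp (k * u x) / ∫ x, Real.exp (k * u x) ∂ν) • g x ∂ν :=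
    fun g => integral_tilted _ _
  set μ := ν.tilted fun x => k * u x
  set Z := ∫ x, Real.exp (k * u x) ∂ν
  have : IsProbabilityMeasure (μ.map (Psi a)) :=
    Measure.isProbabilityMeasure_map (measurable_Psi a).aemeasurable
  have hμ' := map_Psi_compl ha hμ
  have hm := one_sub_sq_pos ha
  set δ := ε * ((1 - ‖a‖ ^ 2) / 4) with hδdef
  have hδ : 0 < δ := by positivity
  have hδ1 : δ < 1 := by rw [hδdef]; nlinarith [sq_nonneg ‖a‖]
  have hpc := continuousOn_pa ha
  have hae : ∀ᵐ x ∂μ, x ∈ cdisc := hμ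
  set P : ℂ → ℝ := fun x => ∫ b, Nk δ b (Psi a x) ∂(μ.map (Psi a)) with hP
  have hPc : ContinuousOn P cdisc :=
    (continuous_potential hμ' hδ).comp_continuousOn (continuousOn_Psi ha)
  have hD : ∫ q, (Nk ε q.1 q.2 + pa a q.1 + pa a q.2) ∂(μ.prod μ) ≤ ∫ x, P x ∂μ := by
    have hae2 : ∀ᵐ q ∂(μ.prod μ), q ∈ cdisc ×ˢ cdisc := prod_compl_eq_zero hμ hμ
    have hN : Integrable (fun q : ℂ × ℂ => Nk δ (Psi a q.1) (Psi a q.2)) (μ.prod μ) := by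
      refine integrable_prod_of_continuousOn isCompact_cdisc isCompact_cdisc hμ hμ ?_
      exact (continuous_Nk hδ).comp_continuousOn (f := fun q : ℂ × ℂ => (Psi a q.1, Psi a q.2))
        (((continuousOn_Psi ha).comp continuousOn_fst fun q hq => hq.1).prodMk
        ((continuousOn_Psi ha).comp continuousOn_snd fun q hq => hq.2))
    have hN' : Integrable (fun q : ℂ × ℂ => Nk ε q.1 q.2 + pa a q.1 + pa a q.2) (μ.prod μ) := by
      refine integrable_prod_of_continuousOn isCompact_cdisc isCompact_cdisc hμ hμ ?_
      exact ((continuous_Nk hε).continuousOn.add (hpc.comp continuousOn_fst fun q hq => hq.1)).add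
        (hpc.comp continuousOn_snd fun q hq => hq.2)
    calc _ ≤ ∫ q, Nk δ (Psi a q.1) (Psi a q.2) ∂(μ.prod μ) := by
          refine integral_mono_ae hN' hN ?_
          filter_upwards [hae2] with q hq using Nk_add_pa_le ha hε hq.2 hq.1
      _ = ∫ x, ∫ b, Nk δ (Psi a b) (Psi a x) ∂μ ∂μ := integral_prod_symm _ hN
      _ = ∫ x, P x ∂μ := by
          congr 1
          ext x
          exact (integral_map_Psi ha hμ (continuous_Nk_left hδ _).continuousOn).symm
  have hgc : ContinuousOn (fun x => 9 / 16 * k * P x - k * (u x + pa a x) + Real.log Z) cdisc :=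
    ((continuousOn_const.mul hPc).sub (continuousOn_const.mul (hu.add hpc))).add continuousOn_const
  have iP := integrable_of_continuousOn isCompact_cdisc hμ hPc
  have iu := integrable_of_continuousOn isCompact_cdisc hμ (hu.add hpc)
  have jen := exp_integral_le (integrable_of_continuousOn isCompact_cdisc hμ hgc)
    (integrable_of_continuousOn isCompact_cdisc hμ (Real.continuous_exp.comp_continuousOn hgc))
  have e1 : ∫ x, (9 / 16 * k * P x - k * (u x + pa a x) + Real.log Z) ∂μ =
      9 / 16 * k * ∫ x, P x ∂μ - k * ∫ x, (u x + pa a x) ∂μ + Real.log Z := by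
    have i1 : Integrable (fun x => 9 / 16 * k * P x) μ := iP.const_mul _
    have i2 : Integrable (fun x => k * (u x + pa a x)) μ := iu.const_mul _
    have i3 : Integrable (fun x => 9 / 16 * k * P x - k * (u x + pa a x)) μ := i1.sub i2
    rw [integral_add i3 (integrable_const _), integral_sub i1 i2, integral_const_mul,
      integral_const_mul]
    simp
  have e2 : ∫ x, Real.exp (9 / 16 * k * P x - k * (u x + pa a x) + Real.log Z) ∂μ =
      ∫ x, Real.exp (3 / 2 * (3 / 8 * k) * P x) * Real.exp (-(k * pa a x)) ∂ν := by
    rw [htil]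
    refine integral_congr_ae (ae_of_all _ fun x => ?_)
    simp only [smul_eq_mul]
    rw [Real.exp_add, Real.exp_log hZ, div_mul_eq_mul_div, div_eq_iff hZ.ne', ← mul_assoc,
      ← Real.exp_add, ← Real.exp_add]
    ring_nf
  have b := integral_exp_potential_le hμ' hδ hS (r := 3 / 8 * k) (by positivity) (by linarith) ha hν
    (w := fun x => Real.exp (-(k * pa a x)))
    (Real.continuous_exp.comp_continuousOn (continuousOn_const.mul hpc).neg)
    (fun x _ => (Real.exp_pos _).le) hW (fun b hb => hK δ hδ hδ1 b hb)
  rw [e1, e2] at jen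
  have := (Real.le_log_iff_exp_le ((Real.exp_pos _).trans_le (jen.trans b))).mpr (jen.trans b)
  have := mul_le_mul_of_nonneg_left hD (by positivity : 0 ≤ 9 / 16 * k)
  linarith

/-- The measures `ν.tilted (k * u)` have `∫ pa a` bounded below in `a`. -/
lemma exists_lower_integral_pa [NeZero ν] (hν : ν cdiscᶜ = 0) {u : ℂ → ℝ}
    (hu : ContinuousOn u cdisc) (k : ℝ) {W : ℝ} (hW : ∀ a ∈ odisc, ∫ x, wa a x ∂ν ≤ W) :
    ∃ M, ∀ a ∈ odisc, -M ≤ ∫ x, pa a x ∂(ν.tilted fun x => k * u x) := by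
  have hexp := integrable_exp_mul hν hu k
  have : IsProbabilityMeasure (ν.tilted fun x => k * u x) := isProbabilityMeasure_tilted hexp
  have hμ := tilted_compl hν fun x => k * u x
  have hZ : 0 < ∫ x, Real.exp (k * u x) ∂ν := integral_exp_pos hexp
  have hec : ContinuousOn (fun x => Real.exp (k * u x) / ∫ x, Real.exp (k * u x) ∂ν) cdisc :=
    (Real.continuous_exp.comp_continuousOn (continuousOn_const.mul hu)).div_const _
  obtain ⟨B, hB⟩ := isCompact_cdisc.bddAbove_image hec
  refine ⟨B * W, fun a ha => ?_⟩
  have hB' : ∀ x ∈ cdisc, Real.exp (k * u x) / ∫ x, Real.exp (k * u x) ∂ν ≤ B := fun x hx =>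
    hB ⟨x, hx, rfl⟩
  have hB0 : 0 ≤ B := (by positivity : (0:ℝ) ≤ _).trans (hB' 0 (by simp [cdisc]))
  have hae : ∀ᵐ x ∂(ν.tilted fun x => k * u x), x ∈ cdisc := hμ
  have hae' : ∀ᵐ x ∂ν, x ∈ cdisc := hν
  have h1 : -∫ x, pa a x ∂(ν.tilted fun x => k * u x) ≤
      ∫ x, wa a x ∂(ν.tilted fun x => k * u x) := by
    rw [← integral_neg]
    refine integral_mono_ae
      (integrable_of_continuousOn isCompact_cdisc hμ (continuousOn_pa ha)).neg
      (integrable_of_continuousOn isCompact_cdisc hμ (continuousOn_wa ha)) ?_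
    filter_upwards [hae] with x hx
    rw [← log_wa ha hx]
    exact (Real.log_le_sub_one_of_pos (wa_pos ha hx)).trans (by linarith)
  have h2 : ∫ x, wa a x ∂(ν.tilted fun x => k * u x) ≤ B * ∫ x, wa a x ∂ν := by
    rw [integral_tilted, ← integral_const_mul]
    refine integral_mono_ae
      (integrable_of_continuousOn isCompact_cdisc hν (hec.mul (continuousOn_wa ha)))
      ((integrable_of_continuousOn isCompact_cdisc hν (continuousOn_wa ha)).const_mul _) ?_
    filter_upwards [hae'] with x hx
    exact mul_le_mul_of_nonneg_right (hB' x hx) (wa_pos ha hx).le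
  have := mul_le_mul_of_nonneg_left (hW a ha) hB0
  linarith

/-- Energy bound in terms of `log ∫ exp (k u)`, after a suitable disc automorphism. -/
lemma exists_energy_ge_log [NeZero ν] (hν : ν cdiscᶜ = 0) {k : ℝ} (hk : 0 < k) (hk2 : k ≤ 2)
    {W W' K : ℝ} (hW' : ∀ a ∈ odisc, ∫ x, wa a x ∂ν ≤ W')
    (hW : ∀ a ∈ odisc, ∫ x, Real.exp (-(k * pa a x)) ∂ν ≤ W)
    (hK : ∀ a ∈ odisc, ∀ δ : ℝ, 0 < δ → δ < 1 → ∀ b ∈ cdisc,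
      ∫ x, Q1 δ b (Psi a x) ^ (-(3 / 8 * k)) * Real.exp (-(k * pa a x)) ∂ν ≤ K) :
    ∃ C : ℝ, ∀ u : ℂ → ℝ, ContDiffOn ℝ 1 u cdisc → ∃ a ∈ odisc,
      9 * π / (4 * k) * Real.log (∫ x, Real.exp (k * u x) ∂ν) - C ≤
        En u + 1 / 8 * ∫ x, (u x + pa a x) * wa a x ∂circM := by
  obtain ⟨C, hC⟩ := exists_energy_lower
  refine ⟨9 * π / (4 * k) * Real.log (512 * (W + 3 / 2 * K)) + C, fun u hu => ?_⟩
  have hexp := integrable_exp_mul hν hu.continuousOn k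
  have hprob : IsProbabilityMeasure (ν.tilted fun x => k * u x) := isProbabilityMeasure_tilted hexp
  have hμ := tilted_compl hν fun x => k * u x
  obtain ⟨M, hM⟩ := exists_lower_integral_pa hν hu.continuousOn k hW'
  obtain ⟨a, ha, hS⟩ := exists_spread hμ hM
  refine ⟨a, ha, ?_⟩
  obtain ⟨ε, hε, hε1, hmain⟩ := hC _ hμ u hu a ha
  have hg := gibbs_le hν hu.continuousOn hk hk2 ha hε hε1 hS (hW a ha) (hK a ha)
  have hpi := Real.pi_pos
  have hg' := mul_le_mul_of_nonneg_left hg (by positivity : 0 ≤ 9 * π / (4 * k))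
  set D := ∫ q, (Nk ε q.1 q.2 + pa a q.1 + pa a q.2)
        ∂((ν.tilted fun x => k * u x).prod (ν.tilted fun x => k * u x))
  set I := ∫ x, (u x + pa a x) ∂(ν.tilted fun x => k * u x)
  have e1 : 9 * π / (4 * k) * (9 / 16 * k * D) = 81 * π / 64 * D := by field_simp; ring
  have e2 : 9 * π / (4 * k) * (k * I) = 9 * π / 4 * I := by field_simp
  rw [e1, mul_add, mul_sub, e2] at hg'
  linarith

end gibbs

instance : NeZero discM := ⟨fun h => by
  have := discM_univ; simp [h] at this; exact Real.pi_ne_zero this.symm⟩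

instance : NeZero circM := ⟨fun h => by
  have := circM_univ; simp [h] at this⟩

lemma integral_wa_sq_le {a : ℂ} (ha : a ∈ odisc) : ∫ x, wa a x ^ 2 ∂discM ≤ π := by
  have := integral_comp_Psi_le ha (h := fun _ => 1) (fun _ => zero_le_one) (integrable_const _)
  simpa [discM_univ] using this

lemma integral_wa_le {a : ℂ} (ha : a ∈ odisc) : ∫ x, wa a x ∂discM ≤ π := by
  have h1 : ∫ x, wa a x ∂discM ≤ ∫ x, (1 / 2 * wa a x ^ 2 + 1 / 2) ∂discM := by
    have i := (integrable_discM (continuousOn_wa_sq ha)).const_mul (1 / 2)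
    refine integral_mono (integrable_discM (continuousOn_wa ha))
      (i.add (integrable_const _)) fun x => ?_
    simp only
    nlinarith [sq_nonneg (wa a x - 1)]
  rw [integral_add ((integrable_discM (continuousOn_wa_sq ha)).const_mul _) (integrable_const _),
    integral_const_mul, integral_const, discM_univ, smul_eq_mul] at h1
  linarith [integral_wa_sq_le ha]

lemma exists_energy_ge_log_disc : ∃ C : ℝ, ∀ u : ℂ → ℝ, ContDiffOn ℝ 1 u cdisc → ∃ a ∈ odisc,
    9 * π / 8 * Real.log (∫ x, Real.exp (2 * u x) ∂discM) - C ≤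
      En u + 1 / 8 * ∫ x, (u x + pa a x) * wa a x ∂circM := by
  obtain ⟨K, -, hK⟩ := exists_bound_integral_Q1_rpow
  have hw : ∀ a ∈ odisc, ∀ᵐ x ∂discM, Real.exp (-(2 * pa a x)) = wa a x ^ 2 := by
    intro a ha
    filter_upwards [discM_ae] with x hx
    rw [← exp_neg_pa ha (odisc_subset_cdisc hx), ← Real.exp_nat_mul]; push_cast; ring_nf
  obtain ⟨C, hC⟩ := exists_energy_ge_log discM_compl (k := 2) (by norm_num) le_rfl
    (W := π) (W' := π) (K := 5 * K) (fun a ha => integral_wa_le ha)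
    (fun a ha => by rw [integral_congr_ae (hw a ha)]; exact integral_wa_sq_le ha)
    (fun a ha δ hδ hδ1 b hb => by
      rw [← integral_congr_ae (f := fun x => Q1 δ b (Psi a x) ^ (-(3 / 4) : ℝ) * wa a x ^ 2)]
      · exact integral_disc_Q1_Psi_le ha hδ hδ1 hb (hK δ hδ b hb)
      · filter_upwards [hw a ha] with x hx
        rw [hx]; norm_num)
  refine ⟨C, fun u hu => ?_⟩
  obtain ⟨a, ha, h⟩ := hC u hu
  exact ⟨a, ha, by norm_num at h ⊢; exact h⟩

lemma exists_energy_ge_log_circ : ∃ C : ℝ, ∀ u : ℂ → ℝ, ContDiffOn ℝ 1 u cdisc → ∃ a ∈ odisc,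
    9 * π / 4 * Real.log (∫ x, Real.exp (u x) ∂circM) - C ≤
      En u + 1 / 8 * ∫ x, (u x + pa a x) * wa a x ∂circM := by
  obtain ⟨K, -, hK⟩ := exists_bound_integral_Q1_rpow
  have hw : ∀ a ∈ odisc, ∀ᵐ x ∂circM, Real.exp (-(1 * pa a x)) = wa a x := by
    intro a ha
    filter_upwards [circM_ae] with x hx
    rw [one_mul, exp_neg_pa ha (bdry_subset_cdisc hx)]
  obtain ⟨C, hC⟩ := exists_energy_ge_log circM_compl (k := 1) (by norm_num) (by norm_num)
    (W := 2 * π) (W' := 2 * π) (K := 11 * K) (fun a ha => (integral_wa_circ ha).le)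
    (fun a ha => by rw [integral_congr_ae (hw a ha)]; exact (integral_wa_circ ha).le)
    (fun a ha δ hδ hδ1 b hb => by
      rw [← integral_congr_ae (f := fun x => Q1 δ b (Psi a x) ^ (-(3 / 8) : ℝ) * wa a x)]
      · exact integral_circ_Q1_Psi_le ha hδ hδ1 hb (hK δ hδ b hb)
      · filter_upwards [hw a ha] with x hx
        rw [hx]; norm_num)
  refine ⟨C, fun u hu => ?_⟩
  obtain ⟨a, ha, h⟩ := hC u hu
  exact ⟨a, ha, by simpa only [one_mul, mul_one] using h⟩

/-! ### Length and area bounds at bounded energy -/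

section static
variable {a : ℂ} {u : ℂ → ℝ}

lemma exp_add_pa (ha : a ∈ odisc) {x : ℂ} (hx : x ∈ cdisc) :
    Real.exp (u x + pa a x) * wa a x = Real.exp (u x) := by
  rw [← exp_neg_pa ha hx, ← Real.exp_add]; ring_nf

lemma hasGradAt_add_pa (ha : a ∈ odisc) (hu : ContDiffOn ℝ 1 u cdisc) {x : ℂ} (hx : x ∈ odisc) :
    HasGradAt (fun x => u x + pa a x) (gradW u x + Ga a x) x :=
  (hasGradAt_gradW hu hx).add (hasGradAt_pa ha (odisc_subset_cdisc hx))

lemma En_eq (ha : a ∈ odisc) (hu : ContDiffOn ℝ 1 u cdisc) :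
    En u = 1 / 2 * ∫ x, ‖gradW u x + Ga a x‖ ^ 2 ∂discM +
      ∫ x, (u x + pa a x) * wa a x ∂circM := by
  have hg := continuousOn_gradW hu
  have hG := continuousOn_Ga ha
  have hw := (continuousOn_wa ha).mono bdry_subset_cdisc
  have e1 : ∫ x, ‖gradW u x + Ga a x‖ ^ 2 ∂discM = ∫ x, rdot (gradW u x) (gradW u x) ∂discM +
      2 * ∫ x, rdot (gradW u x) (Ga a x) ∂discM + ∫ x, rdot (Ga a x) (Ga a x) ∂discM := by
    have i1 := integrable_rdot hg hg
    have i2 : Integrable (fun x => 2 * rdot (gradW u x) (Ga a x)) discM :=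
      (integrable_rdot hg hG).const_mul _
    have i3 := integrable_rdot hG hG
    have i4 : Integrable (fun x => rdot (gradW u x) (gradW u x) +
      2 * rdot (gradW u x) (Ga a x)) discM := i1.add i2
    rw [← integral_const_mul, ← integral_add i1 i2, ← integral_add i4 i3]
    refine integral_congr_ae (ae_of_all _ fun x => ?_)
    simp only
    rw [← rdot_self]
    simp [rdot]; ring
  have e2 : ∫ x, (u x + pa a x) * wa a x ∂circM =
      ∫ x, u x * wa a x ∂circM + ∫ x, pa a x * wa a x ∂circM := by
    rw [← integral_add]
    · simp_rw [add_mul]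
    · exact integrable_circM ((hu.continuousOn.mono bdry_subset_cdisc).mul hw)
    · exact integrable_circM (((continuousOn_pa ha).mono bdry_subset_cdisc).mul hw)
  rw [En, e1, e2, integral_grad_Ga ha hu, integral_Ga_sq ha, integral_pa_mul_wa ha]
  ring

lemma integral_exp_circ_ge (ha : a ∈ odisc) (hu : ContDiffOn ℝ 1 u cdisc) {M : ℝ}
    (hM : M ≤ ∫ x, (u x + pa a x) * wa a x ∂circM) :
    2 * π * Real.exp (M / (2 * π)) ≤ ∫ x, Real.exp (u x) ∂circM := by
  have hpi := Real.pi_pos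
  set κ := M / (2 * π) with hκ
  have hκM : κ * (2 * π) = M := by rw [hκ]; field_simp
  have hw := (continuousOn_wa ha).mono bdry_subset_cdisc
  have hub := hu.continuousOn.mono bdry_subset_cdisc
  have hpb := (continuousOn_pa ha).mono bdry_subset_cdisc
  have iw := integrable_circM hw
  have iv : Integrable (fun x => (u x + pa a x) * wa a x) circM :=
    integrable_circM ((hub.add hpb).mul hw)
  have i1 : Integrable (fun x => (1 - κ) * wa a x) circM := iw.const_mul _
  have h1 : ∫ x, Real.exp κ * ((1 - κ) * wa a x + (u x + pa a x) * wa a x) ∂circM ≤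
      ∫ x, Real.exp (u x) ∂circM := by
    refine integral_mono_ae ((i1.add iv).const_mul _)
      (integrable_circM (Real.continuous_exp.comp_continuousOn hub)) ?_
    filter_upwards [circM_ae] with x hx
    have hx' := bdry_subset_cdisc hx
    rw [← exp_add_pa ha hx', ← add_mul, ← mul_assoc]
    refine mul_le_mul_of_nonneg_right ?_ (wa_pos ha hx').le
    have e : Real.exp (u x + pa a x) = Real.exp κ * Real.exp (u x + pa a x - κ) := by
      rw [← Real.exp_add]; ring_nf
    rw [e]
    have := Real.add_one_le_exp (u x + pa a x - κ)
    exact mul_le_mul_of_nonneg_left (by linarith) (Real.exp_pos _).le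
  rw [integral_const_mul, integral_add i1 iv, integral_const_mul, integral_wa_circ ha] at h1
  have h2 : 2 * π ≤ (1 - κ) * (2 * π) + ∫ x, (u x + pa a x) * wa a x ∂circM := by
    rw [sub_mul, hκM]; linarith
  have := mul_le_mul_of_nonneg_left h2 (Real.exp_pos κ).le
  linarith

/-- The length is controlled by the area and the Dirichlet energy. -/
lemma integral_exp_circ_le (ha : a ∈ odisc) (hu : ContDiffOn ℝ 1 u cdisc) {s : ℝ} (hs : 0 < s) :
    ∫ x, Real.exp (u x) ∂circM ≤ s / 2 * ∫ x, Real.exp (2 * u x) ∂discM +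
      1 / s * (∫ x, ‖gradW u x + Ga a x‖ ^ 2 ∂discM + 4 * π) := by
  have huc := hu.continuousOn
  have hv : ContDiffOn ℝ 1 (fun x => u x + pa a x) cdisc := hu.add (contDiffOn_pa ha)
  have hφ : ContDiffOn ℝ 1 (fun x => Real.exp (u x + pa a x)) cdisc := hv.exp
  have hc : ContinuousOn (fun x => gradW u x + Ga a x) cdisc :=
    (continuousOn_gradW hu).add (continuousOn_Ga ha)
  have e : ∫ x, Real.exp (u x) ∂circM = ∫ x, Real.exp (u x + pa a x) * wa a x ∂circM := by
    refine integral_congr_ae ?_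
    filter_upwards [circM_ae] with x hx
    rw [exp_add_pa ha (bdry_subset_cdisc hx)]
  have iE := integrable_discM (Real.continuous_exp.comp_continuousOn
    (continuousOn_const.mul huc : ContinuousOn (fun x => 2 * u x) cdisc))
  have iN : Integrable (fun x => ‖gradW u x + Ga a x‖ ^ 2) discM :=
    integrable_discM (hc.norm.pow 2)
  have iw : Integrable (fun x => 4 * wa a x ^ 2) discM :=
    (integrable_discM (continuousOn_wa_sq ha)).const_mul _
  have j1 : Integrable (fun x => s / 2 * Real.exp (2 * u x)) discM := iE.const_mul _
  have j2 : Integrable (fun x => 1 / s * (‖gradW u x + Ga a x‖ ^ 2 + 4 * wa a x ^ 2)) discM :=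
    (iN.add iw).const_mul _
  have k1 : Integrable (fun x => rdot (gradW (fun x => Real.exp (u x + pa a x)) x) (Xa a x))
      discM := integrable_rdot (continuousOn_gradW hφ) (continuousOn_Xa ha)
  have k2 : Integrable (fun x => Real.exp (u x + pa a x) * (2 * wa a x ^ 2)) discM :=
    integrable_discM (hφ.continuousOn.mul (continuousOn_const.mul (continuousOn_wa_sq ha)))
  rw [e, integral_mul_wa_circ ha hφ, ← integral_add k1 k2]
  have main : ∫ x, (rdot (gradW (fun x => Real.exp (u x + pa a x)) x) (Xa a x) +
      Real.exp (u x + pa a x) * (2 * wa a x ^ 2)) ∂discM ≤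
      ∫ x, (s / 2 * Real.exp (2 * u x) +
        1 / s * (‖gradW u x + Ga a x‖ ^ 2 + 4 * wa a x ^ 2)) ∂discM := by
    refine integral_mono_ae (k1.add k2) (j1.add j2) ?_
    filter_upwards [discM_ae] with x hx
    have hx' := odisc_subset_cdisc hx
    have hg := (hasGradAt_add_pa ha hu hx).comp (Real.hasDerivAt_exp _)
    rw [hg.gradW hx', rdot_smul_left]
    have h1 := (le_abs_self _).trans (abs_rdot_le (gradW u x + Ga a x) (Xa a x))
    have h2 := mul_le_mul_of_nonneg_left (norm_Xa_le ha hx') (norm_nonneg (gradW u x + Ga a x))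
    have h3 := mul_le_mul_of_nonneg_left (h1.trans h2) (Real.exp_pos (u x + pa a x)).le
    have h4 := exp_add_pa (u := u) ha hx'
    have h5 : Real.exp (2 * u x) = Real.exp (u x) ^ 2 := by
      rw [← Real.exp_nat_mul]; push_cast; rfl
    rw [h5]
    set N := ‖gradW u x + Ga a x‖
    set w := wa a x
    set E := Real.exp (u x)
    have h6 : Real.exp (u x + pa a x) * (N * w) + Real.exp (u x + pa a x) * (2 * w ^ 2) =
        E * (N + 2 * w) := by rw [← h4]; ring
    have h7 : E * (N + 2 * w) ≤ s / 2 * E ^ 2 + 1 / s * (N ^ 2 + 4 * w ^ 2) := by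
      have h8 : 0 ≤ (s * E - (N + 2 * w)) ^ 2 + (N - 2 * w) ^ 2 := by positivity
      have h9 : s / 2 * E ^ 2 + 1 / s * (N ^ 2 + 4 * w ^ 2) - E * (N + 2 * w) =
          ((s * E - (N + 2 * w)) ^ 2 + (N - 2 * w) ^ 2) / (2 * s) := by
        field_simp; ring
      have := div_nonneg h8 (by positivity : 0 ≤ 2 * s)
      linarith
    linarith
  rw [integral_add j1 j2, integral_const_mul, integral_const_mul, integral_add iN iw,
    integral_const_mul] at main
  refine main.trans ?_
  have := integral_wa_sq_le ha
  gcongr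

end static

/-- At bounded energy, an area lower bound implies a length lower bound. -/
lemma exists_length_lower (C₀ ℓ : ℝ) (hℓ : 0 < ℓ) : ∃ c : ℝ, 0 < c ∧ ∀ u : ℂ → ℝ,
    ContDiffOn ℝ 1 u cdisc → En u ≤ C₀ → ℓ ≤ ∫ x, Real.exp (2 * u x) ∂discM →
      c ≤ ∫ x, Real.exp (u x) ∂circM := by
  obtain ⟨C, hC⟩ := exists_energy_ge_log_disc
  have hpi := Real.pi_pos
  refine ⟨2 * π * Real.exp (8 * (9 * π / 8 * Real.log ℓ - C - C₀) / (2 * π)), by positivity,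
    fun u hu hE hA => ?_⟩
  obtain ⟨a, ha, h⟩ := hC u hu
  refine integral_exp_circ_ge ha hu ?_
  have := mul_le_mul_of_nonneg_left (Real.log_le_log hℓ hA) (by positivity : 0 ≤ 9 * π / 8)
  linarith

/-- At bounded energy, a length lower bound implies an area lower bound. -/
lemma exists_area_lower (C₀ ℓ : ℝ) (hℓ : 0 < ℓ) : ∃ c : ℝ, 0 < c ∧ ∀ u : ℂ → ℝ,
    ContDiffOn ℝ 1 u cdisc → En u ≤ C₀ → ℓ ≤ ∫ x, Real.exp (u x) ∂circM →
      c ≤ ∫ x, Real.exp (2 * u x) ∂discM := by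
  obtain ⟨C, hC⟩ := exists_energy_ge_log_circ
  have hpi := Real.pi_pos
  set M := 8 * (9 * π / 4 * Real.log ℓ - C - C₀) with hM
  set B := 2 * |C₀ - M| + 4 * π with hB
  have hB0 : 0 < B := by positivity
  refine ⟨ℓ ^ 2 / (2 * B), by positivity, fun u hu hE hL => ?_⟩
  obtain ⟨a, ha, h⟩ := hC u hu
  have hm : M ≤ ∫ x, (u x + pa a x) * wa a x ∂circM := by
    have := mul_le_mul_of_nonneg_left (Real.log_le_log hℓ hL) (by positivity : 0 ≤ 9 * π / 4)
    linarith
  have hD := En_eq ha hu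
  have h1 := integral_exp_circ_le ha hu (s := 2 * B / ℓ) (by positivity)
  have h2 : ∫ x, ‖gradW u x + Ga a x‖ ^ 2 ∂discM + 4 * π ≤ B := by
    have := le_abs_self (C₀ - M)
    linarith
  have h3 := mul_le_mul_of_nonneg_left h2 (by positivity : 0 ≤ 1 / (2 * B / ℓ))
  have h4 : 1 / (2 * B / ℓ) * B = ℓ / 2 := by field_simp
  have h5 : ℓ / 2 ≤ 2 * B / ℓ / 2 * ∫ x, Real.exp (2 * u x) ∂discM := by linarith
  rw [div_le_iff₀ (by positivity)]
  have h6 := mul_le_mul_of_nonneg_left h5 hℓ.le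
  have h7 : ∀ A : ℝ, ℓ * (2 * B / ℓ / 2 * A) = B * A := fun A => by field_simp
  rw [h7] at h6
  nlinarith

/-! ### The time domain and space-time derivatives -/

section spacetime
variable {T : ℝ≥0∞} {t : ℝ}

lemma isOpen_ofReal_lt (T : ℝ≥0∞) : IsOpen {t : ℝ | ENNReal.ofReal t < T} :=
  isOpen_lt ENNReal.continuous_ofReal continuous_const

lemma flowDom_mem_nhds (ht : t ∈ flowDom T) (h0 : 0 < t) : flowDom T ∈ 𝓝 t := by
  filter_upwards [Ioi_mem_nhds h0, (isOpen_ofReal_lt T).mem_nhds ht.2] with s h1 h2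
  exact ⟨le_of_lt h1, h2⟩

lemma exists_gt_mem_flowDom (ht : t ∈ flowDom T) : ∃ s ∈ flowDom T, t < s := by
  have h : ∀ᶠ s in 𝓝[>] t, ENNReal.ofReal s < T :=
    mem_nhdsWithin_of_mem_nhds ((isOpen_ofReal_lt T).mem_nhds ht.2)
  obtain ⟨s, h1, h2⟩ := (h.and self_mem_nhdsWithin).exists
  exact ⟨s, ⟨ht.1.trans (le_of_lt h2), h1⟩, h2⟩

lemma Icc_subset_flowDom (ht : t ∈ flowDom T) : Icc 0 t ⊆ flowDom T := fun _ hs =>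
  ⟨hs.1, (ENNReal.ofReal_le_ofReal hs.2).trans_lt ht.2⟩

lemma zero_mem_flowDom (hT : 0 < T) : (0:ℝ) ∈ flowDom T := ⟨le_rfl, by simpa⟩

lemma convex_flowDom (T : ℝ≥0∞) : Convex ℝ (flowDom T) := by
  refine Set.OrdConnected.convex ⟨fun x hx y hy s hs => ?_⟩
  exact Icc_subset_flowDom hy ⟨hx.1.trans hs.1, hs.2⟩

lemma uniqueDiffOn_flowDom (hT : 0 < T) : UniqueDiffOn ℝ (flowDom T) := by
  refine uniqueDiffOn_convex (convex_flowDom T) ?_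
  obtain ⟨s, hs, h⟩ := exists_gt_mem_flowDom (zero_mem_flowDom hT)
  exact ⟨s, mem_interior_iff_mem_nhds.mpr (flowDom_mem_nhds hs h)⟩

lemma pos_of_mem_interior_flowDom (ht : t ∈ interior (flowDom T)) : 0 < t := by
  have h : interior (flowDom T) ⊆ interior (Ici 0) := interior_mono fun s hs => hs.1
  simpa using h ht

/-- The space-time cylinder over the closed disc. -/
def cyl (T : ℝ≥0∞) : Set (ℂ × ℝ) := cdisc ×ˢ flowDom T

lemma uniqueDiffOn_cyl (hT : 0 < T) : UniqueDiffOn ℝ (cyl T) :=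
  uniqueDiffOn_cdisc.prod (uniqueDiffOn_flowDom hT)

/-- The derivative of `h` within the cylinder, in direction `v`. -/
def dirD (T : ℝ≥0∞) (v : ℂ × ℝ) (h : ℂ × ℝ → ℝ) (p : ℂ × ℝ) : ℝ := fderivWithin ℝ h (cyl T) p v

lemma contDiffOn_dirD (hT : 0 < T) (v : ℂ × ℝ) {h : ℂ × ℝ → ℝ}
    (hh : ContDiffOn ℝ (⊤ : ℕ∞) h (cyl T)) : ContDiffOn ℝ (⊤ : ℕ∞) (dirD T v h) (cyl T) :=
  (hh.fderivWithin (uniqueDiffOn_cyl hT) (by simp)).clm_apply contDiffOn_const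

lemma contDiffOn_slice {h : ℂ × ℝ → ℝ} {n : WithTop ℕ∞} (hh : ContDiffOn ℝ n h (cyl T))
    (ht : t ∈ flowDom T) : ContDiffOn ℝ n (fun z => h (z, t)) cdisc :=
  hh.comp (f := fun z : ℂ => (z, t)) (by fun_prop) fun _ hz => ⟨hz, ht⟩

lemma differentiableOn_cyl {h : ℂ × ℝ → ℝ} (hh : ContDiffOn ℝ (⊤ : ℕ∞) h (cyl T)) :
    DifferentiableOn ℝ h (cyl T) := hh.differentiableOn (by simp)

lemma fderivWithin_slice {h : ℂ × ℝ → ℝ} (hh : ContDiffOn ℝ (⊤ : ℕ∞) h (cyl T))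
    (ht : t ∈ flowDom T) {z : ℂ} (hz : z ∈ cdisc) (v : ℂ) :
    fderivWithin ℝ (fun w => h (w, t)) cdisc z v = dirD T (v, 0) h (z, t) := by
  have h1 := (differentiableOn_cyl hh (z, t) ⟨hz, ht⟩).hasFDerivWithinAt
  have h2 : HasFDerivWithinAt (fun w : ℂ => (w, t))
      ((ContinuousLinearMap.id ℝ ℂ).prod (0 : ℂ →L[ℝ] ℝ)) cdisc z :=
    (hasFDerivWithinAt_id z cdisc).prodMk (hasFDerivWithinAt_const t z cdisc)
  have h3 := h1.comp (t := cyl T) z h2 (fun w hw => ⟨hw, ht⟩)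
  have h4 := h3.fderivWithin (uniqueDiffOn_cdisc z hz)
  simp only [Function.comp_def] at h4
  rw [h4]
  simp [dirD]

lemma hasDerivAt_slice {h : ℂ × ℝ → ℝ} (hh : ContDiffOn ℝ (⊤ : ℕ∞) h (cyl T))
    (ht : t ∈ flowDom T) (h0 : 0 < t) {z : ℂ} (hz : z ∈ cdisc) :
    HasDerivAt (fun s => h (z, s)) (dirD T (0, 1) h (z, t)) t := by
  have h1 := (differentiableOn_cyl hh (z, t) ⟨hz, ht⟩).hasFDerivWithinAt
  have h2 : HasDerivWithinAt (fun s : ℝ => (z, s)) ((0 : ℂ), (1:ℝ)) (flowDom T) t :=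
    ((hasDerivWithinAt_const t (flowDom T) z).prodMk (hasDerivWithinAt_id t (flowDom T)))
  have h3 := h1.comp_hasDerivWithinAt (t := cyl T) t h2 (fun s hs => ⟨hz, hs⟩)
  exact h3.hasDerivAt (flowDom_mem_nhds ht h0)

lemma dirD_comm {h : ℂ × ℝ → ℝ} (hh : ContDiffOn ℝ (⊤ : ℕ∞) h (cyl T))
    (ht : t ∈ flowDom T) (h0 : 0 < t) {z : ℂ} (hz : z ∈ odisc) (v w : ℂ × ℝ) :
    dirD T v (dirD T w h) (z, t) = dirD T w (dirD T v h) (z, t) := by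
  have hn : cyl T ∈ 𝓝 (z, t) := prod_mem_nhds (cdisc_mem_nhds hz) (flowDom_mem_nhds ht h0)
  have e : ∀ v w : ℂ × ℝ, dirD T v (dirD T w h) (z, t) =
      fderiv ℝ (fderiv ℝ h) (z, t) v w := by
    intro v w
    have hc : ContDiffAt ℝ (⊤ : ℕ∞) h (z, t) := hh.contDiffAt hn
    have hd : DifferentiableAt ℝ (fderiv ℝ h) (z, t) :=
      (hc.fderiv_right (m := 1)
        (show (((2 : ℕ∞) : WithTop ℕ∞)) ≤ ((⊤ : ℕ∞) : WithTop ℕ∞) from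
          WithTop.coe_le_coe.2 le_top)).differentiableAt one_ne_zero
    have e1 : dirD T w h =ᶠ[𝓝 (z, t)] fun p => fderiv ℝ h p w := by
      filter_upwards [eventually_mem_nhds_iff.mpr hn] with p hp
      rw [dirD, fderivWithin_of_mem_nhds hp]
    rw [dirD, fderivWithin_of_mem_nhds hn, e1.fderiv_eq, fderiv_clm_apply hd (by fun_prop)]
    simp
  rw [e v w, e w v]
  have := (hh.contDiffAt hn).isSymmSndFDerivAt (by
    rw [minSmoothness_of_isRCLikeNormedField]
    exact (WithTop.coe_le_coe.2 le_top : ((2 : ℕ∞) : WithTop ℕ∞) ≤ ((⊤ : ℕ∞) : WithTop ℕ∞)))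
  exact this.eq v w

end spacetime

section paramIntegral
variable {T : ℝ≥0∞} {t : ℝ} {ν : Measure ℂ} [IsFiniteMeasure ν] {K : Set ℂ}

lemma continuousOn_integral_param (hK : IsCompact K) (hν : ν Kᶜ = 0) {G : ℂ × ℝ → ℝ}
    (hG : ContinuousOn G (K ×ˢ flowDom T)) :
    ContinuousOn (fun t => ∫ z, G (z, t) ∂ν) (flowDom T) := by
  intro t ht
  obtain ⟨s, hs, hts⟩ := exists_gt_mem_flowDom ht
  have hcomp : IsCompact (K ×ˢ Icc 0 s) := hK.prod isCompact_Icc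
  obtain ⟨C, hC⟩ := hcomp.exists_bound_of_continuousOn
    (hG.mono (prod_mono_right (Icc_subset_flowDom hs)))
  have hmem : Icc 0 s ∈ 𝓝[flowDom T] t := by
    filter_upwards [self_mem_nhdsWithin, mem_nhdsWithin_of_mem_nhds (Iio_mem_nhds hts)] with r h1 h2
    exact ⟨h1.1, le_of_lt h2⟩
  have hae : ∀ᵐ z ∂ν, z ∈ K := hν
  refine continuousWithinAt_of_dominated (bound := fun _ => C) ?_ ?_ (integrable_const C) ?_
  · filter_upwards [self_mem_nhdsWithin] with r hr
    exact (integrable_of_continuousOn hK hν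
      (hG.comp (f := fun z : ℂ => (z, r)) (by fun_prop) fun z hz => ⟨hz, hr⟩)).1
  · filter_upwards [hmem] with r hr
    filter_upwards [hae] with z hz
    exact hC (z, r) ⟨hz, hr⟩
  · filter_upwards [hae] with z hz
    exact (hG.comp (f := fun r : ℝ => (z, r)) (by fun_prop) fun r hr => ⟨hz, hr⟩) t ht

lemma hasDerivAt_integral_param (hK : IsCompact K) (hν : ν Kᶜ = 0) {G G' : ℂ × ℝ → ℝ}
    (hG : ContinuousOn G (K ×ˢ flowDom T)) (hG' : ContinuousOn G' (K ×ˢ flowDom T))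
    (h : ∀ z ∈ K, ∀ s ∈ flowDom T, 0 < s → HasDerivAt (fun r => G (z, r)) (G' (z, s)) s)
    (ht : t ∈ flowDom T) (h0 : 0 < t) :
    HasDerivAt (fun s => ∫ z, G (z, s) ∂ν) (∫ z, G' (z, t) ∂ν) t := by
  obtain ⟨s, hs, hts⟩ := exists_gt_mem_flowDom ht
  have hcomp : IsCompact (K ×ˢ Icc 0 s) := hK.prod isCompact_Icc
  obtain ⟨C, hC⟩ := hcomp.exists_bound_of_continuousOn
    (hG'.mono (prod_mono_right (Icc_subset_flowDom hs)))
  have hae : ∀ᵐ z ∂ν, z ∈ K := hν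
  have hint : ∀ {H : ℂ × ℝ → ℝ}, ContinuousOn H (K ×ˢ flowDom T) → ∀ r ∈ flowDom T,
      Integrable (fun z => H (z, r)) ν := fun hH r hr => integrable_of_continuousOn hK hν
        (hH.comp (f := fun z : ℂ => (z, r)) (by fun_prop) fun z hz => ⟨hz, hr⟩)
  have hsub : ∀ r ∈ Ioo 0 s, r ∈ flowDom T := fun r hr =>
    Icc_subset_flowDom hs (Ioo_subset_Icc_self hr)
  refine (hasDerivAt_integral_of_dominated_loc_of_deriv_le (bound := fun _ => C)
    (F := fun r z => G (z, r)) (F' := fun r z => G' (z, r)) (Ioo_mem_nhds h0 hts) ?_ ?_ ?_ ?_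
    (integrable_const C) ?_).2
  · filter_upwards [flowDom_mem_nhds ht h0] with r hr
    exact (hint hG r hr).1
  · exact hint hG t ht
  · exact (hint hG' t ht).1
  · filter_upwards [hae] with z hz r hr
    exact hC (z, r) ⟨hz, Ioo_subset_Icc_self hr⟩
  · filter_upwards [hae] with z hz r hr
    exact h z hz r (hsub r hr) hr.1

end paramIntegral

/-! ### Evolution of integral quantities along the flow -/

lemma contDiffOn_fderivWithin_dir {w : ℂ → ℝ} (hw : ContDiffOn ℝ (⊤ : ℕ∞) w cdisc) (v : ℂ) :
    ContDiffOn ℝ (⊤ : ℕ∞) (fun x => fderivWithin ℝ w cdisc x v) cdisc :=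
  (hw.fderivWithin uniqueDiffOn_cdisc (by simp)).clm_apply contDiffOn_const

lemma one_le_smooth : (1 : WithTop ℕ∞) ≤ ((⊤ : ℕ∞) : WithTop ℕ∞) := by
  exact_mod_cast (le_top : (1 : ℕ∞) ≤ ⊤)

lemma continuousOn_lapW {w : ℂ → ℝ} (hw : ContDiffOn ℝ (⊤ : ℕ∞) w cdisc) :
    ContinuousOn (lapW w) cdisc :=
  (contDiffOn_fderivWithin_dir (contDiffOn_fderivWithin_dir hw 1) 1).continuousOn.add
    (contDiffOn_fderivWithin_dir (contDiffOn_fderivWithin_dir hw Complex.I)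
      Complex.I).continuousOn

lemma hasDivAt_gradW {w : ℂ → ℝ} (hw : ContDiffOn ℝ (⊤ : ℕ∞) w cdisc) {z : ℂ} (hz : z ∈ odisc) :
    HasDivAt (gradW w) (lapW w z) z := by
  have h1 := hasFDerivAt_of_contDiffOn
    ((contDiffOn_fderivWithin_dir hw 1).of_le one_le_smooth) hz
  have h2 := hasFDerivAt_of_contDiffOn
    ((contDiffOn_fderivWithin_dir hw Complex.I).of_le one_le_smooth) hz
  have h3 := (Complex.ofRealCLM.hasFDerivAt.comp z h1).add
    ((Complex.ofRealCLM.hasFDerivAt.comp z h2).mul_const Complex.I)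
  refine ⟨_, h3.congr_of_eventuallyEq (Eventually.of_forall fun x => ?_), ?_⟩
  · apply Complex.ext <;> simp [gradW]
  · simp [lapW]

lemma nder_eq_rdot (w : ℂ → ℝ) (z : ℂ) : nder w z = rdot z (gradW w z) := by
  rw [nder, fderivWithin_apply_eq_rdot, rdot_comm]

/-- Green's first identity. -/
lemma integral_rdot_gradW {v w : ℂ → ℝ} (hv : ContDiffOn ℝ 1 v cdisc)
    (hw : ContDiffOn ℝ (⊤ : ℕ∞) w cdisc) :
    ∫ z, rdot (gradW v z) (gradW w z) ∂discM =
      ∫ z, v z * nder w z ∂circM - ∫ z, v z * lapW w z ∂discM := by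
  have := green_div hv (continuousOn_gradW (hw.of_le one_le_smooth))
    (fun z hz => hasDivAt_gradW hw hz) (continuousOn_lapW hw)
  simp only [nder_eq_rdot]
  linarith

lemma integral_lapW {w : ℂ → ℝ} (hw : ContDiffOn ℝ (⊤ : ℕ∞) w cdisc) :
    ∫ z, lapW w z ∂discM = ∫ z, nder w z ∂circM := by
  simp only [nder_eq_rdot]
  exact integral_div (continuousOn_gradW (hw.of_le one_le_smooth))
    (fun z hz => hasDivAt_gradW hw hz) (continuousOn_lapW hw)

section flow
variable {T : ℝ≥0∞} {t : ℝ} {h : ℂ × ℝ → ℝ}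

lemma gradW_slice (hh : ContDiffOn ℝ (⊤ : ℕ∞) h (cyl T)) (ht : t ∈ flowDom T) {z : ℂ}
    (hz : z ∈ cdisc) : gradW (fun w => h (w, t)) z =
      ⟨dirD T (1, 0) h (z, t), dirD T (Complex.I, 0) h (z, t)⟩ := by
  rw [gradW, fderivWithin_slice hh ht hz, fderivWithin_slice hh ht hz]

/-- The squared gradient of the slices, as a function on space-time. -/
def gradSq (T : ℝ≥0∞) (h : ℂ × ℝ → ℝ) (p : ℂ × ℝ) : ℝ :=
  dirD T (1, 0) h p ^ 2 + dirD T (Complex.I, 0) h p ^ 2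

lemma integral_gradSq (hh : ContDiffOn ℝ (⊤ : ℕ∞) h (cyl T)) (ht : t ∈ flowDom T) :
    ∫ z, rdot (gradW (fun w => h (w, t)) z) (gradW (fun w => h (w, t)) z) ∂discM =
      ∫ z, gradSq T h (z, t) ∂discM := by
  refine integral_congr_ae ?_
  filter_upwards [discM_ae] with z hz
  rw [gradW_slice hh ht (odisc_subset_cdisc hz), rdot, gradSq]
  ring

lemma continuousOn_gradSq (hT : 0 < T) (hh : ContDiffOn ℝ (⊤ : ℕ∞) h (cyl T)) :
    ContinuousOn (gradSq T h) (cyl T) :=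
  ((contDiffOn_dirD hT _ hh).continuousOn.pow 2).add ((contDiffOn_dirD hT _ hh).continuousOn.pow 2)

lemma hasDerivAt_integral_gradSq (hT : 0 < T) (hh : ContDiffOn ℝ (⊤ : ℕ∞) h (cyl T))
    (ht : t ∈ flowDom T) (h0 : 0 < t) :
    HasDerivAt (fun s => ∫ z, gradSq T h (z, s) ∂discM)
      (2 * ∫ z, rdot (gradW (fun w => dirD T (0, 1) h (w, t)) z)
        (gradW (fun w => h (w, t)) z) ∂discM) t := by
  have hd := fun v => contDiffOn_dirD hT v hh
  have hdd := fun v w => (contDiffOn_dirD hT v (hd w)).continuousOn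
  have key := hasDerivAt_integral_param (G := gradSq T h)
    (G' := fun p => 2 * (dirD T (1, 0) h p * dirD T (0, 1) (dirD T (1, 0) h) p +
      dirD T (Complex.I, 0) h p * dirD T (0, 1) (dirD T (Complex.I, 0) h) p))
    isCompact_cdisc discM_compl (continuousOn_gradSq hT hh)
    (continuousOn_const.mul (((hd _).continuousOn.mul (hdd _ _)).add
      ((hd _).continuousOn.mul (hdd _ _))))
    (fun z hz s hs hs0 => by
      have := ((hasDerivAt_slice (hd (1, 0)) hs hs0 hz).pow 2).add
        ((hasDerivAt_slice (hd (Complex.I, 0)) hs hs0 hz).pow 2)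
      refine this.congr_deriv ?_
      simp; ring) ht h0
  refine key.congr_deriv ?_
  rw [← integral_const_mul]
  refine integral_congr_ae ?_
  filter_upwards [discM_ae] with z hz
  have hz' := odisc_subset_cdisc hz
  rw [gradW_slice (hd _) ht hz', gradW_slice hh ht hz', rdot]
  simp only
  rw [dirD_comm hh ht h0 hz (0, 1) (1, 0), dirD_comm hh ht h0 hz (0, 1) (Complex.I, 0)]
  ring

end flow

section flow
variable {T : ℝ≥0∞} {t : ℝ} {f j : ℂ → ℝ} {u : ℂ → ℝ → ℝ} {ρ : ℝ → ℝ}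

/-- The time derivative of `u`, as a function on the space-time cylinder. -/
def tder (T : ℝ≥0∞) (u : ℂ → ℝ → ℝ) : ℂ × ℝ → ℝ := dirD T (0, 1) fun p => u p.1 p.2

/-- The weighted area `∫_B f e^{2u}`. -/
def wArea (f : ℂ → ℝ) (u : ℂ → ℝ → ℝ) (t : ℝ) : ℝ := ∫ z, f z * Real.exp (2 * u z t) ∂discM

/-- The weighted length `∫_{∂B} j e^u`. -/
def wLen (j : ℂ → ℝ) (u : ℂ → ℝ → ℝ) (t : ℝ) : ℝ := ∫ z, j z * Real.exp (u z t) ∂circM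

lemma IsFlow.smooth (hfl : IsFlow f j T u ρ) :
    ContDiffOn ℝ (⊤ : ℕ∞) (fun p : ℂ × ℝ => u p.1 p.2) (cyl T) := hfl.1

lemma IsFlow.smooth_slice (hfl : IsFlow f j T u ρ) (ht : t ∈ flowDom T) :
    ContDiffOn ℝ (⊤ : ℕ∞) (fun z => u z t) cdisc := contDiffOn_slice hfl.smooth ht

lemma IsFlow.continuousOn_slice (hfl : IsFlow f j T u ρ) (ht : t ∈ flowDom T) :
    ContinuousOn (fun z => u z t) cdisc := (hfl.smooth_slice ht).continuousOn

lemma IsFlow.contDiffOn_tder (hfl : IsFlow f j T u ρ) (hT : 0 < T) :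
    ContDiffOn ℝ (⊤ : ℕ∞) (tder T u) (cyl T) := contDiffOn_dirD hT _ hfl.smooth

lemma IsFlow.continuousOn_tder (hfl : IsFlow f j T u ρ) (hT : 0 < T) (ht : t ∈ flowDom T) :
    ContinuousOn (fun z => tder T u (z, t)) cdisc :=
  (contDiffOn_slice (hfl.contDiffOn_tder hT) ht).continuousOn

lemma IsFlow.hasDerivAt (hfl : IsFlow f j T u ρ) (ht : t ∈ flowDom T) (h0 : 0 < t) {z : ℂ}
    (hz : z ∈ cdisc) : HasDerivAt (u z) (tder T u (z, t)) t :=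
  hasDerivAt_slice hfl.smooth ht h0 hz

lemma IsFlow.lapW_eq (hfl : IsFlow f j T u ρ) (ht : t ∈ flowDom T) (h0 : 0 < t) {z : ℂ}
    (hz : z ∈ odisc) : lapW (fun w => u w t) z =
      Real.exp (2 * u z t) * (tder T u (z, t) - alphaC f u ρ t * f z) := by
  have h1 := hfl.2.2.2.1 t ht h0 z hz
  rw [(hfl.hasDerivAt ht h0 (odisc_subset_cdisc hz)).deriv] at h1
  rw [h1, add_sub_cancel_left, ← mul_assoc, ← Real.exp_add]
  simp

lemma IsFlow.nder_eq (hfl : IsFlow f j T u ρ) (ht : t ∈ flowDom T) (h0 : 0 < t) {z : ℂ}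
    (hz : z ∈ bdry) : nder (fun w => u w t) z =
      Real.exp (u z t) * (betaC j u ρ t * j z - tder T u (z, t)) - 1 := by
  have h1 := hfl.2.2.2.2.1 t ht h0 z hz
  rw [(hfl.hasDerivAt ht h0 (bdry_subset_cdisc hz)).deriv] at h1
  rw [h1, sub_sub_cancel, ← mul_assoc, ← Real.exp_add]
  simp

lemma continuousOn_fst_comp {K : Set ℂ} {φ : ℂ → ℝ} (hφ : ContinuousOn φ K) :
    ContinuousOn (fun p : ℂ × ℝ => φ p.1) (K ×ˢ flowDom T) :=
  hφ.comp continuousOn_fst fun _ hp => hp.1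

lemma IsFlow.hasDerivAt_wArea (hfl : IsFlow f j T u ρ) (hT : 0 < T) {φ : ℂ → ℝ}
    (hφ : ContinuousOn φ cdisc) (ht : t ∈ flowDom T) (h0 : 0 < t) :
    HasDerivAt (wArea φ u) (2 * ∫ z, φ z * Real.exp (2 * u z t) * tder T u (z, t) ∂discM) t := by
  have c1 := continuousOn_fst_comp (T := T) hφ
  have c2 : ContinuousOn (fun p : ℂ × ℝ => Real.exp (2 * u p.1 p.2)) (cyl T) :=
    Real.continuous_exp.comp_continuousOn (continuousOn_const.mul hfl.smooth.continuousOn)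
  rw [← integral_const_mul]
  refine hasDerivAt_integral_param (G := fun p => φ p.1 * Real.exp (2 * u p.1 p.2))
    (G' := fun p => 2 * (φ p.1 * Real.exp (2 * u p.1 p.2) * tder T u p))
    isCompact_cdisc discM_compl (c1.mul c2)
    (continuousOn_const.mul ((c1.mul c2).mul (hfl.contDiffOn_tder hT).continuousOn))
    (fun z hz s hs hs0 => ?_) ht h0
  refine (((hfl.hasDerivAt hs hs0 hz).const_mul 2).exp.const_mul (φ z)).congr_deriv ?_
  ring

lemma IsFlow.continuousOn_wArea (hfl : IsFlow f j T u ρ) {φ : ℂ → ℝ}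
    (hφ : ContinuousOn φ cdisc) : ContinuousOn (wArea φ u) (flowDom T) :=
  continuousOn_integral_param (G := fun p => φ p.1 * Real.exp (2 * u p.1 p.2))
    isCompact_cdisc discM_compl ((continuousOn_fst_comp hφ).mul
      (Real.continuous_exp.comp_continuousOn (continuousOn_const.mul hfl.smooth.continuousOn)))

lemma bdry_prod_subset_cyl : bdry ×ˢ flowDom T ⊆ cyl T := prod_mono_left bdry_subset_cdisc

lemma IsFlow.hasDerivAt_wLen (hfl : IsFlow f j T u ρ) (hT : 0 < T) {φ : ℂ → ℝ}
    (hφ : ContinuousOn φ bdry) (ht : t ∈ flowDom T) (h0 : 0 < t) :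
    HasDerivAt (wLen φ u) (∫ z, φ z * Real.exp (u z t) * tder T u (z, t) ∂circM) t := by
  have c1 := continuousOn_fst_comp (T := T) hφ
  have c2 : ContinuousOn (fun p : ℂ × ℝ => Real.exp (u p.1 p.2)) (bdry ×ˢ flowDom T) :=
    Real.continuous_exp.comp_continuousOn (hfl.smooth.continuousOn.mono bdry_prod_subset_cyl)
  refine hasDerivAt_integral_param (G := fun p => φ p.1 * Real.exp (u p.1 p.2))
    (G' := fun p => φ p.1 * Real.exp (u p.1 p.2) * tder T u p)
    isCompact_bdry circM_compl_bdry (c1.mul c2)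
    ((c1.mul c2).mul ((hfl.contDiffOn_tder hT).continuousOn.mono bdry_prod_subset_cyl))
    (fun z hz s hs hs0 => ?_) ht h0
  refine ((hfl.hasDerivAt hs hs0 (bdry_subset_cdisc hz)).exp.const_mul (φ z)).congr_deriv ?_
  ring

lemma IsFlow.continuousOn_wLen (hfl : IsFlow f j T u ρ) {φ : ℂ → ℝ}
    (hφ : ContinuousOn φ bdry) : ContinuousOn (wLen φ u) (flowDom T) :=
  continuousOn_integral_param (G := fun p => φ p.1 * Real.exp (u p.1 p.2))
    isCompact_bdry circM_compl_bdry ((continuousOn_fst_comp hφ).mul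
      (Real.continuous_exp.comp_continuousOn
        (hfl.smooth.continuousOn.mono bdry_prod_subset_cyl)))

lemma IsFlow.hasDerivAt_En (hfl : IsFlow f j T u ρ) (hT : 0 < T) (ht : t ∈ flowDom T)
    (h0 : 0 < t) : HasDerivAt (fun s => En fun z => u z s)
      (∫ z, tder T u (z, t) * nder (fun w => u w t) z ∂circM -
        ∫ z, tder T u (z, t) * lapW (fun w => u w t) z ∂discM + ∫ z, tder T u (z, t) ∂circM) t := by
  have h1 := hasDerivAt_integral_gradSq hT hfl.smooth ht h0
  have h2 := integral_rdot_gradW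
    ((contDiffOn_slice (hfl.contDiffOn_tder hT) ht).of_le one_le_smooth) (hfl.smooth_slice ht)
  have h3 := hasDerivAt_integral_param (G := fun p => u p.1 p.2) (G' := tder T u)
    isCompact_bdry circM_compl_bdry (hfl.smooth.continuousOn.mono bdry_prod_subset_cyl)
    ((hfl.contDiffOn_tder hT).continuousOn.mono bdry_prod_subset_cyl)
    (fun z hz s hs hs0 => hfl.hasDerivAt hs hs0 (bdry_subset_cdisc hz)) ht h0
  have h4 := (h1.const_mul (1 / 2)).add h3
  refine (h4.congr_deriv ?_).congr_of_eventuallyEq ?_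
  · rw [← h2, tder]; ring
  · filter_upwards [flowDom_mem_nhds ht h0] with s hs
    rw [En, integral_gradSq hfl.smooth hs]
    rfl

lemma IsFlow.continuousOn_En (hfl : IsFlow f j T u ρ) (hT : 0 < T) :
    ContinuousOn (fun s => En fun z => u z s) (flowDom T) := by
  have h1 := continuousOn_integral_param isCompact_cdisc discM_compl
    (continuousOn_gradSq hT hfl.smooth)
  have h2 := continuousOn_integral_param (G := fun p => u p.1 p.2) isCompact_bdry circM_compl_bdry
    (hfl.smooth.continuousOn.mono bdry_prod_subset_cyl)
  refine ((h1.const_smul (1 / 2 : ℝ)).add h2).congr fun s hs => ?_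
  rw [En, integral_gradSq hfl.smooth hs]
  rfl

lemma alphaC_eq (f : ℂ → ℝ) (u : ℂ → ℝ → ℝ) (ρ : ℝ → ℝ) (t : ℝ) :
    alphaC f u ρ t = 2 * ρ t / wArea f u t := rfl

lemma IsFlow.betaC_eq (hfl : IsFlow f j T u ρ) (hj : ContinuousOn j bdry) (ht : t ∈ flowDom T) :
    betaC j u ρ t = 2 * (π - ρ t) / wLen j u t := by
  rw [betaC, circInt_eq, wLen]
  exact hj.mul (Real.continuous_exp.comp_continuousOn
    ((hfl.continuousOn_slice ht).mono bdry_subset_cdisc))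

lemma integral_pos_of_continuousOn {ν : Measure ℂ} [IsFiniteMeasure ν] {K : Set ℂ}
    (hK : IsCompact K) (hν : ν Kᶜ = 0) (hpos : 0 < ν.real univ) {φ : ℂ → ℝ}
    (hφ : ContinuousOn φ K) (h : ∀ z ∈ K, 0 < φ z) : 0 < ∫ z, φ z ∂ν := by
  have hae : ∀ᵐ z ∂ν, z ∈ K := hν
  rw [integral_pos_iff_support_of_nonneg_ae]
  · have h1 : K ⊆ Function.support φ := fun z hz => (h z hz).ne'
    have h2 : ν univ ≤ ν (Function.support φ) :=
      measure_mono_ae (by filter_upwards [hae] with z hz _ using h1 hz)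
    exact (ENNReal.toReal_pos_iff.mp hpos).1.trans_le h2
  · filter_upwards [hae] with z hz using (h z hz).le
  · exact integrable_of_continuousOn hK hν hφ

lemma IsFlow.wArea_pos (hfl : IsFlow f j T u ρ) {φ : ℂ → ℝ} (hφ : ContinuousOn φ cdisc)
    (hpos : ∀ z ∈ cdisc, 0 < φ z) (ht : t ∈ flowDom T) : 0 < wArea φ u t := by
  refine integral_pos_of_continuousOn isCompact_cdisc discM_compl
    (by rw [discM_univ]; exact Real.pi_pos) (hφ.mul (Real.continuous_exp.comp_continuousOn
      (continuousOn_const.mul (hfl.continuousOn_slice ht)))) fun z hz => ?_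
  have := hpos z hz
  positivity

lemma IsFlow.wLen_pos (hfl : IsFlow f j T u ρ) {φ : ℂ → ℝ} (hφ : ContinuousOn φ bdry)
    (hpos : ∀ z ∈ bdry, 0 < φ z) (ht : t ∈ flowDom T) : 0 < wLen φ u t := by
  refine integral_pos_of_continuousOn isCompact_bdry circM_compl_bdry
    (by rw [circM_univ]; exact Real.two_pi_pos) (hφ.mul (Real.continuous_exp.comp_continuousOn
      ((hfl.continuousOn_slice ht).mono bdry_subset_cdisc))) fun z hz => ?_
  have := hpos z hz
  positivity

end flow

section flow
variable {T : ℝ≥0∞} {t : ℝ} {f j : ℂ → ℝ} {u : ℂ → ℝ → ℝ} {ρ : ℝ → ℝ}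

/-- Half the area plus the length, which the flow preserves. -/
def massF (u : ℂ → ℝ → ℝ) (t : ℝ) : ℝ := 1 / 2 * wArea (fun _ => 1) u t + wLen (fun _ => 1) u t

/-- The energy functional that decreases along the flow. -/
def energyF (f j : ℂ → ℝ) (u : ℂ → ℝ → ℝ) (ρ : ℝ → ℝ) (t : ℝ) : ℝ :=
  En (fun z => u z t) - ρ t * Real.log (wArea f u t) - 2 * (π - ρ t) * Real.log (wLen j u t) +
    ρ t * Real.log (2 * ρ t) + 2 * (π - ρ t) * Real.log (2 * (π - ρ t)) + ρ t

lemma IsFlow.hasDerivAt_massF (hfl : IsFlow f j T u ρ) (hT : 0 < T) (hf : ContinuousOn f cdisc)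
    (hfpos : ∀ z ∈ cdisc, 0 < f z) (hj : ContinuousOn j bdry) (hjpos : ∀ z ∈ bdry, 0 < j z)
    (ht : t ∈ flowDom T) (h0 : 0 < t) : HasDerivAt (massF u) 0 t := by
  have hF := hfl.wArea_pos hf hfpos ht
  have hJ := hfl.wLen_pos hj hjpos ht
  have hu := hfl.continuousOn_slice ht
  have hub := hu.mono bdry_subset_cdisc
  have hE : ContinuousOn (fun z => Real.exp (2 * u z t)) cdisc :=
    Real.continuous_exp.comp_continuousOn (continuousOn_const.mul hu)
  have hEb : ContinuousOn (fun z => Real.exp (u z t)) bdry :=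
    Real.continuous_exp.comp_continuousOn hub
  have hg := continuousOn_gradW ((hfl.smooth_slice ht).of_le one_le_smooth)
  have hn : ContinuousOn (fun z => nder (fun w => u w t) z) bdry := by
    simp only [nder_eq_rdot]
    exact (continuous_rdot.comp_continuousOn (continuousOn_id.prodMk hg)).mono bdry_subset_cdisc
  have e1 : ∫ z, 1 * Real.exp (2 * u z t) * tder T u (z, t) ∂discM =
      alphaC f u ρ t * wArea f u t + ∫ z, lapW (fun w => u w t) z ∂discM := by
    have i1 : Integrable (fun z => alphaC f u ρ t * (f z * Real.exp (2 * u z t))) discM :=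
      (integrable_discM (hf.mul hE)).const_mul _
    rw [wArea, ← integral_const_mul,
      ← integral_add i1 (integrable_discM (continuousOn_lapW (hfl.smooth_slice ht)))]
    refine integral_congr_ae ?_
    filter_upwards [discM_ae] with z hz
    rw [hfl.lapW_eq ht h0 hz]; ring
  have e2 : ∫ z, 1 * Real.exp (u z t) * tder T u (z, t) ∂circM =
      betaC j u ρ t * wLen j u t - ∫ z, nder (fun w => u w t) z ∂circM - 2 * π := by
    have i1 : Integrable (fun z => betaC j u ρ t * (j z * Real.exp (u z t))) circM :=
      (integrable_circM (hj.mul hEb)).const_mul _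
    have i2 : Integrable (fun z => betaC j u ρ t * (j z * Real.exp (u z t)) -
      nder (fun w => u w t) z) circM := i1.sub (integrable_circM hn)
    have i3 : ∫ _, (1:ℝ) ∂circM = 2 * π := by simp [circM_univ]
    rw [wLen, ← integral_const_mul, ← integral_sub i1 (integrable_circM hn), ← i3,
      ← integral_sub i2 (integrable_const 1)]
    refine integral_congr_ae ?_
    filter_upwards [circM_ae] with z hz
    rw [hfl.nder_eq ht h0 hz]; ring
  have h1 := ((hfl.hasDerivAt_wArea hT (φ := fun _ => 1) continuousOn_const ht h0).const_mul
    (1 / 2)).add (hfl.hasDerivAt_wLen hT (φ := fun _ => 1) continuousOn_const ht h0)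
  refine h1.congr_deriv ?_
  rw [e1, e2, integral_lapW (hfl.smooth_slice ht), alphaC_eq, hfl.betaC_eq hj ht]
  field_simp
  ring

lemma IsFlow.massF_eq (hfl : IsFlow f j T u ρ) (hT : 0 < T) (hf : ContinuousOn f cdisc)
    (hfpos : ∀ z ∈ cdisc, 0 < f z) (hj : ContinuousOn j bdry) (hjpos : ∀ z ∈ bdry, 0 < j z)
    (ht : t ∈ flowDom T) : massF u t = massF u 0 := by
  have hd : ∀ s ∈ interior (flowDom T), HasDerivAt (massF u) 0 s := fun s hs =>
    hfl.hasDerivAt_massF hT hf hfpos hj hjpos (interior_subset hs) (pos_of_mem_interior_flowDom hs)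
  have hc : ContinuousOn (massF u) (flowDom T) :=
    ((hfl.continuousOn_wArea continuousOn_const).const_smul (1 / 2 : ℝ)).add
      (hfl.continuousOn_wLen continuousOn_const)
  have hdiff : DifferentiableOn ℝ (massF u) (interior (flowDom T)) := fun s hs =>
    (hd s hs).differentiableAt.differentiableWithinAt
  refine le_antisymm
    (antitoneOn_of_deriv_nonpos (convex_flowDom T) hc hdiff (fun s hs => (hd s hs).deriv.le)
      (zero_mem_flowDom hT) ht ht.1)
    (monotoneOn_of_deriv_nonneg (convex_flowDom T) hc hdiff (fun s hs => (hd s hs).deriv.ge)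
      (zero_mem_flowDom hT) ht ht.1)

lemma IsFlow.hasDerivAt_energyF (hfl : IsFlow f j T u ρ) (hT : 0 < T) (hf : ContinuousOn f cdisc)
    (hfpos : ∀ z ∈ cdisc, 0 < f z) (hj : ContinuousOn j bdry) (hjpos : ∀ z ∈ bdry, 0 < j z)
    (ht : t ∈ flowDom T) (h0 : 0 < t) : HasDerivAt (energyF f j u ρ)
      (-(∫ z, Real.exp (2 * u z t) * tder T u (z, t) ^ 2 ∂discM) -
        ∫ z, Real.exp (u z t) * tder T u (z, t) ^ 2 ∂circM - deriv ρ t ^ 2) t := by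
  have hF := hfl.wArea_pos hf hfpos ht
  have hJ := hfl.wLen_pos hj hjpos ht
  have hρ := hfl.2.2.1 t ht
  have hσ : 0 < π - ρ t := sub_pos.mpr hρ.2
  have hρ0 : 0 < ρ t := hρ.1
  have hu := hfl.continuousOn_slice ht
  have hub := hu.mono bdry_subset_cdisc
  have hd := hfl.continuousOn_tder hT ht
  have hdb := hd.mono bdry_subset_cdisc
  have hE : ContinuousOn (fun z => Real.exp (2 * u z t)) cdisc :=
    Real.continuous_exp.comp_continuousOn (continuousOn_const.mul hu)
  have hEb : ContinuousOn (fun z => Real.exp (u z t)) bdry :=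
    Real.continuous_exp.comp_continuousOn hub
  have e1 : ∫ z, tder T u (z, t) * lapW (fun w => u w t) z ∂discM =
      ∫ z, Real.exp (2 * u z t) * tder T u (z, t) ^ 2 ∂discM -
        alphaC f u ρ t * ∫ z, f z * Real.exp (2 * u z t) * tder T u (z, t) ∂discM := by
    have i1 : Integrable (fun z => alphaC f u ρ t *
        (f z * Real.exp (2 * u z t) * tder T u (z, t))) discM :=
      (integrable_discM ((hf.mul hE).mul hd)).const_mul _
    have i2 : Integrable (fun z => Real.exp (2 * u z t) * tder T u (z, t) ^ 2) discM :=
      integrable_discM (hE.mul (hd.pow 2))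
    rw [← integral_const_mul, ← integral_sub i2 i1]
    refine integral_congr_ae ?_
    filter_upwards [discM_ae] with z hz
    rw [hfl.lapW_eq ht h0 hz]; ring
  have e2 : ∫ z, tder T u (z, t) * nder (fun w => u w t) z ∂circM =
      betaC j u ρ t * ∫ z, j z * Real.exp (u z t) * tder T u (z, t) ∂circM -
        ∫ z, Real.exp (u z t) * tder T u (z, t) ^ 2 ∂circM - ∫ z, tder T u (z, t) ∂circM := by
    have i1 : Integrable (fun z => betaC j u ρ t *
        (j z * Real.exp (u z t) * tder T u (z, t))) circM :=
      (integrable_circM ((hj.mul hEb).mul hdb)).const_mul _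
    have i2 : Integrable (fun z => Real.exp (u z t) * tder T u (z, t) ^ 2) circM :=
      integrable_circM (hEb.mul (hdb.pow 2))
    have i3 : Integrable (fun z => betaC j u ρ t * (j z * Real.exp (u z t) * tder T u (z, t)) -
        Real.exp (u z t) * tder T u (z, t) ^ 2) circM := i1.sub i2
    rw [← integral_const_mul, ← integral_sub i1 i2, ← integral_sub i3 (integrable_circM hdb)]
    refine integral_congr_ae ?_
    filter_upwards [circM_ae] with z hz
    rw [hfl.nder_eq ht h0 hz]; ring
  have dρ : HasDerivAt ρ (deriv ρ t) t :=
    ((hfl.2.1.contDiffAt (flowDom_mem_nhds ht h0)).differentiableAt one_ne_zero).hasDerivAt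
  have dσ : HasDerivAt (fun s => 2 * (π - ρ s)) (2 * (-deriv ρ t)) t :=
    (dρ.const_sub π).const_mul 2
  have dA := (hfl.hasDerivAt_wArea hT hf ht h0).log hF.ne'
  have dJ := (hfl.hasDerivAt_wLen hT hj ht h0).log hJ.ne'
  have key := (((((hfl.hasDerivAt_En hT ht h0).sub (dρ.mul dA)).sub (dσ.mul dJ)).add
    (dρ.mul ((dρ.const_mul 2).log (by positivity)))).add
    (dσ.mul (dσ.log (by positivity)))).add dρ
  refine HasDerivAt.congr_deriv (f := energyF f j u ρ) key ?_
  have hlog : deriv ρ t = 2 * (Real.log (2 * (π - ρ t)) - Real.log (wLen j u t)) -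
      (Real.log (2 * ρ t) - Real.log (wArea f u t)) := by
    rw [hfl.2.2.2.2.2 t ht h0, alphaC_eq, hfl.betaC_eq hj ht, Real.log_div (by positivity)
      (by positivity), Real.log_pow, Real.log_div (by positivity) (by positivity),
      Real.log_div (by positivity) (by positivity)]
    push_cast; ring
  rw [e1, e2, alphaC_eq, hfl.betaC_eq hj ht]
  generalize (∫ z, f z * Real.exp (2 * u z t) * tder T u (z, t) ∂discM) = X1
  generalize (∫ z, j z * Real.exp (u z t) * tder T u (z, t) ∂circM) = X2
  generalize deriv ρ t = r at *
  have a1 : 2 * ρ t / wArea f u t * X1 = ρ t * (2 * X1 / wArea f u t) := by ring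
  have a2 : 2 * (π - ρ t) / wLen j u t * X2 = 2 * (π - ρ t) * (X2 / wLen j u t) := by ring
  have a3 : ρ t * (2 * r / (2 * ρ t)) = r := by field_simp
  have a4 : 2 * (π - ρ t) * (2 * -r / (2 * (π - ρ t))) = -(2 * r) := by field_simp
  rw [a1, a2, a3, a4]
  linear_combination r * hlog

lemma IsFlow.continuousOn_energyF (hfl : IsFlow f j T u ρ) (hT : 0 < T)
    (hf : ContinuousOn f cdisc)
    (hfpos : ∀ z ∈ cdisc, 0 < f z) (hj : ContinuousOn j bdry) (hjpos : ∀ z ∈ bdry, 0 < j z) :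
    ContinuousOn (energyF f j u ρ) (flowDom T) := by
  have cρ := hfl.2.1.continuousOn
  have cσ : ContinuousOn (fun t => 2 * (π - ρ t)) (flowDom T) := by fun_prop
  have cF := (hfl.continuousOn_wArea hf).log fun t ht => (hfl.wArea_pos hf hfpos ht).ne'
  have cJ := (hfl.continuousOn_wLen hj).log fun t ht => (hfl.wLen_pos hj hjpos ht).ne'
  have c1 : ContinuousOn (fun t => Real.log (2 * ρ t)) (flowDom T) :=
    (continuousOn_const.mul cρ).log fun t ht => (mul_pos two_pos (hfl.2.2.1 t ht).1).ne'
  have c2 : ContinuousOn (fun t => Real.log (2 * (π - ρ t))) (flowDom T) :=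
    cσ.log fun t ht => by
      have := sub_pos.mpr (hfl.2.2.1 t ht).2
      positivity
  exact (((((hfl.continuousOn_En hT).sub (cρ.mul cF)).sub (cσ.mul cJ)).add (cρ.mul c1)).add
    (cσ.mul c2)).add cρ

lemma IsFlow.energyF_le (hfl : IsFlow f j T u ρ) (hT : 0 < T) (hf : ContinuousOn f cdisc)
    (hfpos : ∀ z ∈ cdisc, 0 < f z) (hj : ContinuousOn j bdry) (hjpos : ∀ z ∈ bdry, 0 < j z)
    (ht : t ∈ flowDom T) : energyF f j u ρ t ≤ energyF f j u ρ 0 := by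
  have hd : ∀ s ∈ interior (flowDom T), HasDerivAt (energyF f j u ρ) _ s := fun s hs =>
    hfl.hasDerivAt_energyF hT hf hfpos hj hjpos (interior_subset hs)
      (pos_of_mem_interior_flowDom hs)
  refine antitoneOn_of_deriv_nonpos (convex_flowDom T)
    (hfl.continuousOn_energyF hT hf hfpos hj hjpos)
    (fun s hs => (hd s hs).differentiableAt.differentiableWithinAt) (fun s hs => ?_)
    (zero_mem_flowDom hT) ht ht.1
  rw [(hd s hs).deriv]
  have h1 : 0 ≤ ∫ z, Real.exp (2 * u z s) * tder T u (z, s) ^ 2 ∂discM :=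
    integral_nonneg fun z => by positivity
  have h2 : 0 ≤ ∫ z, Real.exp (u z s) * tder T u (z, s) ^ 2 ∂circM :=
    integral_nonneg fun z => by positivity
  nlinarith [sq_nonneg (deriv ρ s)]

end flow

section flow
variable {T : ℝ≥0∞} {t : ℝ} {f j : ℂ → ℝ} {u : ℂ → ℝ → ℝ} {ρ : ℝ → ℝ}

lemma wArea_congr (f : ℂ → ℝ) {v : ℂ → ℝ → ℝ} (h : ∀ z ∈ cdisc, u z t = v z t) :
    wArea f u t = wArea f v t := by
  refine integral_congr_ae ?_
  filter_upwards [discM_ae] with z hz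
  rw [h z (odisc_subset_cdisc hz)]

lemma wLen_congr (j : ℂ → ℝ) {v : ℂ → ℝ → ℝ} (h : ∀ z ∈ cdisc, u z t = v z t) :
    wLen j u t = wLen j v t := by
  refine integral_congr_ae ?_
  filter_upwards [circM_ae] with z hz
  rw [h z (bdry_subset_cdisc hz)]

lemma En_congr {v w : ℂ → ℝ} (h : ∀ z ∈ cdisc, v z = w z) : En v = En w := by
  have h1 : ∫ z, v z ∂circM = ∫ z, w z ∂circM := by
    refine integral_congr_ae ?_
    filter_upwards [circM_ae] with z hz using h z (bdry_subset_cdisc hz)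
  have h2 : ∀ z ∈ cdisc, gradW v z = gradW w z := fun z hz => by
    rw [gradW, gradW, fderivWithin_congr h (h z hz)]
  rw [En, En, h1]
  congr 2
  refine integral_congr_ae ?_
  filter_upwards [discM_ae] with z hz
  rw [h2 z (odisc_subset_cdisc hz)]

lemma neg_mul_log_le_one {x : ℝ} (hx : 0 < x) : -(x * Real.log x) ≤ 1 := by
  have h1 := Real.one_sub_inv_le_log_of_pos hx
  have h2 := mul_le_mul_of_nonneg_left h1 hx.le
  rw [mul_sub, mul_inv_cancel₀ hx.ne'] at h2
  linarith

lemma mul_log_le {x y r R : ℝ} (hx : 0 < x) (hxy : x ≤ y) (hr : 0 ≤ r) (hrR : r ≤ R) :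
    r * Real.log x ≤ R * |Real.log y| :=
  (mul_le_mul_of_nonneg_left ((Real.log_le_log hx hxy).trans (le_abs_self _)) hr).trans
    (mul_le_mul_of_nonneg_right hrR (abs_nonneg _))

lemma IsFlow.wArea_le (hfl : IsFlow f j T u ρ) (ht : t ∈ flowDom T) {φ : ℂ → ℝ}
    (hφ : ContinuousOn φ cdisc) {M : ℝ} (hM : ∀ z ∈ cdisc, φ z ≤ M) :
    wArea φ u t ≤ M * wArea (fun _ => 1) u t := by
  have hE : ContinuousOn (fun z => Real.exp (2 * u z t)) cdisc :=
    Real.continuous_exp.comp_continuousOn (continuousOn_const.mul (hfl.continuousOn_slice ht))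
  rw [wArea, wArea, ← integral_const_mul]
  refine integral_mono_ae (integrable_discM (hφ.mul hE))
    ((integrable_discM (continuousOn_const.mul hE)).const_mul M) ?_
  filter_upwards [discM_ae] with z hz
  rw [one_mul]
  exact mul_le_mul_of_nonneg_right (hM z (odisc_subset_cdisc hz)) (Real.exp_pos _).le

lemma IsFlow.wLen_le (hfl : IsFlow f j T u ρ) (ht : t ∈ flowDom T) {φ : ℂ → ℝ}
    (hφ : ContinuousOn φ bdry) {M : ℝ} (hM : ∀ z ∈ bdry, φ z ≤ M) :
    wLen φ u t ≤ M * wLen (fun _ => 1) u t := by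
  have hE : ContinuousOn (fun z => Real.exp (u z t)) bdry :=
    Real.continuous_exp.comp_continuousOn ((hfl.continuousOn_slice ht).mono bdry_subset_cdisc)
  rw [wLen, wLen, ← integral_const_mul]
  refine integral_mono_ae (integrable_circM (hφ.mul hE))
    ((integrable_circM (continuousOn_const.mul hE)).const_mul M) ?_
  filter_upwards [circM_ae] with z hz
  rw [one_mul]
  exact mul_le_mul_of_nonneg_right (hM z hz) (Real.exp_pos _).le

/-- Along the flow the energy `En` stays bounded in terms of the data. -/
lemma IsFlow.En_le (hfl : IsFlow f j T u ρ) (hT : 0 < T) (hf : ContinuousOn f cdisc)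
    (hfpos : ∀ z ∈ cdisc, 0 < f z) (hj : ContinuousOn j bdry) (hjpos : ∀ z ∈ bdry, 0 < j z)
    (ht : t ∈ flowDom T) {Mf Mj : ℝ} (hMf0 : 0 ≤ Mf) (hMj0 : 0 ≤ Mj) (hMf : ∀ z ∈ cdisc, f z ≤ Mf)
    (hMj : ∀ z ∈ bdry, j z ≤ Mj) :
    En (fun z => u z t) ≤ energyF f j u ρ 0 + π * |Real.log (Mf * (2 * massF u 0))| +
      2 * π * |Real.log (Mj * massF u 0)| + 2 := by
  have hρ := hfl.2.2.1 t ht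
  have hσ : 0 < π - ρ t := sub_pos.mpr hρ.2
  have hρ0 : 0 < ρ t := hρ.1
  have hE := hfl.energyF_le hT hf hfpos hj hjpos ht
  have hm := hfl.massF_eq hT hf hfpos hj hjpos ht
  have hA := hfl.wArea_pos (φ := fun _ => 1) continuousOn_const (fun _ _ => one_pos) ht
  have hL := hfl.wLen_pos (φ := fun _ => 1) continuousOn_const (fun _ _ => one_pos) ht
  rw [massF] at hm
  have h1 : wArea f u t ≤ Mf * (2 * massF u 0) :=
    (hfl.wArea_le ht hf hMf).trans (mul_le_mul_of_nonneg_left (by linarith) hMf0)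
  have h2 : wLen j u t ≤ Mj * massF u 0 :=
    (hfl.wLen_le ht hj hMj).trans (mul_le_mul_of_nonneg_left (by linarith) hMj0)
  have h3 := mul_log_le (hfl.wArea_pos hf hfpos ht) h1 hρ0.le hρ.2.le
  have h4 := mul_log_le (hfl.wLen_pos hj hjpos ht) h2
    (by positivity : 0 ≤ 2 * (π - ρ t)) (by linarith : 2 * (π - ρ t) ≤ 2 * π)
  have h5 := neg_mul_log_le_one (by positivity : 0 < 2 * ρ t)
  have h6 := neg_mul_log_le_one (by positivity : 0 < 2 * (π - ρ t))
  rw [energyF] at hE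
  linarith

end flow

/-- Uniform lower bounds on the conformal area and boundary length along the flow,
independent of `T`. -/
theorem flow_volume_lower_bounds (f j : ℂ → ℝ)
    (hf : ContDiffOn ℝ (⊤ : ℕ∞) f cdisc) (hfpos : ∀ z ∈ cdisc, 0 < f z)
    (hj : ContDiffOn ℝ (⊤ : ℕ∞) j bdry) (hjpos : ∀ z ∈ bdry, 0 < j z)
    (u₀ : ℂ → ℝ) (hu₀ : ContDiffOn ℝ (⊤ : ℕ∞) u₀ cdisc)
    (ρ₀ : ℝ) (hρ₀ : ρ₀ ∈ Set.Ioo 0 Real.pi) :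
    ∃ c d : ℝ, 0 < c ∧ 0 < d ∧
      ∀ (T : ℝ≥0∞), 0 < T → ∀ (u : ℂ → ℝ → ℝ) (ρ : ℝ → ℝ), IsFlow f j T u ρ →
        (∀ z ∈ cdisc, u z 0 = u₀ z) → ρ 0 = ρ₀ →
        ∀ t : ℝ, 0 ≤ t → ENNReal.ofReal t < T →
          c ≤ ballInt (fun z => Real.exp (2 * u z t)) ∧
          d ≤ circInt (fun z => Real.exp (u z t)) := by
  obtain ⟨Mf, hMf⟩ := isCompact_cdisc.exists_bound_of_continuousOn hf.continuousOn
  obtain ⟨Mj, hMj⟩ := isCompact_bdry.exists_bound_of_continuousOn hj.continuousOn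
  set m := massF (fun z _ => u₀ z) 0 with hm
  have hu₀b := hu₀.continuousOn.mono bdry_subset_cdisc
  have hm0 : 0 < m := by
    have h1 : 0 < wArea (fun _ => 1) (fun z _ => u₀ z) 0 :=
      integral_pos_of_continuousOn isCompact_cdisc discM_compl
        (by rw [discM_univ]; exact Real.pi_pos) (continuousOn_const.mul
          (Real.continuous_exp.comp_continuousOn (continuousOn_const.mul hu₀.continuousOn)))
        fun z _ => by positivity
    have h2 : 0 < wLen (fun _ => 1) (fun z _ => u₀ z) 0 :=
      integral_pos_of_continuousOn isCompact_bdry circM_compl_bdry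
        (by rw [circM_univ]; exact Real.two_pi_pos) (continuousOn_const.mul
          (Real.continuous_exp.comp_continuousOn hu₀b)) fun z _ => by positivity
    rw [hm, massF]; linarith
  set C₀ := energyF f j (fun z _ => u₀ z) (fun _ => ρ₀) 0 + π * |Real.log (|Mf| * (2 * m))| +
      2 * π * |Real.log (|Mj| * m)| + 2 with hC₀
  obtain ⟨c, hc, hclow⟩ := exists_area_lower C₀ (m / 2) (by positivity)
  obtain ⟨d, hd, hdlow⟩ := exists_length_lower C₀ m hm0
  refine ⟨min c m, min d (m / 2), lt_min hc hm0, lt_min hd (by positivity), ?_⟩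
  intro T hT u ρ hfl hu hρ t ht htT
  have htD : t ∈ flowDom T := ⟨ht, htT⟩
  have hmass : massF u 0 = m := by
    rw [hm, massF, massF, wArea_congr _ (v := fun z _ => u₀ z) hu,
      wLen_congr _ (v := fun z _ => u₀ z) hu]
  have henergy : energyF f j u ρ 0 = energyF f j (fun z _ => u₀ z) (fun _ => ρ₀) 0 := by
    rw [energyF, energyF, wArea_congr _ (v := fun z _ => u₀ z) hu,
      wLen_congr _ (v := fun z _ => u₀ z) hu, En_congr hu, hρ]
  have hEn : En (fun z => u z t) ≤ C₀ := by
    have := hfl.En_le hT hf.continuousOn hfpos hj.continuousOn hjpos htD (abs_nonneg Mf)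
      (abs_nonneg Mj) (fun z hz => (le_abs_self _).trans ((hMf z hz).trans (le_abs_self Mf)))
      (fun z hz => (le_abs_self _).trans ((hMj z hz).trans (le_abs_self Mj)))
    rwa [hmass, henergy] at this
  have hut := (hfl.smooth_slice htD).of_le one_le_smooth
  have hcons := hfl.massF_eq hT hf.continuousOn hfpos hj.continuousOn hjpos htD
  rw [hmass] at hcons
  simp only [massF, wArea, wLen, one_mul] at hcons
  have hcirc : circInt (fun z => Real.exp (u z t)) = ∫ z, Real.exp (u z t) ∂circM :=
    circInt_eq (Real.continuous_exp.comp_continuousOn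
      (hut.continuousOn.mono bdry_subset_cdisc))
  rw [ballInt_eq, hcirc]
  rcases le_or_gt (m / 2) (∫ z, Real.exp (u z t) ∂circM) with h | h
  · exact ⟨(min_le_left _ _).trans (hclow _ hut hEn h), (min_le_right _ _).trans h⟩
  · have hA : m ≤ ∫ z, Real.exp (2 * u z t) ∂discM := by linarith
    exact ⟨(min_le_right _ _).trans hA, (min_le_left _ _).trans (hdlow _ hut hEn hA)⟩
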